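/- Assume additionally that j(·,z) is continuous on ℝ^d for every z. Let u be a bounded usc viscosity subsolution and v a bounded lsc viscosity supersolution of F(x,w,∇w,D²w,I_LI[x,w]) = 0 on ℝ^d, and let φ:ℝ^d×ℝ^d→ℝ be C². Suppose (x̄,ȳ) is a global maximum point of (x,y) ↦ u(x)−v(y)−φ(x,y). Set p := D_xφ(x̄,ȳ), q := −D_yφ(x̄,ȳ) and φ_α(x,y) := R^α_⊗[φ]((x,y),(p,−q)). Then for every δ∈(0,1) there exists ᾱ>0 such that for every 0<α<ᾱ there exist symmetric matrices X,Y∈S^d with: F(x̄, u(x̄), p, X, I^{1,δ}[x̄, φ_α(·,ȳ)] + I^{2,δ}[x̄, p, u]) ≤ 0; F(ȳ, v(ȳ), q, Y, I^{1,δ}[ȳ, −φ_α(x̄,·)] + I^{2,δ}[ȳ, q, v]) ≥ 0; and −(1/α)·I_{2d} ≤ [[X,0],[0,−Y]] ≤ D²φ_α(x̄,ȳ) in S^{2d}, where moreover D²φ_α(x̄,ȳ) → D²φ(x̄,ȳ) as α→0⁺. -/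

import Mathlib

open scoped RealInnerProductSpace
open Filter Metric MeasureTheory Topology

/-- The Lévy–Itô operator `I_LI[x,φ]`. -/
noncomputable def ILI {d : ℕ} (μ : Measure (EuclideanSpace ℝ (Fin d)))
    (j : EuclideanSpace ℝ (Fin d) → EuclideanSpace ℝ (Fin d) → EuclideanSpace ℝ (Fin d))
    (x : EuclideanSpace ℝ (Fin d)) (φ : EuclideanSpace ℝ (Fin d) → ℝ) : ℝ :=
  ∫ z, (φ (x + j x z) - φ x -
    ⟪gradient φ x, j x z⟫ *
      (closedBall (0 : EuclideanSpace ℝ (Fin d)) 1).indicator (fun _ => (1:ℝ)) z) ∂μ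

/-- The small-jumps part `I^{1,δ}[x,φ]`. -/
noncomputable def I1 {d : ℕ} (μ : Measure (EuclideanSpace ℝ (Fin d)))
    (j : EuclideanSpace ℝ (Fin d) → EuclideanSpace ℝ (Fin d) → EuclideanSpace ℝ (Fin d))
    (δ : ℝ) (x : EuclideanSpace ℝ (Fin d)) (φ : EuclideanSpace ℝ (Fin d) → ℝ) : ℝ :=
  ∫ z in {z : EuclideanSpace ℝ (Fin d) | ‖z‖ ≤ δ},
    (φ (x + j x z) - φ x - ⟪gradient φ x, j x z⟫) ∂μ

/-- The large-jumps part `I^{2,δ}[x,p,w]`. -/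
noncomputable def I2 {d : ℕ} (μ : Measure (EuclideanSpace ℝ (Fin d)))
    (j : EuclideanSpace ℝ (Fin d) → EuclideanSpace ℝ (Fin d) → EuclideanSpace ℝ (Fin d))
    (δ : ℝ) (x p : EuclideanSpace ℝ (Fin d)) (w : EuclideanSpace ℝ (Fin d) → ℝ) : ℝ :=
  ∫ z in {z : EuclideanSpace ℝ (Fin d) | δ < ‖z‖},
    (w (x + j x z) - w x -
      ⟪p, j x z⟫ * (closedBall (0 : EuclideanSpace ℝ (Fin d)) 1).indicator (fun _ => (1:ℝ)) z) ∂μ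

/-- The Hessian matrix of `φ` at `x`. -/
noncomputable def hessM {d : ℕ} (φ : EuclideanSpace ℝ (Fin d) → ℝ)
    (x : EuclideanSpace ℝ (Fin d)) : Matrix (Fin d) (Fin d) ℝ :=
  Matrix.of fun i j =>
    iteratedFDeriv ℝ 2 φ x ![EuclideanSpace.single i 1, EuclideanSpace.single j 1]

/-- Degenerate ellipticity of `F` (nonincreasing in the matrix and nonlocal slots). -/
def DegEll {d : ℕ}
    (F : EuclideanSpace ℝ (Fin d) → ℝ → EuclideanSpace ℝ (Fin d) →
      Matrix (Fin d) (Fin d) ℝ → ℝ → ℝ) : Prop :=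
  ∀ x u p (M N : Matrix (Fin d) (Fin d) ℝ) (l₁ l₂ : ℝ),
    (M - N).PosSemidef → l₂ ≤ l₁ → F x u p M l₁ ≤ F x u p N l₂

/-- `u` is a (bounded, usc) viscosity subsolution of `F(x,u,∇u,D²u,I_LI[x,u]) = 0`. -/
def IsSubsolution {d : ℕ}
    (F : EuclideanSpace ℝ (Fin d) → ℝ → EuclideanSpace ℝ (Fin d) →
      Matrix (Fin d) (Fin d) ℝ → ℝ → ℝ)
    (μ : Measure (EuclideanSpace ℝ (Fin d)))
    (j : EuclideanSpace ℝ (Fin d) → EuclideanSpace ℝ (Fin d) → EuclideanSpace ℝ (Fin d))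
    (u : EuclideanSpace ℝ (Fin d) → ℝ) : Prop :=
  ∀ φ : EuclideanSpace ℝ (Fin d) → ℝ, ContDiff ℝ 2 φ → (∃ C, ∀ y, |φ y| ≤ C) →
    ∀ x : EuclideanSpace ℝ (Fin d), (∀ y, u y - φ y ≤ u x - φ x) →
      F x (u x) (gradient φ x) (hessM φ x) (ILI μ j x φ) ≤ 0

/-- `v` is a (bounded, lsc) viscosity supersolution of `F(x,v,∇v,D²v,I_LI[x,v]) = 0`. -/
def IsSupersolution {d : ℕ}
    (F : EuclideanSpace ℝ (Fin d) → ℝ → EuclideanSpace ℝ (Fin d) →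
      Matrix (Fin d) (Fin d) ℝ → ℝ → ℝ)
    (μ : Measure (EuclideanSpace ℝ (Fin d)))
    (j : EuclideanSpace ℝ (Fin d) → EuclideanSpace ℝ (Fin d) → EuclideanSpace ℝ (Fin d))
    (v : EuclideanSpace ℝ (Fin d) → ℝ) : Prop :=
  ∀ φ : EuclideanSpace ℝ (Fin d) → ℝ, ContDiff ℝ 2 φ → (∃ C, ∀ y, |φ y| ≤ C) →
    ∀ x : EuclideanSpace ℝ (Fin d), (∀ y, v x - φ x ≤ v y - φ y) →
      F x (v x) (gradient φ x) (hessM φ x) (ILI μ j x φ) ≥ 0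

/-- Sup-convolution `R^α_⊗[φ]((x,y),(a,b))` for functions of two variables. -/
noncomputable def RsupP {d : ℕ} (φ : EuclideanSpace ℝ (Fin d) → EuclideanSpace ℝ (Fin d) → ℝ)
    (α : ℝ) (x y a b : EuclideanSpace ℝ (Fin d)) : ℝ :=
  sSup ((fun XY : EuclideanSpace ℝ (Fin d) × EuclideanSpace ℝ (Fin d) =>
      φ XY.1 XY.2 - ⟪a, XY.1 - x⟫ - ⟪b, XY.2 - y⟫ -
        (‖XY.1 - x‖ ^ 2 + ‖XY.2 - y‖ ^ 2) / (2 * α)) ''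
    (closedBall x 1 ×ˢ closedBall y 1))

/-- The quadratic form `z ↦ ⟨Az, z⟩` of a matrix `A`. -/
noncomputable def quadF {d : ℕ} (A : Matrix (Fin d) (Fin d) ℝ)
    (z : EuclideanSpace ℝ (Fin d)) : ℝ :=
  ⟪Matrix.toEuclideanLin A z, z⟫

section Subgradients

variable {V : Type*} [NormedAddCommGroup V] [InnerProductSpace ℝ V]

theorem subgradient_lipschitz_at_contact {f : V → ℝ} {η : V → V}
    (hη : ∀ z z', f z + ⟪η z, z' - z⟫ ≤ f z') {z : V} {C ρ : ℝ}
    (hC : ∀ z', ‖z' - z‖ ≤ ρ → f z' ≤ f z + ⟪η z, z' - z⟫ + C * ‖z' - z‖ ^ 2)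
    {z' : V} (hz' : ‖z' - z‖ ≤ ρ / 2) : ‖η z' - η z‖ ≤ 4 * C * ‖z' - z‖ := by
  rcases eq_or_ne z' z with rfl | hne
  · simp
  have hh : 0 < ‖z' - z‖ := norm_pos_iff.2 (sub_ne_zero.2 hne)
  have hCnn : 0 ≤ C := by
    have h1 := hC z' (by linarith)
    have h2 := hη z z'
    have : 0 ≤ C * ‖z' - z‖ ^ 2 := by linarith
    exact nonneg_of_mul_nonneg_left this (by positivity)
  rcases eq_or_ne (η z') (η z) with hg | hg
  · rw [hg, sub_self, norm_zero]; positivity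
  have hgp : 0 < ‖η z' - η z‖ := norm_pos_iff.2 (sub_ne_zero.2 hg)
  set g := η z' - η z with hgdef
  set e : V := (‖z' - z‖ / ‖g‖) • g with he
  have hen : ‖e‖ = ‖z' - z‖ := by
    rw [he, norm_smul, Real.norm_of_nonneg (by positivity)]
    field_simp
  have hge : ⟪g, e⟫ = ‖z' - z‖ * ‖g‖ := by
    rw [he, real_inner_smul_right, real_inner_self_eq_norm_sq]
    field_simp
  have hsum : ‖z' + e - z‖ ≤ 2 * ‖z' - z‖ := by
    have : z' + e - z = (z' - z) + e := by abel
    rw [this]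
    linarith [norm_add_le (z' - z) e]
  have h1 := hC (z' + e) (by linarith)
  have h2 := hη z z'
  have h3 := hη z' (z' + e)
  have h4 : z' + e - z = (z' - z) + e := by abel
  rw [add_sub_cancel_left] at h3
  have h5 : C * ‖z' + e - z‖ ^ 2 ≤ C * (2 * ‖z' - z‖) ^ 2 := by gcongr
  have h6 : ⟪η z, z' + e - z⟫ = ⟪η z, z' - z⟫ + ⟪η z, e⟫ := by rw [h4, inner_add_right]
  have h7 : ⟪g, e⟫ = ⟪η z', e⟫ - ⟪η z, e⟫ := by rw [hgdef, inner_sub_left]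
  have h8 : ‖z' - z‖ * ‖g‖ ≤ ‖z' - z‖ * (4 * C * ‖z' - z‖) := by nlinarith
  exact le_of_mul_le_mul_left h8 hh

theorem subgradient_monotone {f : V → ℝ} {η : V → V}
    (hη : ∀ z z', f z + ⟪η z, z' - z⟫ ≤ f z') (z z' : V) : 0 ≤ ⟪η z' - η z, z' - z⟫ := by
  have h1 := hη z z'
  have h2 := hη z' z
  have h3 : ⟪η z', z - z'⟫ = -⟪η z', z' - z⟫ := by rw [← inner_neg_right, neg_sub]
  rw [inner_sub_left]
  linarith

theorem exists_lipschitz_resolvent [FiniteDimensional ℝ V] {f : V → ℝ} {η : V → V}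
    (hη : ∀ z z', f z + ⟪η z, z' - z⟫ ≤ f z') :
    ∃ Z : V → V, (∃ K, LipschitzWith K Z) ∧ ∀ z, Z (z + η z) = z := by
  have key : ∀ z z', ‖z' - z‖ ≤ ‖(z' + η z') - (z + η z)‖ := by
    intro z z'
    have h1 := subgradient_monotone hη z z'
    have h2 : (z' + η z') - (z + η z) = (z' - z) + (η z' - η z) := by abel
    have h3 : ‖z' - z‖ ^ 2 ≤ ‖(z' + η z') - (z + η z)‖ ^ 2 := by
      rw [h2, norm_add_sq_real, real_inner_comm]
      nlinarith [sq_nonneg ‖η z' - η z‖]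
    exact (sq_le_sq₀ (norm_nonneg _) (norm_nonneg _)).1 h3
  have hinj : Function.Injective fun z => z + η z := by
    intro z z' h
    have h1 := key z z'
    simp only at h
    rw [h, sub_self, norm_zero] at h1
    exact (sub_eq_zero.1 (norm_le_zero_iff.1 h1)).symm
  have hL : LipschitzOnWith 1 (Function.invFun fun z => z + η z)
      (Set.range fun z => z + η z) := by
    refine LipschitzOnWith.of_dist_le_mul ?_
    rintro _ ⟨a, rfl⟩ _ ⟨b, rfl⟩
    rw [Function.leftInverse_invFun hinj a, Function.leftInverse_invFun hinj b, dist_eq_norm,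
      dist_eq_norm]
    simpa using key b a
  obtain ⟨g, hg, hgE⟩ := hL.extend_finite_dimension
  refine ⟨g, ⟨_, hg⟩, fun z => ?_⟩
  rw [← hgE ⟨z, rfl⟩]
  exact Function.leftInverse_invFun hinj z

theorem exists_linear_approx_subgradient [FiniteDimensional ℝ V] {η Z : V → V} {D : V →L[ℝ] V}
    {z : V} (hD : HasFDerivAt Z D (z + η z)) (hZ : ∀ z, Z (z + η z) = z) {K ρ : ℝ} (hK : 0 ≤ K)
    (hρ : 0 < ρ) (hL : ∀ z', ‖z' - z‖ ≤ ρ → ‖η z' - η z‖ ≤ K * ‖z' - z‖) :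
    ∃ B : V →L[ℝ] V, ∀ ε > 0, ∃ r > 0, ∀ z', ‖z' - z‖ ≤ r →
      ‖η z' - η z - B (z' - z)‖ ≤ ε * ‖z' - z‖ := by
  have key : ∀ c > 0, ∃ r > 0, ∀ z', ‖z' - z‖ ≤ r →
      ‖(z' - z) - D ((z' - z) + (η z' - η z))‖ ≤ c * ‖z' - z‖ := by
    intro c hc
    have h1 := (hasFDerivAt_iff_isLittleO.1 hD).def (show 0 < c / (1 + K) by positivity)
    obtain ⟨r, hr, h2⟩ := Metric.eventually_nhds_iff.1 h1
    refine ⟨min ρ (r / (2 * (1 + K))), by positivity, fun z' hz' => ?_⟩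
    have h3 := hL z' (hz'.trans (min_le_left _ _))
    have h4 : (z' + η z') - (z + η z) = (z' - z) + (η z' - η z) := by abel
    have h5 : ‖(z' - z) + (η z' - η z)‖ ≤ (1 + K) * ‖z' - z‖ := by
      linarith [norm_add_le (z' - z) (η z' - η z)]
    have h6 : (1 + K) * ‖z' - z‖ < r := by
      have := hz'.trans (min_le_right _ _)
      rw [le_div_iff₀ (by positivity)] at this
      nlinarith
    have h7 := @h2 (z' + η z') (by rw [dist_eq_norm, h4]; linarith)
    rw [hZ, hZ, h4] at h7
    refine h7.trans ?_
    calc c / (1 + K) * ‖(z' - z) + (η z' - η z)‖ ≤ c / (1 + K) * ((1 + K) * ‖z' - z‖) := by gcongr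
      _ = c * ‖z' - z‖ := by field_simp
  have hsurj : Function.Surjective D := by
    intro h
    have hcl : IsClosed (D.range : Set V) := Submodule.closed_of_finiteDimensional _
    have : h ∈ closure (D.range : Set V) := by
      rw [Metric.mem_closure_iff]
      intro ε hε
      obtain ⟨r, hr, h1⟩ := key (ε / (2 * (‖h‖ + 1))) (by positivity)
      set t := r / (‖h‖ + 1) with ht
      have htp : 0 < t := by positivity
      have h2 := h1 (z + t • h) (by
        rw [add_sub_cancel_left, norm_smul, Real.norm_of_nonneg htp.le, ht, div_mul_eq_mul_div,
          div_le_iff₀ (by positivity)]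
        nlinarith)
      rw [add_sub_cancel_left] at h2
      refine ⟨D (t⁻¹ • (t • h + (η (z + t • h) - η z))), ⟨_, rfl⟩, ?_⟩
      have h3 : h - D (t⁻¹ • (t • h + (η (z + t • h) - η z))) =
          t⁻¹ • (t • h - D (t • h + (η (z + t • h) - η z))) := by
        rw [smul_sub, smul_smul, inv_mul_cancel₀ htp.ne', one_smul, map_smul]
      rw [dist_eq_norm, h3, norm_smul, norm_inv, Real.norm_of_nonneg htp.le]
      rw [norm_smul, Real.norm_of_nonneg htp.le] at h2
      calc t⁻¹ * _ ≤ t⁻¹ * (ε / (2 * (‖h‖ + 1)) * (t * ‖h‖)) := by gcongr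
        _ = ε * (‖h‖ / (2 * (‖h‖ + 1))) := by field_simp
        _ < ε * 1 := by
          gcongr
          rw [div_lt_one (by positivity)]
          linarith [norm_nonneg h]
        _ = ε := mul_one _
    rw [hcl.closure_eq] at this
    exact this
  have hinj : Function.Injective D :=
    (LinearMap.injective_iff_surjective (f := (D : V →ₗ[ℝ] V))).2 hsurj
  let e : V ≃L[ℝ] V :=
    (LinearEquiv.ofBijective (D : V →ₗ[ℝ] V) ⟨hinj, hsurj⟩).toContinuousLinearEquiv
  have he : ∀ x, e.symm (D x) = x := fun x => e.symm_apply_apply x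
  refine ⟨(e.symm : V →L[ℝ] V) - ContinuousLinearMap.id ℝ V, fun ε hε => ?_⟩
  obtain ⟨r, hr, h1⟩ := key (ε / (‖(e.symm : V →L[ℝ] V)‖ + 1)) (by positivity)
  refine ⟨r, hr, fun z' hz' => ?_⟩
  have h2 := h1 z' hz'
  have h3 : η z' - η z - ((e.symm : V →L[ℝ] V) - ContinuousLinearMap.id ℝ V) (z' - z) =
      -(e.symm : V →L[ℝ] V) ((z' - z) - D ((z' - z) + (η z' - η z))) := by
    rw [map_sub (e.symm : V →L[ℝ] V)]
    have : (e.symm : V →L[ℝ] V) (D ((z' - z) + (η z' - η z))) = (z' - z) + (η z' - η z) := he _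
    rw [this]
    simp only [sub_apply, ContinuousLinearMap.id_apply]
    abel
  rw [h3, norm_neg]
  refine ((e.symm : V →L[ℝ] V).le_opNorm _).trans ?_
  calc ‖(e.symm : V →L[ℝ] V)‖ * _ ≤ (‖(e.symm : V →L[ℝ] V)‖ + 1) *
        (ε / (‖(e.symm : V →L[ℝ] V)‖ + 1) * ‖z' - z‖) := by
        gcongr
        linarith
    _ = ε * ‖z' - z‖ := by field_simp

theorem second_order_expansion_of_subgradient {f : V → ℝ} {η : V → V}
    (hη : ∀ z z', f z + ⟪η z, z' - z⟫ ≤ f z') {z : V} {B : V →L[ℝ] V}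
    (hB : ∀ ε > 0, ∃ r > 0, ∀ z', ‖z' - z‖ ≤ r →
      ‖η z' - η z - B (z' - z)‖ ≤ ε * ‖z' - z‖) :
    ∀ ε > 0, ∃ r > 0, ∀ h, ‖h‖ ≤ r →
      |f (z + h) - f z - ⟪η z, h⟫ - 1 / 2 * ⟪B h, h⟫| ≤ ε * ‖h‖ ^ 2 := by
  intro ε hε
  obtain ⟨r, hr, h1⟩ := hB ε hε
  refine ⟨r, hr, fun h hh => ?_⟩
  set b := ⟪B h, h⟫ with hb
  have herr : ∀ t : ℝ, 0 ≤ t → t ≤ 1 →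
      |⟪η (z + t • h), h⟫ - ⟪η z, h⟫ - t * b| ≤ ε * ‖h‖ ^ 2 := by
    intro t ht0 ht1
    have h2 : ‖t • h‖ ≤ ‖h‖ := by
      rw [norm_smul, Real.norm_of_nonneg ht0]
      nlinarith [norm_nonneg h]
    have h3 := h1 (z + t • h) (by rw [add_sub_cancel_left]; exact h2.trans hh)
    rw [add_sub_cancel_left] at h3
    have h4 : ⟪η (z + t • h), h⟫ - ⟪η z, h⟫ - t * b =
        ⟪η (z + t • h) - η z - B (t • h), h⟫ := by
      rw [inner_sub_left, inner_sub_left, map_smul, real_inner_smul_left]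
    rw [h4]
    calc _ ≤ ‖η (z + t • h) - η z - B (t • h)‖ * ‖h‖ := abs_real_inner_le_norm _ _
      _ ≤ (ε * ‖h‖) * ‖h‖ := by gcongr; exact h3.trans (by gcongr)
      _ = ε * ‖h‖ ^ 2 := by ring
  have hstep : ∀ s t : ℝ, f (z + s • h) + (t - s) * ⟪η (z + s • h), h⟫ ≤ f (z + t • h) := by
    intro s t
    have := hη (z + s • h) (z + t • h)
    rwa [add_sub_add_left_eq_sub, ← sub_smul, real_inner_smul_right] at this
  have hind : ∀ N : ℕ, 0 < N → ∀ k : ℕ, k ≤ N →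
      |f (z + ((k : ℝ) / N) • h) - f z - k / N * ⟪η z, h⟫ - k ^ 2 / (2 * N ^ 2) * b| ≤
        k / N * (ε * ‖h‖ ^ 2) + k / (2 * N ^ 2) * |b| := by
    intro N hN k
    have hN' : (0 : ℝ) < N := by exact_mod_cast hN
    induction k with
    | zero => intro _; simp
    | succ k ih =>
      intro hk
      have ih := ih (by omega)
      have hk' : (k : ℝ) + 1 ≤ N := by exact_mod_cast hk
      have h2 := hstep (k / N) ((k + 1) / N)
      have h3 := hstep ((k + 1) / N) (k / N)
      have h4 := herr (k / N) (by positivity) (by rw [div_le_one hN']; linarith)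
      have h5 := herr ((k + 1) / N) (by positivity) (by rw [div_le_one hN']; linarith)
      have h6 : ((k : ℝ) + 1) / N - k / N = 1 / N := by ring
      have h6' : (k : ℝ) / N - (k + 1) / N = -(1 / N) := by ring
      rw [h6] at h2
      rw [h6'] at h3
      push_cast
      set i : ℝ := 1 / N with hi
      have hip : 0 < i := by positivity
      have hd : ∀ x : ℝ, x / N = x * i := fun x => by rw [hi]; ring
      have hd2 : ∀ x : ℝ, x / (2 * N ^ 2) = x * i ^ 2 / 2 := fun x => by
        rw [hi]; field_simp
      simp only [hd, hd2] at ih h2 h3 h4 h5 ⊢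
      set E := ε * ‖h‖ ^ 2
      rw [abs_le] at ih h4 h5 ⊢
      have g1 := mul_le_mul_of_nonneg_left h4.1 hip.le
      have g2 := mul_le_mul_of_nonneg_left h5.2 hip.le
      have g3 : i ^ 2 * b ≤ i ^ 2 * |b| := by gcongr; exact le_abs_self b
      have g4 : i ^ 2 * (-b) ≤ i ^ 2 * |b| := by gcongr; exact neg_le_abs b
      constructor
      · nlinarith [ih.1]
      · nlinarith [ih.2]
  have hlim : ∀ᶠ N : ℕ in atTop, |f (z + h) - f z - ⟪η z, h⟫ - 1 / 2 * b| ≤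
      ε * ‖h‖ ^ 2 + 1 / (2 * (N : ℝ)) * |b| := by
    filter_upwards [eventually_gt_atTop 0] with N hN
    have hN' : (0 : ℝ) < N := by exact_mod_cast hN
    have := hind N hN N le_rfl
    rw [div_self hN'.ne', one_smul, one_mul, one_mul] at this
    convert this using 3
    · field_simp
    · field_simp
  have ht : Tendsto (fun N : ℕ => ε * ‖h‖ ^ 2 + 1 / (2 * (N : ℝ)) * |b|) atTop
      (𝓝 (ε * ‖h‖ ^ 2 + 0 * |b|)) := by
    refine tendsto_const_nhds.add (Tendsto.mul_const _ ?_)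
    have := (tendsto_one_div_atTop_nhds_zero_nat (𝕜 := ℝ)).const_mul (1 / 2)
    rw [mul_zero] at this
    refine this.congr fun N => ?_
    ring
  rw [zero_mul, add_zero] at ht
  exact ge_of_tendsto ht hlim

end Subgradients

section Contact

variable {V : Type*} [NormedAddCommGroup V] [InnerProductSpace ℝ V]

theorem continuous_of_subgradients [FiniteDimensional ℝ V] {f : V → ℝ} {η : V → V}
    (hη : ∀ z z', f z + ⟪η z, z' - z⟫ ≤ f z') : Continuous f := by
  have hconv : ConvexOn ℝ Set.univ f := by
    refine ⟨convex_univ, fun x _ y _ a b ha hb hab => ?_⟩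
    have h1 := mul_le_mul_of_nonneg_left (hη (a • x + b • y) x) ha
    have h2 := mul_le_mul_of_nonneg_left (hη (a • x + b • y) y) hb
    have h3 : a * ⟪η (a • x + b • y), x - (a • x + b • y)⟫ +
        b * ⟪η (a • x + b • y), y - (a • x + b • y)⟫ = 0 := by
      rw [← real_inner_smul_right, ← real_inner_smul_right, ← inner_add_right]
      have : a • (x - (a • x + b • y)) + b • (y - (a • x + b • y)) =
          (1 - (a + b)) • (a • x + b • y) := by module
      rw [this, hab, sub_self, zero_smul, inner_zero_right]
    simp only [smul_eq_mul]
    have h4 : a * f (a • x + b • y) + b * f (a • x + b • y) = f (a • x + b • y) := by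
      rw [← add_mul, hab, one_mul]
    linarith
  exact continuousOn_univ.1 (hconv.continuousOn isOpen_univ)

theorem ContDiffAt.gradient_contDiffAt [CompleteSpace V] {Ψ : V → ℝ} {z : V}
    (h : ContDiffAt ℝ 2 Ψ z) : ContDiffAt ℝ 1 (gradient Ψ) z :=
  ((InnerProductSpace.toDual ℝ V).symm.toContinuousLinearEquiv.contDiff.contDiffAt).comp z
    (h.fderiv_right (m := 1) (by norm_num))

theorem second_order_taylor {Ψ : V → ℝ} {z : V} (hΨ : ContDiffAt ℝ 2 Ψ z) :
    ∀ ε > 0, ∃ r > 0, ∀ h, ‖h‖ ≤ r →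
      |Ψ (z + h) - Ψ z - fderiv ℝ Ψ z h - 1 / 2 * fderiv ℝ (fderiv ℝ Ψ) z h h| ≤
        ε * ‖h‖ ^ 2 := by
  intro ε hε
  have hd : HasFDerivAt (fderiv ℝ Ψ) (fderiv ℝ (fderiv ℝ Ψ) z) z :=
    ((hΨ.fderiv_right (m := 1) (by norm_num)).differentiableAt (by norm_num)).hasFDerivAt
  have h1 := (hasFDerivAt_iff_isLittleO.1 hd).def hε
  have h2 : ∀ᶠ y in 𝓝 z, ContDiffAt ℝ 2 Ψ y := hΨ.eventually (by simp)
  obtain ⟨r, hr, h3⟩ := Metric.eventually_nhds_iff.1 (h1.and h2)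
  refine ⟨r / 2, by positivity, fun h hh => ?_⟩
  set D2 := fderiv ℝ (fderiv ℝ Ψ) z
  have hmem : ∀ t ∈ Set.Icc (0 : ℝ) 1, dist (z + t • h) z < r := by
    intro t ht
    rw [dist_eq_norm, add_sub_cancel_left, norm_smul, Real.norm_of_nonneg ht.1]
    nlinarith [norm_nonneg h, ht.2]
  have hder : ∀ t ∈ Set.Icc (0 : ℝ) 1, HasDerivWithinAt
      (fun t : ℝ => Ψ (z + t • h) - t * fderiv ℝ Ψ z h - t ^ 2 / 2 * D2 h h)
      (fderiv ℝ Ψ (z + t • h) h - fderiv ℝ Ψ z h - t * D2 h h) (Set.Icc 0 1) t := by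
    intro t ht
    have g1 : HasFDerivAt Ψ (fderiv ℝ Ψ (z + t • h)) (z + t • h) :=
      ((h3 (hmem t ht)).2.differentiableAt (by norm_num)).hasFDerivAt
    have g2 : HasDerivAt (fun t : ℝ => z + t • h) h t := by
      simpa using ((hasDerivAt_id t).smul_const h).const_add z
    have g3 := g1.comp_hasDerivAt t g2
    have g4 : HasDerivAt (fun t : ℝ => t * fderiv ℝ Ψ z h) (fderiv ℝ Ψ z h) t := by
      simpa using (hasDerivAt_id t).mul_const (fderiv ℝ Ψ z h)
    have g5 : HasDerivAt (fun t : ℝ => t ^ 2 / 2 * D2 h h) (t * D2 h h) t := by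
      have := ((hasDerivAt_pow 2 t).div_const 2).mul_const (D2 h h)
      refine this.congr_deriv ?_
      norm_num
    exact ((g3.sub g4).sub g5).hasDerivWithinAt
  have hbd : ∀ t ∈ Set.Ico (0 : ℝ) 1,
      ‖fderiv ℝ Ψ (z + t • h) h - fderiv ℝ Ψ z h - t * D2 h h‖ ≤ ε * ‖h‖ ^ 2 := by
    intro t ht
    have g1 := (h3 (hmem t ⟨ht.1, ht.2.le⟩)).1
    rw [add_sub_cancel_left] at g1
    have g2 : fderiv ℝ Ψ (z + t • h) h - fderiv ℝ Ψ z h - t * D2 h h =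
        (fderiv ℝ Ψ (z + t • h) - fderiv ℝ Ψ z - D2 (t • h)) h := by
      simp
    have g3 : ‖t • h‖ ≤ ‖h‖ := by
      rw [norm_smul, Real.norm_of_nonneg ht.1]
      nlinarith [norm_nonneg h, ht.2]
    rw [g2]
    calc _ ≤ ‖fderiv ℝ Ψ (z + t • h) - fderiv ℝ Ψ z - D2 (t • h)‖ * ‖h‖ :=
          ContinuousLinearMap.le_opNorm _ _
      _ ≤ (ε * ‖h‖) * ‖h‖ := by gcongr; exact g1.trans (by gcongr)
      _ = ε * ‖h‖ ^ 2 := by ring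
  have := norm_image_sub_le_of_norm_deriv_le_segment_01' hder hbd
  rw [Real.norm_eq_abs] at this
  convert this using 2
  simp
  ring

theorem le_of_second_order_bounds {q₁ q₂ : V → ℝ} (h₁ : ∀ (t : ℝ) h, q₁ (t • h) = t ^ 2 * q₁ h)
    (h₂ : ∀ (t : ℝ) h, q₂ (t • h) = t ^ 2 * q₂ h)
    (H : ∀ ε > 0, ∃ r > 0, ∀ h, ‖h‖ ≤ r → q₁ h ≤ q₂ h + ε * ‖h‖ ^ 2) (h : V) : q₁ h ≤ q₂ h := by
  refine le_of_forall_pos_le_add fun ε hε => ?_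
  obtain ⟨r, hr, h3⟩ := H (ε / (‖h‖ ^ 2 + 1)) (by positivity)
  set t := r / (‖h‖ + 1) with ht
  have htp : 0 < t := by positivity
  have h4 := h3 (t • h) (by
    rw [norm_smul, Real.norm_of_nonneg htp.le, ht, div_mul_eq_mul_div,
      div_le_iff₀ (by positivity)]
    nlinarith)
  rw [h₁, h₂, norm_smul, Real.norm_of_nonneg htp.le] at h4
  have h5 : t ^ 2 * q₁ h ≤ t ^ 2 * (q₂ h + ε / (‖h‖ ^ 2 + 1) * ‖h‖ ^ 2) := by nlinarith
  have h6 := le_of_mul_le_mul_left h5 (by positivity)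
  have h7 : ε / (‖h‖ ^ 2 + 1) * ‖h‖ ^ 2 ≤ ε := by
    rw [div_mul_eq_mul_div, div_le_iff₀ (by positivity)]
    nlinarith
  linarith

theorem exists_differentiableAt_of_lipschitzOn_cover [FiniteDimensional ℝ V] {Z : V → V}
    (hZ : ∃ K, LipschitzWith K Z) {T : V → V} {S : Set V} (hT : ∃ K, LipschitzOnWith K T S)
    {σ : ℝ} (hσ : 0 < σ) (p : V → Prop) (hp : ∀ r ∈ ball (0 : V) σ, ∃ s ∈ S, T s = r ∧ p s) :
    ∃ s ∈ S, T s ∈ ball (0 : V) σ ∧ p s ∧ DifferentiableAt ℝ Z s := by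
  borelize V
  obtain ⟨K, hZ⟩ := hZ
  obtain ⟨K', hT⟩ := hT
  by_contra! hcon
  set N := {s | ¬ DifferentiableAt ℝ Z s} with hN
  have hN0 : Measure.hausdorffMeasure (Module.finrank ℝ V : ℝ) N = 0 :=
    ae_iff.1 (hZ.ae_differentiableAt (μ := Measure.hausdorffMeasure (Module.finrank ℝ V : ℝ)))
  have hsub : ball (0 : V) σ ⊆ T '' (S ∩ N) := by
    intro r hr
    obtain ⟨s, hs, hTs, hps⟩ := hp r hr
    exact ⟨s, ⟨hs, hcon s hs (hTs ▸ hr) hps⟩, hTs⟩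
  have h1 := (hT.mono (Set.inter_subset_left (t := N))).hausdorffMeasure_image_le
    (d := (Module.finrank ℝ V : ℝ)) (by positivity)
  have h2 : Measure.hausdorffMeasure (Module.finrank ℝ V : ℝ) (S ∩ N) = 0 :=
    measure_mono_null Set.inter_subset_right hN0
  rw [h2, mul_zero] at h1
  have h3 := (measure_mono hsub).trans h1
  exact absurd h3 (not_le.2 (measure_ball_pos _ _ hσ))

theorem jensen_contact_points [FiniteDimensional ℝ V] {f Ψ : V → ℝ} {η : V → V}
    (hη : ∀ z z', f z + ⟪η z, z' - z⟫ ≤ f z') {z₀ : V} {R : ℝ} (hR : 0 < R)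
    (hΨc : ContinuousOn Ψ (closedBall z₀ R)) (hΨ : ContDiffAt ℝ 2 Ψ z₀)
    (hle : ∀ z ∈ closedBall z₀ R, f z ≤ Ψ z) (h0 : f z₀ = Ψ z₀) {ε : ℝ} (hε : 0 < ε) :
    ∃ z r : V, ∃ B : V →L[ℝ] V, ‖z - z₀‖ ≤ ε ∧ ‖r‖ ≤ ε ∧
      η z = gradient Ψ z + (2 * ε) • (z - z₀) + r ∧
      (∀ z' ∈ closedBall z₀ R, f z' - f z - ⟪η z, z' - z⟫ ≤
        Ψ z' - Ψ z - ⟪gradient Ψ z, z' - z⟫ + ε * ‖z' - z‖ ^ 2) ∧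
      ∀ ε' > 0, ∃ ρ > 0, ∀ h, ‖h‖ ≤ ρ →
        |f (z + h) - f z - ⟪η z, h⟫ - 1 / 2 * ⟪B h, h⟫| ≤ ε' * ‖h‖ ^ 2 := by
  have hfc := continuous_of_subgradients hη
  obtain ⟨Z, hZL, hZ⟩ := exists_lipschitz_resolvent hη
  obtain ⟨K, s, hs, hKs⟩ := hΨ.gradient_contDiffAt.exists_lipschitzOnWith
  have hev : ∀ᶠ y in 𝓝 z₀, ContDiffAt ℝ 2 Ψ y := hΨ.eventually (by simp)
  obtain ⟨ρ', hρ', hball⟩ := Metric.eventually_nhds_iff_ball.1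
    (hev.and (eventually_mem_set.2 hs))
  set ρ := min ρ' R / 2 with hρdef
  have hρ : 0 < ρ := by positivity
  have hρρ' : ρ < ρ' := by
    have := min_le_left ρ' R
    have : 0 < min ρ' R := by positivity
    linarith
  have hρR : ρ < R := by
    have := min_le_right ρ' R
    have : 0 < min ρ' R := by positivity
    linarith
  set G := gradient Ψ with hG
  set τ := min (ρ / 2) ε with hτ
  have hτp : 0 < τ := by positivity
  set σ := min ε (ε * τ) with hσ
  have hσp : 0 < σ := by positivity
  have hτρ : τ ≤ ρ / 2 := min_le_left _ _
  set p : V → V → Prop := fun z r => ‖z - z₀‖ ≤ τ ∧ ∀ z' ∈ closedBall z₀ R,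
    f z' - Ψ z' - ε * ‖z' - z₀‖ ^ 2 - ⟪r, z' - z₀⟫ ≤
      f z - Ψ z - ε * ‖z - z₀‖ ^ 2 - ⟪r, z - z₀⟫ with hp
  have hexp : ∀ r ∈ ball (0 : V) σ, ∃ z, p z r := by
    intro r hr
    rw [mem_ball_zero_iff] at hr
    have hcont : ContinuousOn
        (fun z' => f z' - Ψ z' - ε * ‖z' - z₀‖ ^ 2 - ⟪r, z' - z₀⟫) (closedBall z₀ R) := by
      refine ((hfc.continuousOn.sub hΨc).sub ?_).sub ?_ <;> fun_prop
    obtain ⟨z, hz, hmax⟩ := (isCompact_closedBall z₀ R).exists_isMaxOn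
      ⟨z₀, mem_closedBall_self hR.le⟩ hcont
    refine ⟨z, ?_, fun z' hz' => hmax hz'⟩
    have h1 := hmax (mem_closedBall_self hR.le)
    simp only [Set.mem_ofPred_eq, sub_self, norm_zero, inner_zero_right, h0] at h1
    have h2 := hle z hz
    have h3 : -⟪r, z - z₀⟫ ≤ ‖r‖ * ‖z - z₀‖ :=
      (neg_le_abs _).trans (abs_real_inner_le_norm _ _)
    have h4 : ε * ‖z - z₀‖ ^ 2 ≤ (ε * τ) * ‖z - z₀‖ := by
      have : ‖r‖ * ‖z - z₀‖ ≤ (ε * τ) * ‖z - z₀‖ := by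
        gcongr
        exact hr.le.trans (min_le_right _ _)
      linarith
    by_contra! hlt
    have : 0 < ‖z - z₀‖ := hτp.trans hlt
    nlinarith [mul_pos hε this]
  have hpη : ∀ z r, p z r → η z = G z + (2 * ε) • (z - z₀) + r := by
    intro z r hpz
    have hzb : z ∈ ball z₀ ρ' := by
      rw [mem_ball_iff_norm]; linarith [hpz.1]
    have hd : HasFDerivAt Ψ (fderiv ℝ Ψ z) z :=
      ((hball z hzb).1.differentiableAt (by norm_num)).hasFDerivAt
    have hmin : IsLocalMin
        (fun z' => Ψ z' + ε * ‖z' - z₀‖ ^ 2 + ⟪r, z' - z₀⟫ - ⟪η z, z'⟫) z := by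
      have hnb : closedBall z₀ R ∈ 𝓝 z := by
        refine mem_of_superset (isOpen_ball.mem_nhds (x := z) (s := ball z₀ R) ?_)
          ball_subset_closedBall
        rw [mem_ball_iff_norm]; linarith [hpz.1]
      filter_upwards [hnb] with z' hz'
      have h1 := hpz.2 z' hz'
      have h2 := hη z z'
      rw [inner_sub_right (η z)] at h2
      linarith
    have g1 : HasFDerivAt (fun z' : V => ‖z' - z₀‖ ^ 2) (2 • innerSL ℝ (z - z₀)) z := by
      simpa using ((hasFDerivAt_id z).sub_const z₀).norm_sq
    have g2 : ∀ a b : V, HasFDerivAt (fun z' : V => ⟪a, z' - b⟫) (innerSL ℝ a) z := by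
      intro a b
      have : HasFDerivAt (fun z' => (innerSL ℝ a) (z' - b))
          ((innerSL ℝ a).comp (ContinuousLinearMap.id ℝ V)) z :=
        (innerSL ℝ a).hasFDerivAt.comp z ((hasFDerivAt_id z).sub_const b)
      rwa [ContinuousLinearMap.comp_id] at this
    have g3 := ((hd.add (g1.const_mul ε)).add (g2 r z₀)).sub (g2 (η z) 0)
    simp only [sub_zero] at g3
    have g4 := hmin.hasFDerivAt_eq_zero g3
    refine ext_inner_right ℝ fun h => ?_
    have g5 := DFunLike.congr_fun g4 h
    simp at g5
    rw [inner_add_left, inner_add_left, hG, inner_gradient_left, real_inner_smul_left,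
      inner_sub_left]
    linarith
  have hpc : ∀ z r, p z r → ∀ z' ∈ closedBall z₀ R, f z' - f z - ⟪η z, z' - z⟫ ≤
        Ψ z' - Ψ z - ⟪G z, z' - z⟫ + ε * ‖z' - z‖ ^ 2 := by
    intro z r hpz z' hz'
    have h1 := hpz.2 z' hz'
    have h2 : ‖z' - z₀‖ ^ 2 = ‖z' - z‖ ^ 2 + 2 * ⟪z - z₀, z' - z⟫ + ‖z - z₀‖ ^ 2 := by
      have : z' - z₀ = (z' - z) + (z - z₀) := by abel
      rw [this, norm_add_sq_real, real_inner_comm]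
    have h3 : ⟪r, z' - z₀⟫ = ⟪r, z' - z⟫ + ⟪r, z - z₀⟫ := by
      rw [← inner_add_right]; congr 1; abel
    rw [hpη z r hpz, inner_add_left, inner_add_left, real_inner_smul_left]
    rw [h2, h3] at h1
    linarith
  set T : V → V := fun s => s - Z s - G (Z s) - (2 * ε) • (Z s - z₀) with hT
  set S : Set V := {s | ∃ z, ‖z - z₀‖ ≤ τ ∧ s = z + η z} with hS
  have hTz : ∀ z r, p z r → T (z + η z) = r := by
    intro z r hpz
    simp only [hT, hZ]
    rw [hpη z r hpz]
    abel
  have hTL : ∃ K, LipschitzOnWith K T S := by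
    obtain ⟨K₀, hK₀⟩ := hZL
    have hmaps : Set.MapsTo Z S s := by
      rintro _ ⟨z, hz, rfl⟩
      rw [hZ]
      refine (hball z ?_).2
      rw [mem_ball_iff_norm]; linarith
    have l1 : LipschitzOnWith (1 : NNReal) (fun s : V => s) S := LipschitzWith.id.lipschitzOnWith
    have l2 := hK₀.lipschitzOnWith (s := S)
    have l3 := hKs.comp l2 hmaps
    have l4 : LipschitzWith (‖2 * ε‖₊ * (K₀ + 0)) fun s => (2 * ε) • (Z s - z₀) :=
      (lipschitzWith_smul (2 * ε)).comp (hK₀.sub (LipschitzWith.const z₀))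
    exact ⟨_, ((l1.sub l2).sub l3).sub l4.lipschitzOnWith⟩
  obtain ⟨s', ⟨z₁, hz₁, rfl⟩, hTs, ⟨z, r, hpz, hzs⟩, hdiff⟩ :=
    exists_differentiableAt_of_lipschitzOn_cover hZL hTL hσp
      (fun s => ∃ z r, p z r ∧ s = z + η z)
      (fun r hr => by
        obtain ⟨z, hpz⟩ := hexp r hr
        exact ⟨z + η z, ⟨z, hpz.1, rfl⟩, hTz z r hpz, z, r, hpz, rfl⟩)
  rw [hzs] at hTs hdiff
  rw [hTz z r hpz, mem_ball_zero_iff] at hTs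
  have hcontact : ∀ z', ‖z' - z‖ ≤ ρ / 2 →
      f z' ≤ f z + ⟪η z, z' - z⟫ + (K + ε) * ‖z' - z‖ ^ 2 := by
    intro z' hz'
    have hz'0 : ‖z' - z₀‖ ≤ ρ := by
      have : z' - z₀ = (z' - z) + (z - z₀) := by abel
      rw [this]
      linarith [norm_add_le (z' - z) (z - z₀), hpz.1]
    have h1 := hpc z r hpz z' (by rw [mem_closedBall_iff_norm]; linarith)
    have hsub : ball z (ρ / 2 + (ρ' - ρ)) ⊆ ball z₀ ρ' := by
      intro y hy
      rw [mem_ball_iff_norm] at hy ⊢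
      have : y - z₀ = (y - z) + (z - z₀) := by abel
      rw [this]
      linarith [norm_add_le (y - z) (z - z₀), hpz.1]
    have hzmem : z ∈ ball z₀ ρ' := by rw [mem_ball_iff_norm]; linarith [hpz.1]
    have hcs : closedBall z ‖z' - z‖ ⊆ ball z₀ ρ' := fun y hy => hsub (by
      rw [mem_closedBall_iff_norm] at hy
      rw [mem_ball_iff_norm]; linarith)
    have h2 := (convex_closedBall z ‖z' - z‖).norm_image_sub_le_of_norm_fderiv_le' (𝕜 := ℝ)
      (f := Ψ) (φ := fderiv ℝ Ψ z) (C := K * ‖z' - z‖) (x := z) (y := z')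
      (fun y hy => (hball y (hcs hy)).1.differentiableAt (by norm_num))
      (fun y hy => by
        rw [← toDual_gradient, ← toDual_gradient, ← map_sub, LinearIsometryEquiv.norm_map]
        have h3 := hKs.dist_le_mul y (hball y (hcs hy)).2 z (hball z hzmem).2
        rw [dist_eq_norm, dist_eq_norm] at h3
        rw [mem_closedBall_iff_norm] at hy
        exact h3.trans (by gcongr))
      (mem_closedBall_self (norm_nonneg _)) (mem_closedBall_iff_norm.2 le_rfl)
    rw [← inner_gradient_left] at h2
    have h3 := (le_abs_self _).trans h2
    nlinarith
  obtain ⟨B, hB⟩ := exists_linear_approx_subgradient hdiff.hasFDerivAt hZ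
    (K := 4 * (K + ε)) (ρ := ρ / 2 / 2) (by positivity) (by positivity)
    (fun z' hz' => subgradient_lipschitz_at_contact hη hcontact hz')
  exact ⟨z, r, B, hpz.1.trans (min_le_right _ _), hTs.le.trans (min_le_left _ _),
    hpη z r hpz, hpc z r hpz, second_order_expansion_of_subgradient hη hB⟩

end Contact

section SupConvolution

variable {V : Type*} [NormedAddCommGroup V] [InnerProductSpace ℝ V]

/-- Sup-convolution of `φ` with tilt `P`, over displacements in `C₀`. -/
noncomputable def supConv (C₀ : Set V) (φ : V → ℝ) (P : V) (α : ℝ) (z : V) : ℝ :=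
  sSup ((fun w => φ (z + w) - ⟪P, w⟫ - ‖w‖ ^ 2 / (2 * α)) '' C₀)

theorem exists_isMaxOn_supConv {C₀ : Set V} (hC : IsCompact C₀) (hne : C₀.Nonempty) {φ : V → ℝ}
    (hφ : Continuous φ) (P : V) (α : ℝ) (z : V) :
    ∃ w ∈ C₀, supConv C₀ φ P α z = φ (z + w) - ⟪P, w⟫ - ‖w‖ ^ 2 / (2 * α) ∧
      ∀ w' ∈ C₀, φ (z + w') - ⟪P, w'⟫ - ‖w'‖ ^ 2 / (2 * α) ≤ supConv C₀ φ P α z := by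
  have hcont : Continuous (fun w => φ (z + w) - ⟪P, w⟫ - ‖w‖ ^ 2 / (2 * α)) := by fun_prop
  obtain ⟨w, hw, heq, hmax⟩ := hC.exists_sSup_image_eq_and_ge hne hcont.continuousOn
  exact ⟨w, hw, heq, fun w' hw' => (hmax w' hw').trans heq.ge⟩

theorem hasFDerivAt_of_abs_sub_le {ψ : V → ℝ} {z g : V} {C r : ℝ} (hr : 0 < r)
    (h : ∀ z', ‖z' - z‖ ≤ r → |ψ z' - ψ z - ⟪g, z' - z⟫| ≤ C * ‖z' - z‖ ^ 2) :
    HasFDerivAt ψ (innerSL ℝ g) z := by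
  rw [hasFDerivAt_iff_isLittleO]
  have h1 : (fun z' => ψ z' - ψ z - (innerSL ℝ g) (z' - z)) =O[𝓝 z] fun z' => ‖z' - z‖ ^ 2 := by
    refine Asymptotics.IsBigO.of_bound C ?_
    filter_upwards [closedBall_mem_nhds z hr] with z' hz'
    rw [mem_closedBall_iff_norm] at hz'
    simpa using h z' hz'
  refine h1.trans_isLittleO ?_
  have h2 : Tendsto (fun z' => z' - z) (𝓝 z) (𝓝 0) := by
    have : Continuous (fun z' => z' - z) := by fun_prop
    simpa using this.tendsto z
  exact (Asymptotics.isLittleO_norm_pow_id (E' := V) one_lt_two).comp_tendsto h2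

variable [FiniteDimensional ℝ V]

theorem supConv_regular {φ : V → ℝ} (hφ : ContDiff ℝ 2 φ) {C₀ : Set V} (hC : IsCompact C₀)
    (hC1 : closedBall 0 1 ⊆ C₀) (hC2 : C₀ ⊆ closedBall 0 2) (z₀ : V) {P : V}
    (hP : gradient φ z₀ = P) {R : ℝ} (hR : 0 < R) :
    ∃ α₀ > 0, ∃ C, ∀ α, 0 < α → α < α₀ →
      (∀ z ∈ ball z₀ R, ContDiffAt ℝ 2 (supConv C₀ φ P α) z) ∧
      supConv C₀ φ P α z₀ = φ z₀ ∧ gradient (supConv C₀ φ P α) z₀ = P ∧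
      ∀ h k, |fderiv ℝ (fderiv ℝ (supConv C₀ φ P α)) z₀ h k - fderiv ℝ (fderiv ℝ φ) z₀ h k| ≤
        C * α * (‖h‖ * ‖k‖) := by
  set G := gradient φ with hGdef
  have hG : ContDiff ℝ 1 G := contDiff_iff_contDiffAt.2 fun z =>
    hφ.contDiffAt.gradient_contDiffAt
  set K := closedBall z₀ (R + 3) with hK
  have hKc : IsCompact K := isCompact_closedBall z₀ _
  obtain ⟨M, hM⟩ := hKc.exists_bound_of_continuousOn
    (f := fun z => G z - P) (hG.continuous.sub continuous_const).continuousOn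
  obtain ⟨L, hL⟩ := hKc.exists_bound_of_continuousOn
    (f := fun z => fderiv ℝ G z) (hG.continuous_fderiv one_ne_zero).continuousOn
  have hz₀K : z₀ ∈ K := mem_closedBall_self (by linarith)
  have hM0 : 0 ≤ M := (norm_nonneg _).trans (hM z₀ hz₀K)
  have hL0 : 0 ≤ L := (norm_nonneg _).trans (hL z₀ hz₀K)
  have hKconv : Convex ℝ K := convex_closedBall _ _
  have hLip : ∀ Z ∈ K, ∀ Z' ∈ K, ‖G Z' - G Z‖ ≤ L * ‖Z' - Z‖ := fun Z hZ Z' hZ' =>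
    hKconv.norm_image_sub_le_of_norm_fderiv_le (𝕜 := ℝ)
      (fun y _ => hG.differentiable one_ne_zero y) hL hZ hZ'
  refine ⟨1 / (2 * (M + L + 1)), by positivity, 2 * L ^ 2, fun α hα hα' => ?_⟩
  rw [lt_div_iff₀ (by positivity)] at hα'
  have hαM : 2 * α * M < 1 := by nlinarith
  have hαL : α * L < 1 / 2 := by nlinarith
  set ψ := supConv C₀ φ P α with hψ
  choose w hwC hweq hwmax using
    exists_isMaxOn_supConv hC ⟨0, hC1 (by simp)⟩ hφ.continuous P α
  have hwK : ∀ z ∈ ball z₀ R, z + w z ∈ K ∧ z ∈ K := by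
    intro z hz
    have h1 := hC2 (hwC z)
    rw [mem_ball_iff_norm] at hz
    rw [mem_closedBall_zero_iff] at h1
    have h2 : z + w z - z₀ = (z - z₀) + w z := by abel
    rw [hK, mem_closedBall_iff_norm, mem_closedBall_iff_norm, h2]
    exact ⟨by linarith [norm_add_le (z - z₀) (w z)], by linarith⟩
  have hwsmall : ∀ z ∈ ball z₀ R, ‖w z‖ < 1 := by
    intro z hz
    have h1 := hwmax z 0 (hC1 (by simp))
    rw [hweq z] at h1
    simp only [add_zero, inner_zero_right, norm_zero] at h1
    have h2 := hKconv.norm_image_sub_le_of_norm_fderiv_le' (𝕜 := ℝ)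
      (f := φ) (φ := innerSL ℝ P) (C := M) (x := z) (y := z + w z)
      (fun y _ => hφ.differentiable two_ne_zero y)
      (fun y hy => by
        have h3 : fderiv ℝ φ y - innerSL ℝ P = innerSL ℝ (G y - P) := by
          ext k
          simp [hGdef]
        rw [h3, innerSL_apply_norm]
        exact hM y hy) (hwK z hz).2 (hwK z hz).1
    rw [add_sub_cancel_left, innerSL_apply_apply] at h2
    have h3 := (le_abs_self _).trans h2
    have h4 : ‖w z‖ ^ 2 / (2 * α) ≤ M * ‖w z‖ := by
      have : (0 : ℝ) ^ 2 / (2 * α) = 0 := by simp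
      linarith
    rw [div_le_iff₀ (by positivity)] at h4
    by_contra! h5
    nlinarith
  have hwfix : ∀ z ∈ ball z₀ R, w z = α • (G (z + w z) - P) := by
    intro z hz
    have hmax : IsLocalMax (fun w' => φ (z + w') - ⟪P, w'⟫ - ‖w'‖ ^ 2 / (2 * α)) (w z) := by
      filter_upwards [isOpen_ball.mem_nhds (mem_ball_zero_iff.2 (hwsmall z hz))] with w' hw'
      exact (hwmax z w' (hC1 (ball_subset_closedBall hw'))).trans (hweq z).le
    have g1 : HasFDerivAt (fun w' => φ (z + w')) (fderiv ℝ φ (z + w z)) (w z) := by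
      have := (hφ.differentiable two_ne_zero (z + w z)).hasFDerivAt
      rwa [hasFDerivAt_comp_add_left]
    have g2 : HasFDerivAt (fun w' : V => ⟪P, w'⟫) (innerSL ℝ P) (w z) :=
      (innerSL ℝ P).hasFDerivAt
    have g3 : HasFDerivAt (fun w' : V => ‖w'‖ ^ 2) (2 • innerSL ℝ (w z)) (w z) := by
      simpa using (hasFDerivAt_id (w z)).norm_sq
    simp only [div_eq_mul_inv] at hmax
    have g4 := hmax.hasFDerivAt_eq_zero ((g1.sub g2).sub (g3.mul_const (2 * α)⁻¹))
    refine ext_inner_right ℝ fun k => ?_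
    have g5 := DFunLike.congr_fun g4 k
    rw [real_inner_smul_left, inner_sub_left, inner_gradient_left]
    simp at g5
    field_simp at g5
    linarith
  set m : V → V := fun z => z + w z with hm
  have hmLip : ∀ z ∈ ball z₀ R, ∀ z' ∈ ball z₀ R, ‖m z' - m z‖ ≤ 2 * ‖z' - z‖ := by
    intro z hz z' hz'
    have h1 : m z' - m z = (z' - z) + α • (G (m z') - G (m z)) := by
      have e1 : m z = z + α • (G (m z) - P) := by
        simp only [hm]; rw [← hwfix z hz]
      have e2 : m z' = z' + α • (G (m z') - P) := by
        simp only [hm]; rw [← hwfix z' hz']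
      calc m z' - m z = (z' + α • (G (m z') - P)) - (z + α • (G (m z) - P)) := by
            rw [← e1, ← e2]
        _ = _ := by rw [smul_sub, smul_sub, smul_sub]; abel
    have h2 : ‖m z' - m z‖ ≤ ‖z' - z‖ + α * (L * ‖m z' - m z‖) := by
      calc _ = ‖(z' - z) + α • (G (m z') - G (m z))‖ := by rw [← h1]
        _ ≤ ‖z' - z‖ + ‖α • (G (m z') - G (m z))‖ := norm_add_le _ _
        _ ≤ _ := by
          rw [norm_smul, Real.norm_of_nonneg hα.le]
          gcongr
          exact hLip _ (hwK z hz).1 _ (hwK z' hz').1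
    nlinarith [norm_nonneg (m z' - m z)]
  have hfixm : ∀ z ∈ ball z₀ R, m z - α • (G (m z) - P) = z := by
    intro z hz
    have := hwfix z hz
    simp only [hm]
    rw [← this]
    abel
  have hnb : ∀ z ∈ ball z₀ R, ball z₀ R ∈ 𝓝 z := fun z hz => isOpen_ball.mem_nhds hz
  have hmcont : ∀ z ∈ ball z₀ R, Tendsto m (𝓝 z) (𝓝 (m z)) := by
    intro z hz
    rw [tendsto_iff_norm_sub_tendsto_zero]
    have h0 : Tendsto (fun z' => 2 * ‖z' - z‖) (𝓝 z) (𝓝 0) := by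
      have : Continuous (fun z' => 2 * ‖z' - z‖) := by fun_prop
      simpa using this.tendsto z
    refine squeeze_zero' (Eventually.of_forall fun _ => norm_nonneg _) ?_ h0
    filter_upwards [hnb z hz] with z' hz' using hmLip z hz z' hz'
  set Θ : V → V := fun Z => Z - α • (G Z - P) with hΘ
  have hΘc : ContDiff ℝ 1 Θ := by
    simp only [hΘ]
    exact contDiff_id.sub ((hG.sub contDiff_const).const_smul α)
  have hΘd : ∀ Z, HasFDerivAt Θ (ContinuousLinearMap.id ℝ V - α • fderiv ℝ G Z) Z := by
    intro Z
    have h1 := (hG.differentiable one_ne_zero Z).hasFDerivAt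
    exact (hasFDerivAt_id Z).sub ((h1.sub_const P).const_smul α)
  have hmC1 : ∀ z ∈ ball z₀ R, ContDiffAt ℝ 1 m z := by
    intro z hz
    have hn : ‖α • fderiv ℝ G (m z)‖ < 1 := by
      rw [norm_smul, Real.norm_of_nonneg hα.le]
      have := hL _ (hwK z hz).1
      nlinarith
    set U := Units.oneSub (α • fderiv ℝ G (m z)) hn with hU
    set e : V ≃L[ℝ] V := ContinuousLinearEquiv.ofUnit U
    have he : HasFDerivAt Θ (e : V →L[ℝ] V) (m z) := hΘd (m z)
    have h1 := (hΘc.contDiffAt (x := m z)).to_localInverse he one_ne_zero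
    have h2 : Θ (m z) = z := hfixm z hz
    rw [h2] at h1
    refine h1.congr_of_eventuallyEq ?_
    have h3 : ∀ᶠ Z in 𝓝 (m z), (hΘc.contDiffAt (x := m z)).localInverse he one_ne_zero (Θ Z) = Z :=
      ((hΘc.contDiffAt (x := m z)).hasStrictFDerivAt' he one_ne_zero).eventually_left_inverse
    filter_upwards [(hmcont z hz).eventually h3, hnb z hz] with z' h4 hz'
    have h5 : Θ (m z') = z' := hfixm z' hz'
    rw [h5] at h4
    exact h4.symm
  have hwm : ∀ z, w z = m z - z := fun z => by simp [hm]
  have hψd : ∀ z ∈ ball z₀ R, HasFDerivAt ψ (innerSL ℝ (P + α⁻¹ • (m z - z))) z := by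
    intro z hz
    obtain ⟨r, hr, hrs⟩ := Metric.mem_nhds_iff.1 (hnb z hz)
    have hwn : ∀ z₁ ∈ ball z₀ R, 0 < 1 - ‖w z₁‖ := fun z₁ hz₁ => by linarith [hwsmall z₁ hz₁]
    have hlow : ∀ z₁ z₂, m z₁ - z₂ ∈ C₀ → ψ z₁ - ⟪P, z₁ - z₂⟫ + ‖w z₁‖ ^ 2 / (2 * α) -
        ‖w z₁ + (z₁ - z₂)‖ ^ 2 / (2 * α) ≤ ψ z₂ := by
      intro z₁ z₂ hC
      have h1 := hwmax z₂ _ hC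
      have h2 := hweq z₁
      have e : m z₁ - z₂ = w z₁ + (z₁ - z₂) := by rw [hwm]; abel
      rw [add_sub_cancel, e, inner_add_right] at h1
      simp only [hm] at h1
      linarith
    have hα2 : 0 < 2 * α := by positivity
    have hev : ∀ᶠ z' in 𝓝 z, m z' - z ∈ C₀ ∧ m z - z' ∈ C₀ := by
      have hb : ball (0 : V) 1 ∈ 𝓝 (m z - z) :=
        isOpen_ball.mem_nhds (by rw [← hwm, mem_ball_zero_iff]; exact hwsmall z hz)
      have t1 : Tendsto (fun z' => m z' - z) (𝓝 z) (𝓝 (m z - z)) :=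
        (hmcont z hz).sub_const z
      have t2 : Tendsto (fun z' => m z - z') (𝓝 z) (𝓝 (m z - z)) :=
        tendsto_id.const_sub (m z)
      filter_upwards [t1 hb, t2 hb] with z' h1 h2
      exact ⟨hC1 (ball_subset_closedBall h1), hC1 (ball_subset_closedBall h2)⟩
    obtain ⟨r, hr, hrs⟩ := Metric.eventually_nhds_iff_ball.1 (hev.and (hnb z hz))
    refine hasFDerivAt_of_abs_sub_le (C := 2 / α + 2 * α⁻¹) (r := r / 2) (by positivity)
      fun z' hz' => ?_
    have hz'r : z' ∈ ball z r := by rw [mem_ball_iff_norm]; linarith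
    obtain ⟨⟨hc1, hc2⟩, hzb⟩ := hrs z' hz'r
    have h1 := hlow z z' hc2
    have h2 := hlow z' z hc1
    rw [norm_add_sq_real] at h1 h2
    have e1 : z - z' = -(z' - z) := by abel
    rw [e1, norm_neg, inner_neg_right, inner_neg_right] at h1
    have h3 : ‖m z' - m z‖ ≤ 2 * ‖z' - z‖ := hmLip z hz z' hzb
    have h4 : ⟪w z', z' - z⟫ = ⟪w z, z' - z⟫ + ⟪m z' - m z, z' - z⟫ - ‖z' - z‖ ^ 2 := by
      rw [hwm, hwm, ← real_inner_self_eq_norm_sq, ← inner_add_left, ← inner_sub_left]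
      congr 1
      abel
    have h5 : |⟪m z' - m z, z' - z⟫| ≤ 2 * ‖z' - z‖ * ‖z' - z‖ :=
      (abs_real_inner_le_norm _ _).trans (by gcongr)
    rw [abs_le] at h5
    rw [inner_add_left, real_inner_smul_left, ← hwm, abs_le]
    have hα3 : (2 * α)⁻¹ = α⁻¹ / 2 := by rw [mul_inv]; ring
    have hαi : 0 < α⁻¹ := by positivity
    simp only [div_eq_mul_inv, hα3] at h1 h2 ⊢
    rw [h4] at h2
    have h6 := mul_le_mul_of_nonneg_left h5.1 hαi.le
    have h7 := mul_le_mul_of_nonneg_left h5.2 hαi.le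
    have h8 : 0 ≤ α⁻¹ * ‖z' - z‖ ^ 2 := by positivity
    constructor <;> nlinarith
  have hev : ∀ z ∈ ball z₀ R, fderiv ℝ ψ =ᶠ[𝓝 z] fun z => innerSL ℝ (P + α⁻¹ • (m z - z)) := by
    intro z hz
    filter_upwards [hnb z hz] with z' hz' using (hψd z' hz').fderiv
  have hz₀b : z₀ ∈ ball z₀ R := mem_ball_self hR
  have hmz₀ : m z₀ = z₀ := by
    have h1 := hfixm z₀ hz₀b
    have h2 : m z₀ - z₀ = α • (G (m z₀) - G z₀) := by
      rw [hP, sub_eq_iff_eq_add]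
      exact (sub_eq_iff_eq_add'.1 h1)
    have h3 := hLip _ hz₀K _ (hwK z₀ hz₀b).1
    have h4 : ‖m z₀ - z₀‖ ≤ α * (L * ‖m z₀ - z₀‖) := by
      conv_lhs => rw [h2, norm_smul, Real.norm_of_nonneg hα.le]
      gcongr
    have h5 : ‖m z₀ - z₀‖ = 0 := by nlinarith [norm_nonneg (m z₀ - z₀)]
    exact sub_eq_zero.1 (norm_eq_zero.1 h5)
  refine ⟨fun z hz => ?_, ?_, ?_, fun h k => ?_⟩
  · refine contDiffAt_succ_iff_hasFDerivAt.2 ⟨_, ⟨ball z₀ R, hnb z hz, hψd⟩, ?_⟩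
    exact (innerSL ℝ).contDiff.contDiffAt.comp z
      (contDiffAt_const.add (((hmC1 z hz).sub contDiffAt_id).const_smul α⁻¹))
  · have h1 := hweq z₀
    rw [hwm, hmz₀] at h1
    simpa using h1
  · have h1 := hψd z₀ hz₀b
    rw [hmz₀] at h1
    refine HasGradientAt.gradient ?_
    rw [hasGradientAt_iff_hasFDerivAt]
    refine h1.congr_fderiv ?_
    ext k
    simp
  · have hdm := (hmC1 z₀ hz₀b).differentiableAt one_ne_zero
    set D := fderiv ℝ m z₀ with hD
    have h1 : HasFDerivAt (fun z => innerSL ℝ (P + α⁻¹ • (m z - z)))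
        ((innerSL ℝ).comp (α⁻¹ • (D - ContinuousLinearMap.id ℝ V))) z₀ :=
      (innerSL ℝ).hasFDerivAt.comp z₀
        (((hdm.hasFDerivAt.sub (hasFDerivAt_id z₀)).const_smul α⁻¹).const_add P)
    have h2 : HasFDerivAt (fun z => Θ (m z))
        ((ContinuousLinearMap.id ℝ V - α • fderiv ℝ G z₀).comp D) z₀ := by
      have := hΘd z₀
      conv at this => arg 3; rw [← hmz₀]
      exact this.comp z₀ hdm.hasFDerivAt
    have h3 : HasFDerivAt (fun z => Θ (m z)) (ContinuousLinearMap.id ℝ V) z₀ := by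
      refine (hasFDerivAt_id z₀).congr_of_eventuallyEq ?_
      filter_upwards [hnb z₀ hz₀b] with z' hz' using hfixm z' hz'
    have h4 : D h - α • fderiv ℝ G z₀ (D h) = h := by
      simpa using DFunLike.congr_fun (h2.unique h3) h
    have h5 : fderiv ℝ (fderiv ℝ φ) z₀ h k = ⟪fderiv ℝ G z₀ h, k⟫ := by
      have e1 : fderiv ℝ φ = fun z => innerSL ℝ (G z) := by
        funext z
        ext k
        simp [hGdef]
      have e2 : HasFDerivAt (fun z => innerSL ℝ (G z)) ((innerSL ℝ).comp (fderiv ℝ G z₀)) z₀ :=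
        (innerSL ℝ).hasFDerivAt.comp z₀ (hG.differentiable one_ne_zero z₀).hasFDerivAt
      rw [e1, e2.fderiv]
      simp
    rw [(hev z₀ hz₀b).fderiv_eq, h1.fderiv, h5]
    have h6 : α⁻¹ • (D h - h) = fderiv ℝ G z₀ (D h) := by
      have : D h - h = α • fderiv ℝ G z₀ (D h) := by
        rw [sub_eq_iff_eq_add, add_comm]; exact sub_eq_iff_eq_add.1 h4
      rw [this, smul_smul, inv_mul_cancel₀ hα.ne', one_smul]
    have h7 : ((innerSL ℝ).comp (α⁻¹ • (D - ContinuousLinearMap.id ℝ V))) h k =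
        ⟪fderiv ℝ G z₀ (D h), k⟫ := by
      rw [← h6, real_inner_smul_left, inner_sub_left]; simp
    rw [h7, ← inner_sub_left, ← map_sub]
    have h8 : ∀ x, ‖fderiv ℝ G z₀ x‖ ≤ L * ‖x‖ := fun x =>
      (ContinuousLinearMap.le_opNorm _ _).trans (by gcongr; exact hL z₀ hz₀K)
    have h9 : ‖D h - h‖ ≤ α * (L * ‖D h‖) := by
      have : D h - h = α • fderiv ℝ G z₀ (D h) := by
        rw [sub_eq_iff_eq_add, add_comm]; exact sub_eq_iff_eq_add.1 h4
      rw [this, norm_smul, Real.norm_of_nonneg hα.le]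
      gcongr
      exact h8 _
    have h10 : ‖D h‖ ≤ 2 * ‖h‖ := by
      have : ‖D h‖ ≤ ‖D h - h‖ + ‖h‖ := by
        simpa using norm_add_le (D h - h) h
      nlinarith [norm_nonneg (D h)]
    calc _ ≤ ‖fderiv ℝ G z₀ (D h - h)‖ * ‖k‖ := abs_real_inner_le_norm _ _
      _ ≤ (L * (α * (L * (2 * ‖h‖)))) * ‖k‖ := by
        gcongr
        exact (h8 _).trans (by gcongr; exact h9.trans (by gcongr))
      _ = _ := by ring

end SupConvolution

theorem UpperSemicontinuous.exists_smooth_approx {V : Type*} [NormedAddCommGroup V]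
    [InnerProductSpace ℝ V] [FiniteDimensional ℝ V] {u : V → ℝ} (hu : UpperSemicontinuous u)
    {C : ℝ} (hC : ∀ x, |u x| ≤ C) :
    ∃ g : ℕ → V → ℝ, (∀ n, ContDiff ℝ 2 (g n)) ∧ (∀ n x, u x ≤ g n x) ∧
      (∀ n x, |g n x| ≤ C + 2) ∧ ∀ x, Tendsto (fun n => g n x) atTop (𝓝 (u x)) := by
  set a : ℕ → V → ℝ := fun n x => ⨆ y, (u y - n * ‖x - y‖) with ha
  have hle : ∀ (n : ℕ) x y, u y - n * ‖x - y‖ ≤ C := fun n x y => by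
    have := le_of_abs_le (hC y)
    have : 0 ≤ (n : ℝ) * ‖x - y‖ := by positivity
    linarith
  have hbdd : ∀ (n : ℕ) x, BddAbove (Set.range fun y => u y - n * ‖x - y‖) := fun n x =>
    ⟨C, by rintro _ ⟨y, rfl⟩; exact hle n x y⟩
  have hua : ∀ n x, u x ≤ a n x := fun n x => by
    simpa using le_ciSup (hbdd n x) x
  have haC : ∀ n x, a n x ≤ C := fun n x => ciSup_le (hle n x)
  have haL : ∀ n x x', a n x' ≤ a n x + n * ‖x' - x‖ := by
    intro n x x'
    refine ciSup_le fun y => ?_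
    have h1 := le_ciSup (hbdd n x) y
    have h2 : ‖x - y‖ ≤ ‖x' - y‖ + ‖x' - x‖ := by
      have : x - y = (x' - y) - (x' - x) := by abel
      rw [this]; exact norm_sub_le _ _
    have h3 : (n : ℝ) * ‖x - y‖ ≤ n * (‖x' - y‖ + ‖x' - x‖) := by gcongr
    simp only [ha]
    linarith
  have hauc : ∀ n, UniformContinuous (a n) := by
    intro n
    refine (LipschitzWith.of_dist_le_mul (K := n) fun x x' => ?_).uniformContinuous
    rw [Real.dist_eq, dist_eq_norm, abs_le]
    have h1 := haL n x x'
    have h2 := haL n x' x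
    rw [norm_sub_rev] at h1
    simp only [NNReal.coe_natCast]
    constructor <;> linarith
  have hat : ∀ x, ∀ ε > 0, ∀ᶠ n in atTop, a n x ≤ u x + ε := by
    intro x ε hε
    have h1 := hu x (u x + ε) (by linarith)
    obtain ⟨r, hr, hball⟩ := Metric.eventually_nhds_iff_ball.1 h1
    filter_upwards [eventually_ge_atTop ⌈2 * C / r⌉₊] with n hn
    have hn' : 2 * C / r ≤ n := (Nat.le_ceil _).trans (by exact_mod_cast hn)
    rw [div_le_iff₀ hr] at hn'
    refine ciSup_le fun y => ?_
    by_cases hy : y ∈ ball x r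
    · have := hball y hy
      have : 0 ≤ (n : ℝ) * ‖x - y‖ := by positivity
      linarith
    · rw [mem_ball_iff_norm', not_lt] at hy
      have h2 : (n : ℝ) * r ≤ n * ‖x - y‖ := by gcongr
      have := abs_le.1 (hC y)
      have := abs_le.1 (hC x)
      linarith
  choose b hb1 hb2 using fun n : ℕ => (hauc n).exists_contDiff_dist_le
    (ε := 1 / ((n : ℝ) + 1)) (by positivity)
  have hpos : ∀ n : ℕ, 0 < 1 / ((n : ℝ) + 1) := fun n => by positivity
  have hle1 : ∀ n : ℕ, 1 / ((n : ℝ) + 1) ≤ 1 := fun n => by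
    rw [div_le_one (by positivity)]
    have : (0 : ℝ) ≤ n := n.cast_nonneg
    linarith
  have hbb : ∀ n x, a n x - 1 / ((n : ℝ) + 1) < b n x ∧ b n x < a n x + 1 / ((n : ℝ) + 1) := by
    intro n x
    have := hb2 n x
    rw [Real.dist_eq, abs_lt] at this
    constructor <;> linarith
  refine ⟨fun n x => b n x + 1 / ((n : ℝ) + 1), fun n => ?_, fun n x => ?_, fun n x => ?_,
    fun x => ?_⟩
  · exact ((hb1 n).of_le (by norm_cast)).add contDiff_const
  · linarith [hua n x, hbb n x]
  · have := abs_le.1 (hC x)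
    have := hua n x
    have := haC n x
    have := hle1 n
    have := hbb n x
    rw [abs_le]
    constructor <;> linarith
  · have h0 : Tendsto (fun n : ℕ => 1 / ((n : ℝ) + 1)) atTop (𝓝 0) :=
      tendsto_one_div_add_atTop_nhds_zero_nat
    have h1 : Tendsto (fun n => a n x) atTop (𝓝 (u x)) := by
      rw [tendsto_order]
      refine ⟨fun c hc => Eventually.of_forall fun n => hc.trans_le (hua n x), fun c hc => ?_⟩
      filter_upwards [hat x ((c - u x) / 2) (by linarith)] with n hn
      linarith
    refine tendsto_of_tendsto_of_tendsto_of_le_of_le h1 (h :=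
      fun n => a n x + 2 * (1 / ((n : ℝ) + 1)))
      ?_ (fun n => ?_) (fun n => ?_)
    · simpa using h1.add (h0.const_mul 2)
    · simp only; linarith [hbb n x]
    · simp only; linarith [hbb n x]

section Quadratic

variable {d : ℕ}

theorem continuous_quadF (A : Matrix (Fin d) (Fin d) ℝ) : Continuous (quadF A) := by
  unfold quadF
  have : Continuous (Matrix.toEuclideanLin A) := LinearMap.continuous_of_finiteDimensional _
  exact this.inner continuous_id

theorem contDiff_quadratic (c : ℝ) (p x₀ : EuclideanSpace ℝ (Fin d))
    (A : Matrix (Fin d) (Fin d) ℝ) :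
    ContDiff ℝ 2 (fun x => c + ⟪p, x - x₀⟫ + 1 / 2 * quadF A (x - x₀)) := by
  set T := LinearMap.toContinuousLinearMap (Matrix.toEuclideanLin A)
  change ContDiff ℝ 2 (fun x => c + ⟪p, x - x₀⟫ + 1 / 2 * ⟪T (x - x₀), x - x₀⟫)
  have h : ContDiff ℝ 2 fun x => x - x₀ := contDiff_id.sub contDiff_const
  exact (contDiff_const.add (contDiff_const.inner ℝ h)).add
    (contDiff_const.mul ((T.contDiff.comp h).inner ℝ h))

theorem hasFDerivAt_quadratic (c : ℝ) (p x₀ : EuclideanSpace ℝ (Fin d))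
    {A : Matrix (Fin d) (Fin d) ℝ} (hA : A.IsSymm) (x : EuclideanSpace ℝ (Fin d)) :
    HasFDerivAt (fun x => c + ⟪p, x - x₀⟫ + 1 / 2 * quadF A (x - x₀))
      (innerSL ℝ (p + Matrix.toEuclideanLin A (x - x₀))) x := by
  have hsym : (Matrix.toEuclideanLin A).IsSymmetric :=
    Matrix.isSymmetric_toEuclideanLin_iff.2 (by
      rw [Matrix.IsHermitian, Matrix.conjTranspose_eq_transpose_of_trivial]; exact hA)
  set T := LinearMap.toContinuousLinearMap (Matrix.toEuclideanLin A) with hT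
  refine hasFDerivAt_of_abs_sub_le (C := 1 / 2 * ‖T‖) one_pos fun x' _ => ?_
  have e : c + ⟪p, x' - x₀⟫ + 1 / 2 * quadF A (x' - x₀) -
      (c + ⟪p, x - x₀⟫ + 1 / 2 * quadF A (x - x₀)) -
      ⟪p + Matrix.toEuclideanLin A (x - x₀), x' - x⟫ = 1 / 2 * ⟪T (x' - x), x' - x⟫ := by
    have h1 : x' - x₀ = (x' - x) + (x - x₀) := by abel
    have h2 := hsym (x' - x) (x - x₀)
    have h3 := real_inner_comm (x' - x) (Matrix.toEuclideanLin A (x - x₀))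
    simp only [quadF, h1, map_add, inner_add_left, inner_add_right, hT,
      LinearMap.coe_toContinuousLinearMap']
    linarith
  rw [e, abs_mul, abs_of_pos (by norm_num : (0 : ℝ) < 1 / 2), mul_assoc]
  gcongr
  calc _ ≤ ‖T (x' - x)‖ * ‖x' - x‖ := abs_real_inner_le_norm _ _
    _ ≤ (‖T‖ * ‖x' - x‖) * ‖x' - x‖ := by gcongr; exact T.le_opNorm _
    _ = _ := by ring

theorem hessM_eq_of_eventuallyEq_quadratic {ψ : EuclideanSpace ℝ (Fin d) → ℝ} {c : ℝ}
    {p x₀ : EuclideanSpace ℝ (Fin d)} {A : Matrix (Fin d) (Fin d) ℝ} (hA : A.IsSymm)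
    (h : ψ =ᶠ[𝓝 x₀] fun x => c + ⟪p, x - x₀⟫ + 1 / 2 * quadF A (x - x₀)) :
    gradient ψ x₀ = p ∧ hessM ψ x₀ = A := by
  have h1 : fderiv ℝ ψ =ᶠ[𝓝 x₀] fun x => innerSL ℝ (p + Matrix.toEuclideanLin A (x - x₀)) := by
    filter_upwards [h.fderiv (𝕜 := ℝ)] with x hx
    rw [hx, (hasFDerivAt_quadratic c p x₀ hA x).fderiv]
  set T := LinearMap.toContinuousLinearMap (Matrix.toEuclideanLin A) with hT
  have h2 : HasFDerivAt (fun x => innerSL ℝ (p + T (x - x₀))) ((innerSL ℝ).comp T) x₀ :=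
    (innerSL ℝ).hasFDerivAt.comp x₀
      ((T.hasFDerivAt.comp x₀ ((hasFDerivAt_id x₀).sub_const x₀)).const_add p)
  constructor
  · refine ext_inner_right ℝ fun k => ?_
    rw [inner_gradient_left, h1.eq_of_nhds]
    simp
  · ext i k
    rw [hessM, Matrix.of_apply, iteratedFDeriv_two_apply, h1.fderiv_eq]
    change fderiv ℝ (fun x => innerSL ℝ (p + T (x - x₀))) x₀ _ _ = _
    rw [h2.fderiv]
    change ⟪T (EuclideanSpace.single i 1), EuclideanSpace.single k 1⟫ = _
    rw [EuclideanSpace.inner_single_right, ← hA.apply i k]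
    simp [hT, Matrix.toLpLin_apply]

end Quadratic

section Nonlocal

variable {d : ℕ}

theorem integrable_min_sq_one {μ : Measure (EuclideanSpace ℝ (Fin d))}
    (hLevy : ∫⁻ z, ENNReal.ofReal (min (‖z‖ ^ 2) 1) ∂μ < ⊤) :
    Integrable (fun z => min (‖z‖ ^ 2) 1) μ := by
  refine ⟨(by fun_prop : Continuous fun z : EuclideanSpace ℝ (Fin d) =>
      min (‖z‖ ^ 2) 1).aestronglyMeasurable, ?_⟩
  rw [hasFiniteIntegral_iff_ofReal (Eventually.of_forall fun z => by positivity)]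
  exact hLevy

theorem abs_le_mul_min_sq_one {θ : EuclideanSpace ℝ (Fin d) → ℝ} {K₁ K₂ r : ℝ} (hr : 0 < r)
    (hr1 : r ≤ 1)
    (hK₁ : 0 ≤ K₁) (hK₂ : 0 ≤ K₂) (h₁ : ∀ z, ‖z‖ ≤ r → |θ z| ≤ K₁ * ‖z‖ ^ 2)
    (h₂ : ∀ z, r < ‖z‖ → |θ z| ≤ K₂) (z : EuclideanSpace ℝ (Fin d)) :
    ‖θ z‖ ≤ (K₁ + K₂ / r ^ 2) * min (‖z‖ ^ 2) 1 := by
  rw [Real.norm_eq_abs]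
  have hq : 0 ≤ K₂ / r ^ 2 := by positivity
  rcases le_or_gt ‖z‖ r with hz | hz
  · have : ‖z‖ ^ 2 ≤ 1 := by nlinarith [norm_nonneg z]
    rw [min_eq_left this]
    refine (h₁ z hz).trans ?_
    gcongr
    linarith
  · have h3 : r ^ 2 ≤ min (‖z‖ ^ 2) 1 := le_min (by nlinarith) (by nlinarith)
    calc |θ z| ≤ K₂ := h₂ z hz
      _ = K₂ / r ^ 2 * r ^ 2 := by field_simp
      _ ≤ (K₁ + K₂ / r ^ 2) * min (‖z‖ ^ 2) 1 := by
        gcongr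
        linarith

theorem abs_quadF_le (A : Matrix (Fin d) (Fin d) ℝ) :
    ∃ K, 0 ≤ K ∧ ∀ h, |quadF A h| ≤ K * ‖h‖ ^ 2 := by
  set T := LinearMap.toContinuousLinearMap (Matrix.toEuclideanLin A) with hT
  refine ⟨‖T‖, norm_nonneg _, fun h => ?_⟩
  calc _ ≤ ‖T h‖ * ‖h‖ := abs_real_inner_le_norm _ _
    _ ≤ (‖T‖ * ‖h‖) * ‖h‖ := by gcongr; exact T.le_opNorm _
    _ = _ := by ring

theorem abs_inner_mul_indicator_le (p h z : EuclideanSpace ℝ (Fin d)) {c : ℝ} (hh : ‖h‖ ≤ c * ‖z‖)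
    (hc : 0 ≤ c) :
    |⟪p, h⟫ * (closedBall (0 : EuclideanSpace ℝ (Fin d)) 1).indicator (fun _ =>
      (1 : ℝ)) z| ≤ ‖p‖ * c := by
  by_cases hz : z ∈ closedBall (0 : EuclideanSpace ℝ (Fin d)) 1
  · rw [Set.indicator_of_mem hz, mul_one]
    rw [mem_closedBall_zero_iff] at hz
    refine (abs_real_inner_le_norm _ _).trans ?_
    gcongr
    nlinarith
  · rw [Set.indicator_of_notMem hz]
    simp only [mul_zero, abs_zero]
    positivity

variable {μ : Measure (EuclideanSpace ℝ (Fin d))}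
  {j : EuclideanSpace ℝ (Fin d) → EuclideanSpace ℝ (Fin d) → EuclideanSpace ℝ (Fin d)}
  {F : EuclideanSpace ℝ (Fin d) → ℝ → EuclideanSpace ℝ (Fin d) →
      Matrix (Fin d) (Fin d) ℝ → ℝ → ℝ} {u : EuclideanSpace ℝ (Fin d) → ℝ} {cb C : ℝ}

theorem DegEll.le_zero_of_le (hFe : DegEll F) {x : EuclideanSpace ℝ (Fin d)} {t : ℝ}
    {p : EuclideanSpace ℝ (Fin d)}
    {A : Matrix (Fin d) (Fin d) ℝ} {l l' : ℝ} (h : F x t p A l ≤ 0) (hl : l ≤ l') :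
    F x t p A l' ≤ 0 :=
  (hFe x t p A A l' l (by rw [sub_self]; exact Matrix.PosSemidef.zero) hl).trans h

theorem le_zero_of_tendsto
    (hFc : Continuous fun ξ : EuclideanSpace ℝ (Fin d) × ℝ × EuclideanSpace ℝ (Fin d) ×
      Matrix (Fin d) (Fin d) ℝ × ℝ => F ξ.1 ξ.2.1 ξ.2.2.1 ξ.2.2.2.1 ξ.2.2.2.2)
    {x : ℕ → EuclideanSpace ℝ (Fin d)} {t : ℕ → ℝ} {p : ℕ → EuclideanSpace ℝ (Fin d)}
    {A : ℕ → Matrix (Fin d) (Fin d) ℝ} {l : ℕ → ℝ}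
    {x₀ p₀ : EuclideanSpace ℝ (Fin d)} {t₀ l₀ : ℝ} {A₀ : Matrix (Fin d) (Fin d) ℝ}
    (hx : Tendsto x atTop (𝓝 x₀)) (ht : Tendsto t atTop (𝓝 t₀)) (hp : Tendsto p atTop (𝓝 p₀))
    (hA : Tendsto A atTop (𝓝 A₀)) (hl : Tendsto l atTop (𝓝 l₀))
    (h : ∀ k, F (x k) (t k) (p k) (A k) (l k) ≤ 0) : F x₀ t₀ p₀ A₀ l₀ ≤ 0 := by
  have h1 := (hFc.tendsto (x₀, t₀, p₀, A₀, l₀)).comp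
    (hx.prodMk_nhds (ht.prodMk_nhds (hp.prodMk_nhds (hA.prodMk_nhds hl))))
  exact le_of_tendsto' h1 h

theorem IsSubsolution.le_zero_of_quadratic_touching
    (hLevy : ∫⁻ z, ENNReal.ofReal (min (‖z‖ ^ 2) 1) ∂μ < ⊤) (hcb : 0 < cb)
    (hjm : Measurable (Function.uncurry j)) (hjb : ∀ x z, ‖j x z‖ ≤ cb * ‖z‖)
    (hFc : Continuous fun ξ : EuclideanSpace ℝ (Fin d) × ℝ × EuclideanSpace ℝ (Fin d) ×
      Matrix (Fin d) (Fin d) ℝ × ℝ => F ξ.1 ξ.2.1 ξ.2.2.1 ξ.2.2.2.1 ξ.2.2.2.2)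
    (hFe : DegEll F) (hu : UpperSemicontinuous u) (hC : ∀ x, |u x| ≤ C)
    (hsub : IsSubsolution F μ j u) {x₀ p : EuclideanSpace ℝ (Fin d)} {A : Matrix (Fin d) (Fin d) ℝ}
    (hA : A.IsSymm)
    {s : ℝ} (hs : 0 < s)
    (htouch : ∀ h, ‖h‖ ≤ 2 * s → u (x₀ + h) ≤ u x₀ + ⟪p, h⟫ + 1 / 2 * quadF A h)
    {b : EuclideanSpace ℝ (Fin d) → ℝ} (hb : Integrable b μ)
    (hle : ∀ z, (if ‖j x₀ z‖ ≤ 2 * s then u x₀ + ⟪p, j x₀ z⟫ + 1 / 2 * quadF A (j x₀ z)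
      else u (x₀ + j x₀ z)) - u x₀ -
      ⟪p, j x₀ z⟫ * (closedBall (0 : EuclideanSpace ℝ (Fin d)) 1).indicator (fun _ =>
        (1 : ℝ)) z ≤ b z) :
    F x₀ (u x₀) p A (∫ z, b z ∂μ) ≤ 0 := by
  obtain ⟨g, hg1, hg2, hg3, hg4⟩ := hu.exists_smooth_approx hC
  have hC0 : 0 ≤ C := (abs_nonneg _).trans (hC x₀)
  let χ : ContDiffBump x₀ := ⟨s, 2 * s, hs, by linarith⟩
  have hχ1 : ∀ h, ‖h‖ ≤ s → χ (x₀ + h) = 1 := fun h hh =>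
    χ.one_of_mem_closedBall (by simpa [mem_closedBall_iff_norm] using hh)
  have hχ0 : ∀ h, 2 * s < ‖h‖ → χ (x₀ + h) = 0 := fun h hh =>
    χ.zero_of_le_dist (by simpa [dist_eq_norm] using hh.le)
  set q : EuclideanSpace ℝ (Fin d) → ℝ :=
      fun x => u x₀ + ⟪p, x - x₀⟫ + 1 / 2 * quadF A (x - x₀) with hq
  have hqc : ContDiff ℝ 2 q := contDiff_quadratic _ _ _ _
  obtain ⟨Kq, hKq⟩ := (isCompact_closedBall x₀ (2 * s)).exists_bound_of_continuousOn
    hqc.continuous.continuousOn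
  have hKq0 : 0 ≤ Kq := (norm_nonneg _).trans (hKq x₀ (mem_closedBall_self (by linarith)))
  set blend : (EuclideanSpace ℝ (Fin d) → ℝ) → EuclideanSpace ℝ (Fin d) → ℝ :=
      fun w x => χ x * q x + (1 - χ x) * w x with hblend
  have hqh : ∀ h, q (x₀ + h) = u x₀ + ⟪p, h⟫ + 1 / 2 * quadF A h := fun h => by
    simp [hq]
  have hbl1 : ∀ w h, ‖h‖ ≤ s → blend w (x₀ + h) = u x₀ + ⟪p, h⟫ + 1 / 2 * quadF A h := by
    intro w h hh
    simp only [hblend, hχ1 h hh, hqh]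
    ring
  have hblb : ∀ w : EuclideanSpace ℝ (Fin d) → ℝ, (∀ x, |w x| ≤ C + 2) → ∀ x, |blend w x| ≤
      Kq + (C + 2) := by
    intro w hw x
    have h0 := χ.nonneg (x := x)
    have h1 := χ.le_one (x := x)
    have h2 : |χ x * q x| ≤ Kq := by
      by_cases hx : x ∈ closedBall x₀ (2 * s)
      · rw [abs_mul, abs_of_nonneg h0]
        have := hKq x hx
        rw [Real.norm_eq_abs] at this
        nlinarith [abs_nonneg (q x)]
      · have := hχ0 (x - x₀) (by
          rwa [mem_closedBall_iff_norm, not_le] at hx)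
        rw [add_sub_cancel] at this
        rw [this]
        simpa using hKq0
    have h3 : |(1 - χ x) * w x| ≤ C + 2 := by
      rw [abs_mul, abs_of_nonneg (by linarith)]
      nlinarith [hw x, abs_nonneg (w x)]
    exact (abs_add_le _ _).trans (by linarith)
  have hblu : ∀ w : EuclideanSpace ℝ (Fin d) → ℝ, (∀ x, u x ≤ w x) → ∀ x, u x ≤ blend w x := by
    intro w hw x
    have h0 := χ.nonneg (x := x)
    have h1 := χ.le_one (x := x)
    by_cases hx : ‖x - x₀‖ ≤ 2 * s
    · have h2 := htouch (x - x₀) hx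
      rw [add_sub_cancel] at h2
      simp only [hblend, hq]
      nlinarith [hw x]
    · have := hχ0 (x - x₀) (not_le.1 hx)
      rw [add_sub_cancel] at this
      simp only [hblend, this]
      linarith [hw x]
  have hjx : Measurable (j x₀) := hjm.of_uncurry_left
  have hind : Measurable ((closedBall (0 : EuclideanSpace ℝ (Fin d)) 1).indicator (fun _ =>
      (1 : ℝ))) :=
    measurable_const.indicator isClosed_closedBall.measurableSet
  set I : (EuclideanSpace ℝ (Fin d) → ℝ) → EuclideanSpace ℝ (Fin d) → ℝ :=
      fun w z => w (x₀ + j x₀ z) - u x₀ -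
      ⟪p, j x₀ z⟫ * (closedBall (0 : EuclideanSpace ℝ (Fin d)) 1).indicator (fun _ =>
        (1 : ℝ)) z with hI
  have hImeas : ∀ w : EuclideanSpace ℝ (Fin d) → ℝ, Measurable w → AEStronglyMeasurable (I w) μ :=
      by
    intro w hw
    simp only [hI]
    have h1 : Measurable fun z => ⟪p, j x₀ z⟫ := measurable_const.inner hjx
    exact (((hw.comp (measurable_const.add hjx)).sub measurable_const).sub
      (h1.mul hind)).aestronglyMeasurable
  have hblm : ∀ w : EuclideanSpace ℝ (Fin d) → ℝ, Measurable w → Measurable (blend w) := fun w hw =>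
    (χ.continuous.measurable.mul hqc.continuous.measurable).add
      ((measurable_const.sub χ.continuous.measurable).mul hw)
  obtain ⟨KA, hKA0, hKA⟩ := abs_quadF_le A
  set r := min 1 (s / cb) with hr
  have hr0 : 0 < r := by positivity
  set M := 1 / 2 * KA * cb ^ 2 + (Kq + (C + 2) + C + ‖p‖ * cb) / r ^ 2 with hM
  have hbound : ∀ w : EuclideanSpace ℝ (Fin d) → ℝ, (∀ x, |w x| ≤ C + 2) → ∀ z,
      ‖I (blend w) z‖ ≤ M * min (‖z‖ ^ 2) 1 := by
    intro w hw
    refine abs_le_mul_min_sq_one hr0 (min_le_left _ _) (by positivity) (by positivity)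
      (fun z hz => ?_) (fun z _ => ?_)
    · have hz1 : ‖z‖ ≤ 1 := hz.trans (min_le_left _ _)
      have hz2 : ‖z‖ ≤ s / cb := hz.trans (min_le_right _ _)
      rw [le_div_iff₀ hcb] at hz2
      have h1 : ‖j x₀ z‖ ≤ s := (hjb x₀ z).trans (by linarith)
      simp only [hI]
      rw [hbl1 w _ h1, Set.indicator_of_mem (mem_closedBall_zero_iff.2 hz1)]
      have h2 : u x₀ + ⟪p, j x₀ z⟫ + 1 / 2 * quadF A (j x₀ z) - u x₀ - ⟪p, j x₀ z⟫ * 1 =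
        1 / 2 * quadF A (j x₀ z) := by ring
      rw [h2, abs_mul, abs_of_pos (by norm_num : (0 : ℝ) < 1 / 2)]
      calc 1 / 2 * |quadF A (j x₀ z)| ≤ 1 / 2 * (KA * (cb * ‖z‖) ^ 2) := by
            gcongr
            exact (hKA _).trans (by gcongr; exact hjb x₀ z)
        _ = _ := by ring
    · have h1 := hblb w hw (x₀ + j x₀ z)
      have h2 := abs_inner_mul_indicator_le p _ z (hjb x₀ z) hcb.le
      have h3 := hC x₀
      rw [abs_le] at h1 h2 h3 ⊢
      simp only [hI]
      constructor <;> linarith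
  have hκ := (integrable_min_sq_one hLevy).const_mul M
  have hblx₀ : ∀ w, blend w x₀ = u x₀ := fun w => by
    have := hbl1 w 0 (by simpa using hs.le)
    simpa [quadF] using this
  have hILI : ∀ n, F x₀ (u x₀) p A (∫ z, I (blend (g n)) z ∂μ) ≤ 0 := by
    intro n
    have hc : ContDiff ℝ 2 (blend (g n)) :=
      (χ.contDiff.mul hqc).add ((contDiff_const.sub χ.contDiff).mul (hg1 n))
    have h1 := hsub _ hc ⟨_, hblb _ (hg3 n)⟩ x₀ (fun y => by
      rw [hblx₀]; linarith [hblu _ (hg2 n) y])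
    have hev : blend (g n) =ᶠ[𝓝 x₀] q := by
      filter_upwards [closedBall_mem_nhds x₀ hs] with x hx
      have := hbl1 (g n) (x - x₀) (mem_closedBall_iff_norm.1 hx)
      rw [add_sub_cancel] at this
      rw [this]
    obtain ⟨h2, h3⟩ := hessM_eq_of_eventuallyEq_quadratic hA hev
    rw [h2, h3, ILI, h2, hblx₀] at h1
    exact h1
  have hlim : Tendsto (fun n => ∫ z, I (blend (g n)) z ∂μ) atTop (𝓝 (∫ z, I (blend u) z ∂μ)) := by
    refine tendsto_integral_of_dominated_convergence _
      (fun n => hImeas _ (hblm _ (hg1 n).continuous.measurable)) hκ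
      (fun n => Eventually.of_forall (hbound _ (hg3 n))) (Eventually.of_forall fun z => ?_)
    simp only [hI, hblend]
    exact ((((hg4 _).const_mul _).const_add _).sub_const _).sub_const _
  have hCu : ∀ x, |u x| ≤ C + 2 := fun x => (hC x).trans (by linarith)
  have hint : Integrable (I (blend u)) μ :=
    Integrable.mono' hκ (hImeas _ (hblm _ hu.measurable)) (Eventually.of_forall (hbound _ hCu))
  have h1 := le_zero_of_tendsto hFc tendsto_const_nhds tendsto_const_nhds tendsto_const_nhds
    tendsto_const_nhds hlim hILI
  refine hFe.le_zero_of_le h1 (integral_mono hint hb fun z => ?_)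
  refine le_trans ?_ (hle z)
  simp only [hI]
  gcongr
  split_ifs with h
  · have h0 := χ.nonneg (x := x₀ + j x₀ z)
    have h1 := χ.le_one (x := x₀ + j x₀ z)
    have h2 := htouch _ h
    simp only [hblend, hqh]
    nlinarith
  · simp only [hblend, hχ0 _ (not_le.1 h)]
    linarith

end Nonlocal

section Nonlocal

variable {d : ℕ}

variable {μ : Measure (EuclideanSpace ℝ (Fin d))}
  {j : EuclideanSpace ℝ (Fin d) → EuclideanSpace ℝ (Fin d) → EuclideanSpace ℝ (Fin d)}
  {F : EuclideanSpace ℝ (Fin d) → ℝ → EuclideanSpace ℝ (Fin d) →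
      Matrix (Fin d) (Fin d) ℝ → ℝ → ℝ} {u g : EuclideanSpace ℝ (Fin d) → ℝ} {cb C Cg δ : ℝ}

/-- The integrand equal to `g (j x z)` for small jumps, and to that of `I2` for large jumps. -/
noncomputable def splitIntegrand
    (j : EuclideanSpace ℝ (Fin d) → EuclideanSpace ℝ (Fin d) → EuclideanSpace ℝ (Fin d)) (δ : ℝ)
    (x p : EuclideanSpace ℝ (Fin d)) (u g : EuclideanSpace ℝ (Fin d) → ℝ)
    (z : EuclideanSpace ℝ (Fin d)) : ℝ :=
  if ‖z‖ ≤ δ then g (j x z) else u (x + j x z) - u x -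
    ⟪p, j x z⟫ * (closedBall (0 : EuclideanSpace ℝ (Fin d)) 1).indicator (fun _ => (1 : ℝ)) z

theorem measurable_splitIntegrand (hjm : Measurable (Function.uncurry j)) (hu : Measurable u)
    (hg : Measurable g) (x p : EuclideanSpace ℝ (Fin d)) :
    Measurable (splitIntegrand j δ x p u g) := by
  have hjx : Measurable (j x) := hjm.of_uncurry_left
  have hind : Measurable ((closedBall (0 : EuclideanSpace ℝ (Fin d)) 1).indicator (fun _ =>
      (1 : ℝ))) :=
    measurable_const.indicator isClosed_closedBall.measurableSet
  have h1 : Measurable fun z => ⟪p, j x z⟫ := measurable_const.inner hjx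
  exact Measurable.ite (measurableSet_le measurable_norm measurable_const) (hg.comp hjx)
    (((hu.comp (measurable_const.add hjx)).sub measurable_const).sub (h1.mul hind))

theorem norm_splitIntegrand_le (hcb : 0 < cb) (hjb : ∀ x z, ‖j x z‖ ≤ cb * ‖z‖)
    (hC : ∀ x, |u x| ≤ C) (hCg : 0 ≤ Cg) (hg : ∀ h, ‖h‖ ≤ cb → |g h| ≤ Cg * ‖h‖ ^ 2)
    (hδ : 0 < δ) (hδ1 : δ < 1) (x p : EuclideanSpace ℝ (Fin d)) (z : EuclideanSpace ℝ (Fin d)) :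
    ‖splitIntegrand j δ x p u g z‖ ≤
      (Cg * cb ^ 2 + (2 * C + ‖p‖ * cb) / δ ^ 2) * min (‖z‖ ^ 2) 1 := by
  have hC0 : 0 ≤ C := (abs_nonneg _).trans (hC x)
  refine abs_le_mul_min_sq_one hδ hδ1.le (by positivity) (by positivity)
    (fun z hz => ?_) (fun z hz => ?_) z
  · rw [splitIntegrand, if_pos hz]
    have h1 : ‖j x z‖ ≤ cb := (hjb x z).trans (by nlinarith)
    calc _ ≤ Cg * ‖j x z‖ ^ 2 := hg _ h1
      _ ≤ Cg * (cb * ‖z‖) ^ 2 := by gcongr; exact hjb x z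
      _ = _ := by ring
  · rw [splitIntegrand, if_neg (not_le.2 hz)]
    have h1 := hC (x + j x z)
    have h2 := abs_inner_mul_indicator_le p _ z (hjb x z) hcb.le
    have h3 := hC x
    rw [abs_le] at h1 h2 h3 ⊢
    constructor <;> linarith

theorem integral_splitIntegrand {x p : EuclideanSpace ℝ (Fin d)}
    (h : Integrable (splitIntegrand j δ x p u g) μ) :
    ∫ z, splitIntegrand j δ x p u g z ∂μ =
      (∫ z in {z : EuclideanSpace ℝ (Fin d) | ‖z‖ ≤ δ}, g (j x z) ∂μ) + I2 μ j δ x p u := by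
  have hm : MeasurableSet {z : EuclideanSpace ℝ (Fin d) | ‖z‖ ≤ δ} :=
      measurableSet_le measurable_norm measurable_const
  have hc : {z : EuclideanSpace ℝ (Fin d) | ‖z‖ ≤ δ}ᶜ = {z : EuclideanSpace ℝ (Fin d) | δ < ‖z‖} :=
      by
    ext z; simp
  rw [← integral_add_compl hm h, hc, I2]
  congr 1
  · exact setIntegral_congr_fun hm fun z hz => if_pos hz
  · refine setIntegral_congr_fun (hc ▸ hm.compl) fun z hz => if_neg (not_le.2 hz)

theorem IsSubsolution.le_zero_of_second_order_touching
    (hLevy : ∫⁻ z, ENNReal.ofReal (min (‖z‖ ^ 2) 1) ∂μ < ⊤) (hcb : 0 < cb)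
    (hjm : Measurable (Function.uncurry j)) (hjb : ∀ x z, ‖j x z‖ ≤ cb * ‖z‖)
    (hFc : Continuous fun ξ : EuclideanSpace ℝ (Fin d) × ℝ × EuclideanSpace ℝ (Fin d) ×
      Matrix (Fin d) (Fin d) ℝ × ℝ => F ξ.1 ξ.2.1 ξ.2.2.1 ξ.2.2.2.1 ξ.2.2.2.2)
    (hFe : DegEll F) (hu : UpperSemicontinuous u) (hC : ∀ x, |u x| ≤ C)
    (hsub : IsSubsolution F μ j u) {x₀ p : EuclideanSpace ℝ (Fin d)} {A : Matrix (Fin d) (Fin d) ℝ}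
    (hA : A.IsSymm)
    (htouch : ∀ ε > 0, ∃ r > 0, ∀ h, ‖h‖ ≤ r →
      u (x₀ + h) ≤ u x₀ + ⟪p, h⟫ + 1 / 2 * quadF A h + ε * ‖h‖ ^ 2)
    (hgm : Measurable g) (hCg : 0 ≤ Cg) (hg : ∀ h, ‖h‖ ≤ cb → |g h| ≤ Cg * ‖h‖ ^ 2)
    (hug : ∀ h, ‖h‖ ≤ cb → u (x₀ + h) - u x₀ - ⟪p, h⟫ ≤ g h) (hδ : 0 < δ) (hδ1 : δ < 1) :
    F x₀ (u x₀) p A (∫ z, splitIntegrand j δ x₀ p u g z ∂μ) ≤ 0 := by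
  have hC0 : 0 ≤ C := (abs_nonneg _).trans (hC x₀)
  have hjx : Measurable (j x₀) := hjm.of_uncurry_left
  have hind : Measurable ((closedBall (0 : EuclideanSpace ℝ (Fin d)) 1).indicator (fun _ =>
      (1 : ℝ))) :=
    measurable_const.indicator isClosed_closedBall.measurableSet
  set e : ℕ → ℝ := fun m => 1 / ((m : ℝ) + 1) with he
  have he0 : ∀ m, 0 < e m := fun m => by simp only [he]; positivity
  have he1 : ∀ m, e m ≤ 1 := fun m => by
    simp only [he]
    rw [div_le_one (by positivity)]
    have : (0 : ℝ) ≤ m := m.cast_nonneg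
    linarith
  have het : Tendsto e atTop (𝓝 0) := tendsto_one_div_add_atTop_nhds_zero_nat
  choose r hr0 hr using fun m => htouch (e m) (he0 m)
  set s : ℕ → ℝ := fun m => min (r m) (e m) / 2 with hs
  have hs0 : ∀ m, 0 < s m := fun m => by
    have := hr0 m
    have := he0 m
    simp only [hs]; positivity
  have hsr : ∀ m, 2 * s m ≤ r m := fun m => by
    simp only [hs]; linarith [min_le_left (r m) (e m)]
  have hse : ∀ m, 2 * s m ≤ e m := fun m => by
    simp only [hs]; linarith [min_le_right (r m) (e m)]
  set Am : ℕ → Matrix (Fin d) (Fin d) ℝ := fun m => A + (2 * e m) • (1 : Matrix _ _ ℝ) with hAm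
  have hAms : ∀ m, (Am m).IsSymm := fun m => by
    simp only [hAm]
    exact hA.add (Matrix.isSymm_one.smul _)
  have hquad : ∀ m h, 1 / 2 * quadF (Am m) h = 1 / 2 * quadF A h + e m * ‖h‖ ^ 2 := by
    intro m h
    simp only [quadF, hAm, map_add, map_smul, LinearMap.add_apply, LinearMap.smul_apply,
      inner_add_left, real_inner_smul_left]
    have : Matrix.toEuclideanLin (1 : Matrix (Fin d) (Fin d) ℝ) h = h := by
      simp
    rw [this, real_inner_self_eq_norm_sq]
    ring
  have hAmt : Tendsto Am atTop (𝓝 A) := by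
    have h1 := ((het.const_mul 2).smul_const (1 : Matrix (Fin d) (Fin d) ℝ)).const_add A
    simpa using h1
  set b : ℕ → EuclideanSpace ℝ (Fin d) → ℝ := fun m z => if ‖z‖ ≤ δ then
      (if ‖j x₀ z‖ ≤ 2 * s m then 1 / 2 * quadF (Am m) (j x₀ z) else g (j x₀ z))
    else (if ‖j x₀ z‖ ≤ 2 * s m then u x₀ + ⟪p, j x₀ z⟫ + 1 / 2 * quadF (Am m) (j x₀ z)
      else u (x₀ + j x₀ z)) - u x₀ -
      ⟪p, j x₀ z⟫ * (closedBall (0 : EuclideanSpace ℝ (Fin d)) 1).indicator (fun _ =>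
        (1 : ℝ)) z with hb
  have hbm : ∀ m, Measurable (b m) := by
    intro m
    have h1 : Measurable fun z => ⟪p, j x₀ z⟫ := measurable_const.inner hjx
    have h2 : Measurable fun z => 1 / 2 * quadF (Am m) (j x₀ z) :=
      measurable_const.mul ((continuous_quadF _).measurable.comp hjx)
    have h3 : MeasurableSet {z | ‖j x₀ z‖ ≤ 2 * s m} := measurableSet_le hjx.norm measurable_const
    exact Measurable.ite (measurableSet_le measurable_norm measurable_const)
      (Measurable.ite h3 h2 (hgm.comp hjx))
      (((Measurable.ite h3 ((measurable_const.add h1).add h2)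
        (hu.measurable.comp (measurable_const.add hjx))).sub measurable_const).sub (h1.mul hind))
  obtain ⟨KA, hKA0, hKA⟩ := abs_quadF_le A
  have hqb : ∀ m h, |1 / 2 * quadF (Am m) h| ≤ (KA + 1) * ‖h‖ ^ 2 := by
    intro m h
    rw [hquad]
    have h1 := hKA h
    have h2 : 0 ≤ e m * ‖h‖ ^ 2 := mul_nonneg (he0 m).le (by positivity)
    have h3 : e m * ‖h‖ ^ 2 ≤ 1 * ‖h‖ ^ 2 := by gcongr; exact he1 m
    rw [abs_le] at h1 ⊢
    constructor <;> nlinarith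
  set M := (KA + 1 + Cg) * cb ^ 2 + (2 * C + ‖p‖ + (KA + 1) + ‖p‖ * cb) / δ ^ 2 with hM
  have hbb : ∀ m z, ‖b m z‖ ≤ M * min (‖z‖ ^ 2) 1 := by
    intro m
    refine abs_le_mul_min_sq_one hδ hδ1.le (by positivity) (by positivity)
      (fun z hz => ?_) (fun z hz => ?_)
    · simp only [hb]
      rw [if_pos hz]
      have h1 : ‖j x₀ z‖ ≤ cb := (hjb x₀ z).trans (by nlinarith)
      have h2 : |if ‖j x₀ z‖ ≤ 2 * s m then 1 / 2 * quadF (Am m) (j x₀ z) else g (j x₀ z)| ≤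
          (KA + 1 + Cg) * ‖j x₀ z‖ ^ 2 := by
        have h3 : 0 ≤ Cg * ‖j x₀ z‖ ^ 2 := by positivity
        have h4 : 0 ≤ (KA + 1) * ‖j x₀ z‖ ^ 2 := by positivity
        split_ifs
        · exact (hqb m _).trans (by linarith)
        · exact (hg _ h1).trans (by linarith)
      calc _ ≤ (KA + 1 + Cg) * ‖j x₀ z‖ ^ 2 := h2
        _ ≤ (KA + 1 + Cg) * (cb * ‖z‖) ^ 2 := by gcongr; exact hjb x₀ z
        _ = _ := by ring
    · simp only [hb]
      rw [if_neg (not_le.2 hz)]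
      have h2 := abs_inner_mul_indicator_le p _ z (hjb x₀ z) hcb.le
      have h3 := hC x₀
      have h4 : |(if ‖j x₀ z‖ ≤ 2 * s m then u x₀ + ⟪p, j x₀ z⟫ + 1 / 2 * quadF (Am m) (j x₀ z)
          else u (x₀ + j x₀ z))| ≤ C + ‖p‖ + (KA + 1) := by
        split_ifs with h
        · have h5 : ‖j x₀ z‖ ≤ 1 := h.trans ((hse m).trans (he1 m))
          have h6 : |⟪p, j x₀ z⟫| ≤ ‖p‖ := (abs_real_inner_le_norm _ _).trans
            (by nlinarith [norm_nonneg p])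
          have h7 : |1 / 2 * quadF (Am m) (j x₀ z)| ≤ KA + 1 := (hqb m _).trans (by
            have : ‖j x₀ z‖ ^ 2 ≤ 1 := by nlinarith [norm_nonneg (j x₀ z)]
            nlinarith)
          rw [abs_le] at h3 h6 h7 ⊢
          constructor <;> linarith
        · refine (hC _).trans ?_
          have := norm_nonneg p
          linarith
      rw [abs_le] at h2 h3 h4 ⊢
      constructor <;> linarith
  have hκ := (integrable_min_sq_one hLevy).const_mul M
  have hF : ∀ m, F x₀ (u x₀) p (Am m) (∫ z, b m z ∂μ) ≤ 0 := by
    intro m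
    refine hsub.le_zero_of_quadratic_touching hLevy hcb hjm hjb hFc hFe hu hC (hAms m) (hs0 m)
      (fun h hh => ?_) (hκ.mono' (hbm m).aestronglyMeasurable (Eventually.of_forall (hbb m)))
      fun z => ?_
    · rw [hquad]
      linarith [hr m h (hh.trans (hsr m))]
    · simp only [hb]
      by_cases hz : ‖z‖ ≤ δ
      · rw [if_pos hz, Set.indicator_of_mem (mem_closedBall_zero_iff.2 (hz.trans hδ1.le))]
        have h1 : ‖j x₀ z‖ ≤ cb := (hjb x₀ z).trans (by nlinarith)
        split_ifs
        · linarith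
        · linarith [hug _ h1]
      · rw [if_neg hz]
  have hlim : Tendsto (fun m => ∫ z, b m z ∂μ) atTop
      (𝓝 (∫ z, splitIntegrand j δ x₀ p u g z ∂μ)) := by
    refine tendsto_integral_of_dominated_convergence _
      (fun m => (hbm m).aestronglyMeasurable) hκ
      (fun m => Eventually.of_forall (hbb m)) (Eventually.of_forall fun z => ?_)
    refine tendsto_const_nhds.congr' ?_
    rcases eq_or_ne (j x₀ z) 0 with h0 | h0
    · have hg0 : g 0 = 0 := by
        have := hg 0 (by simpa using hcb.le)
        simpa using this
      refine Eventually.of_forall fun m => ?_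
      have h2 : 0 ≤ s m := (hs0 m).le
      simp [splitIntegrand, hb, h0, hg0, quadF, h2]
    · have h1 : ∀ᶠ m in atTop, e m < ‖j x₀ z‖ :=
        (tendsto_order.1 het).2 _ (norm_pos_iff.2 h0)
      filter_upwards [h1] with m hm
      have h2 : ¬ ‖j x₀ z‖ ≤ 2 * s m := not_le.2 ((hse m).trans_lt hm)
      simp only [splitIntegrand, hb, if_neg h2]
  exact le_zero_of_tendsto hFc tendsto_const_nhds tendsto_const_nhds tendsto_const_nhds
    hAmt hlim hF

theorem IsSubsolution.le_zero_of_tendsto_touching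
    (hLevy : ∫⁻ z, ENNReal.ofReal (min (‖z‖ ^ 2) 1) ∂μ < ⊤) (hcb : 0 < cb)
    (hjm : Measurable (Function.uncurry j)) (hjb : ∀ x z, ‖j x z‖ ≤ cb * ‖z‖)
    (hjc : ∀ z, Continuous fun x => j x z)
    (hFc : Continuous fun ξ : EuclideanSpace ℝ (Fin d) × ℝ × EuclideanSpace ℝ (Fin d) ×
      Matrix (Fin d) (Fin d) ℝ × ℝ => F ξ.1 ξ.2.1 ξ.2.2.1 ξ.2.2.2.1 ξ.2.2.2.2)
    (hFe : DegEll F) (hu : UpperSemicontinuous u) (hC : ∀ x, |u x| ≤ C)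
    (hsub : IsSubsolution F μ j u) {x p : ℕ → EuclideanSpace ℝ (Fin d)}
    {A : ℕ → Matrix (Fin d) (Fin d) ℝ}
    {g : ℕ → EuclideanSpace ℝ (Fin d) → ℝ} (hA : ∀ k, (A k).IsSymm)
    (htouch : ∀ k, ∀ ε > 0, ∃ r > 0, ∀ h, ‖h‖ ≤ r →
      u (x k + h) ≤ u (x k) + ⟪p k, h⟫ + 1 / 2 * quadF (A k) h + ε * ‖h‖ ^ 2)
    (hgm : ∀ k, Measurable (g k)) (hCg : 0 ≤ Cg)
    (hg : ∀ k h, ‖h‖ ≤ cb → |g k h| ≤ Cg * ‖h‖ ^ 2)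
    (hug : ∀ k h, ‖h‖ ≤ cb → u (x k + h) - u (x k) - ⟪p k, h⟫ ≤ g k h)
    (hδ : 0 < δ) (hδ1 : δ < 1) {x₀ p₀ : EuclideanSpace ℝ (Fin d)} {A₀ : Matrix (Fin d) (Fin d) ℝ}
    {g₀ : EuclideanSpace ℝ (Fin d) → ℝ}
    (hx : Tendsto x atTop (𝓝 x₀)) (hux : Tendsto (fun k => u (x k)) atTop (𝓝 (u x₀)))
    (hp : Tendsto p atTop (𝓝 p₀)) (hAt : Tendsto A atTop (𝓝 A₀)) (hg₀m : Measurable g₀)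
    (hgt : ∀ (h : ℕ → EuclideanSpace ℝ (Fin d)) (h₀ : EuclideanSpace ℝ (Fin d)),
    (∀ k, ‖h k‖ ≤ cb) → Tendsto h atTop (𝓝 h₀) →
      Tendsto (fun k => g k (h k)) atTop (𝓝 (g₀ h₀))) :
    F x₀ (u x₀) p₀ A₀ ((∫ z in {z : EuclideanSpace ℝ (Fin d) | ‖z‖ ≤ δ}, g₀ (j x₀ z) ∂μ) + I2 μ j δ
      x₀ p₀ u) ≤ 0 := by
  have hC0 : 0 ≤ C := (abs_nonneg _).trans (hC x₀)
  obtain ⟨Cp, hCp⟩ := hp.norm.bddAbove_range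
  have hpC : ∀ k, ‖p k‖ ≤ Cp := fun k => hCp ⟨k, rfl⟩
  have hCp0 : 0 ≤ Cp := (norm_nonneg _).trans (hpC 0)
  have hp₀C : ‖p₀‖ ≤ Cp := le_of_tendsto' hp.norm hpC
  have hg₀ : ∀ h, ‖h‖ ≤ cb → |g₀ h| ≤ Cg * ‖h‖ ^ 2 := fun h hh =>
    le_of_tendsto' (hgt (fun _ => h) h (fun _ => hh) tendsto_const_nhds).abs fun k => hg k h hh
  set M := Cg * cb ^ 2 + (2 * C + Cp * cb) / δ ^ 2 with hM
  set b : ℕ → EuclideanSpace ℝ (Fin d) → ℝ :=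
      fun k => splitIntegrand j δ (x k) (p k) u (g k) with hb
  set b₀ := splitIntegrand j δ x₀ p₀ u g₀ with hb₀
  have hbb : ∀ k z, ‖b k z‖ ≤ M * min (‖z‖ ^ 2) 1 := fun k z =>
    (norm_splitIntegrand_le hcb hjb hC hCg (hg k) hδ hδ1 _ _ z).trans (by
      rw [hM]
      gcongr
      exact hpC k)
  have hb₀b : ∀ z, ‖b₀ z‖ ≤ M * min (‖z‖ ^ 2) 1 := fun z =>
    (norm_splitIntegrand_le hcb hjb hC hCg hg₀ hδ hδ1 _ _ z).trans (by
      rw [hM]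
      gcongr)
  have hbm : ∀ k, Measurable (b k) := fun k =>
    measurable_splitIntegrand hjm hu.measurable (hgm k) _ _
  have hb₀m : Measurable b₀ := measurable_splitIntegrand hjm hu.measurable hg₀m _ _
  have hκ := (integrable_min_sq_one hLevy).const_mul M
  have hbi : ∀ k, Integrable (b k) μ := fun k =>
    hκ.mono' (hbm k).aestronglyMeasurable (Eventually.of_forall (hbb k))
  have hb₀i : Integrable b₀ μ :=
    hκ.mono' hb₀m.aestronglyMeasurable (Eventually.of_forall hb₀b)
  have hF : ∀ k, F (x k) (u (x k)) (p k) (A k) (∫ z, max (b k z) (b₀ z) ∂μ) ≤ 0 := fun k =>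
    hFe.le_zero_of_le (hsub.le_zero_of_second_order_touching hLevy hcb hjm hjb hFc hFe hu hC
      (hA k) (htouch k) (hgm k) hCg (hg k) (hug k) hδ hδ1)
      (integral_mono (hbi k) ((hbi k).sup hb₀i) fun z => le_max_left _ _)
  have hlim : Tendsto (fun k => ∫ z, max (b k z) (b₀ z) ∂μ) atTop (𝓝 (∫ z, b₀ z ∂μ)) := by
    refine tendsto_integral_of_dominated_convergence _
      (fun k => ((hbm k).max hb₀m).aestronglyMeasurable) hκ
      (fun k => Eventually.of_forall fun z => ?_) (Eventually.of_forall fun z => ?_)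
    · exact (abs_max_le_max_abs_abs).trans (max_le (hbb k z) (hb₀b z))
    · have hjt : Tendsto (fun k => j (x k) z) atTop (𝓝 (j x₀ z)) := ((hjc z).tendsto x₀).comp hx
      by_cases hz : ‖z‖ ≤ δ
      · have h1 : Tendsto (fun k => g k (j (x k) z)) atTop (𝓝 (g₀ (j x₀ z))) :=
          hgt _ _ (fun k => (hjb _ z).trans (by nlinarith)) hjt
        simp only [hb, hb₀, splitIntegrand, if_pos hz]
        simpa using h1.max (tendsto_const_nhds (x := g₀ (j x₀ z)))
      · simp only [hb, hb₀, splitIntegrand, if_neg hz]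
        rw [tendsto_order]
        refine ⟨fun c hc => Eventually.of_forall fun k => lt_max_of_lt_right hc, fun c hc => ?_⟩
        set i := (closedBall (0 : EuclideanSpace ℝ (Fin d)) 1).indicator (fun _ => (1 : ℝ)) z
        have h1 : Tendsto (fun k => u (x k) + ⟪p k, j (x k) z⟫ * i) atTop
            (𝓝 (u x₀ + ⟪p₀, j x₀ z⟫ * i)) := hux.add ((hp.inner hjt).mul_const i)
        set γ := (c - (u (x₀ + j x₀ z) - u x₀ - ⟪p₀, j x₀ z⟫ * i)) / 2 with hγ
        have hγ0 : 0 < γ := by rw [hγ]; linarith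
        have h2 := (tendsto_order.1 h1).1 (u x₀ + ⟪p₀, j x₀ z⟫ * i - γ) (by linarith)
        have h3 := (hx.add hjt).eventually
          (hu (x₀ + j x₀ z) (u (x₀ + j x₀ z) + γ) (by linarith))
        filter_upwards [h2, h3] with k h4 h5
        refine max_lt ?_ hc
        linarith
  have h1 := le_zero_of_tendsto hFc hx hux hp hAt hlim hF
  rwa [integral_splitIntegrand hb₀i] at h1

end Nonlocal

theorem gradient_neg_fun {E : Type*} [NormedAddCommGroup E] [InnerProductSpace ℝ E]
    [CompleteSpace E] (f : E → ℝ) (x : E) :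
    gradient (fun y => -f y) x = -gradient f x := by
  have : (fun y => -f y) = -f := rfl
  simp [gradient, this, fderiv_neg]

section Nonlocal

variable {d : ℕ}

theorem hessM_neg (φ : EuclideanSpace ℝ (Fin d) → ℝ) (x : EuclideanSpace ℝ (Fin d)) :
    hessM (fun y => -φ y) x = -hessM φ x := by
  ext i k
  have : (fun y => -φ y) = -φ := rfl
  simp [hessM, this, iteratedFDeriv_neg]

theorem ILI_neg (μ : Measure (EuclideanSpace ℝ (Fin d)))
    (j : EuclideanSpace ℝ (Fin d) → EuclideanSpace ℝ (Fin d) → EuclideanSpace ℝ (Fin d))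
    (x : EuclideanSpace ℝ (Fin d)) (φ : EuclideanSpace ℝ (Fin d) → ℝ) :
    ILI μ j x (fun y => -φ y) = -ILI μ j x φ := by
  simp only [ILI, gradient_neg_fun, ← integral_neg]
  congr 1
  ext z
  rw [inner_neg_left]
  ring

theorem I2_neg (μ : Measure (EuclideanSpace ℝ (Fin d)))
    (j : EuclideanSpace ℝ (Fin d) → EuclideanSpace ℝ (Fin d) → EuclideanSpace ℝ (Fin d))
    (δ : ℝ) (x p : EuclideanSpace ℝ (Fin d)) (w : EuclideanSpace ℝ (Fin d) → ℝ) :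
    I2 μ j δ x (-p) (fun y => -w y) = -I2 μ j δ x p w := by
  simp only [I2, ← integral_neg]
  congr 1
  ext z
  rw [inner_neg_left]
  ring

theorem I1_neg (μ : Measure (EuclideanSpace ℝ (Fin d)))
    (j : EuclideanSpace ℝ (Fin d) → EuclideanSpace ℝ (Fin d) → EuclideanSpace ℝ (Fin d))
    (δ : ℝ) (x : EuclideanSpace ℝ (Fin d)) (φ : EuclideanSpace ℝ (Fin d) → ℝ) :
    I1 μ j δ x (fun y => -φ y) = -I1 μ j δ x φ := by
  simp only [I1, gradient_neg_fun, ← integral_neg]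
  congr 1
  ext z
  rw [inner_neg_left]
  ring

variable {F : EuclideanSpace ℝ (Fin d) → ℝ → EuclideanSpace ℝ (Fin d) →
      Matrix (Fin d) (Fin d) ℝ → ℝ → ℝ}

theorem DegEll.neg (hF : DegEll F) : DegEll fun x s p M l => -F x (-s) (-p) (-M) (-l) := by
  intro x s p M N l₁ l₂ hMN hl
  have : (-N - -M).PosSemidef := by rwa [neg_sub_neg]
  exact neg_le_neg (hF x (-s) (-p) (-N) (-M) (-l₂) (-l₁) this (neg_le_neg hl))

theorem continuous_neg_reflect
    (hFc : Continuous fun ξ : EuclideanSpace ℝ (Fin d) × ℝ × EuclideanSpace ℝ (Fin d) ×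
      Matrix (Fin d) (Fin d) ℝ × ℝ => F ξ.1 ξ.2.1 ξ.2.2.1 ξ.2.2.2.1 ξ.2.2.2.2) :
    Continuous fun ξ : EuclideanSpace ℝ (Fin d) × ℝ × EuclideanSpace ℝ (Fin d) ×
      Matrix (Fin d) (Fin d) ℝ × ℝ => -F ξ.1 (-ξ.2.1) (-ξ.2.2.1) (-ξ.2.2.2.1) (-ξ.2.2.2.2) :=
  (hFc.comp (f := fun ξ : EuclideanSpace ℝ (Fin d) × ℝ × EuclideanSpace ℝ (Fin d) ×
      Matrix (Fin d) (Fin d) ℝ × ℝ => (ξ.1, -ξ.2.1, -ξ.2.2.1, -ξ.2.2.2.1, -ξ.2.2.2.2))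
    (by fun_prop)).neg

theorem IsSupersolution.neg {μ : Measure (EuclideanSpace ℝ (Fin d))}
    {j : EuclideanSpace ℝ (Fin d) → EuclideanSpace ℝ (Fin d) → EuclideanSpace ℝ (Fin d)}
    {v : EuclideanSpace ℝ (Fin d) → ℝ} (hv : IsSupersolution F μ j v) :
    IsSubsolution (fun x s p M l => -F x (-s) (-p) (-M) (-l)) μ j fun x => -v x := by
  intro φ hφ ⟨C, hC⟩ x hx
  have h := hv (fun y => -φ y) hφ.neg ⟨C, fun y => by simpa using hC y⟩ x
    fun y => by linarith [hx y]
  rw [gradient_neg_fun, hessM_neg, ILI_neg] at h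
  simpa using h

end Nonlocal

section ContactPoints

variable {V : Type*} [NormedAddCommGroup V] [InnerProductSpace ℝ V]

theorem norm_sq_div_sub (α : ℝ) (z z' : V) :
    ‖z'‖ ^ 2 / (2 * α) = ‖z‖ ^ 2 / (2 * α) + ⟪(1 / α) • z, z' - z⟫ + ‖z' - z‖ ^ 2 / (2 * α) := by
  have h : ‖z'‖ ^ 2 = ‖z‖ ^ 2 + 2 * ⟪z, z' - z⟫ + ‖z' - z‖ ^ 2 := by
    rw [← norm_add_sq_real, add_sub_cancel]
  rw [h, real_inner_smul_left]
  rcases eq_or_ne α 0 with rfl | hα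
  · simp
  · field_simp

theorem exists_tilted_maximizer [FiniteDimensional ℝ V] {U : V → ℝ} (hU : UpperSemicontinuous U)
    {C : ℝ} (hC : ∀ x, |U x| ≤ C) (P : V) {α : ℝ}
    (hαC : 2 * C + ‖P‖ < 1 / (2 * α)) :
    ∃ Zm : V → V, (∀ z, ‖Zm z - z‖ ≤ 1) ∧ ∀ z Z,
      U Z - ⟪P, Z - z⟫ - ‖Z - z‖ ^ 2 / (2 * α) ≤
        U (Zm z) - ⟪P, Zm z - z⟫ - ‖Zm z - z‖ ^ 2 / (2 * α) := by
  have key : ∀ z, ∃ Zm, ‖Zm - z‖ ≤ 1 ∧ ∀ Z,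
      U Z - ⟪P, Z - z⟫ - ‖Z - z‖ ^ 2 / (2 * α) ≤
        U Zm - ⟪P, Zm - z⟫ - ‖Zm - z‖ ^ 2 / (2 * α) := by
    intro z
    have hc : Continuous fun Z => -⟪P, Z - z⟫ - ‖Z - z‖ ^ 2 / (2 * α) := by fun_prop
    have husc := hU.add hc.upperSemicontinuous
    obtain ⟨Zm, hZm, hmax⟩ := (husc.upperSemicontinuousOn (closedBall z 1)).exists_isMaxOn
      (nonempty_closedBall.2 zero_le_one) (isCompact_closedBall z 1)
    refine ⟨Zm, by rwa [← mem_closedBall_iff_norm], fun Z => ?_⟩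
    by_cases hZ : Z ∈ closedBall z 1
    · have := isMaxOn_iff.1 hmax Z hZ
      linarith
    · have h1 := isMaxOn_iff.1 hmax z (mem_closedBall_self zero_le_one)
      simp only [sub_self, inner_zero_right, norm_zero] at h1
      rw [mem_closedBall_iff_norm, not_le] at hZ
      set s := ‖Z - z‖
      have h2 := (abs_le.1 (abs_real_inner_le_norm P (Z - z))).1
      have h3 : s ^ 2 / (2 * α) = s ^ 2 * (1 / (2 * α)) := by ring
      have h4 := (abs_le.1 (hC Z)).2
      have h5 := (abs_le.1 (hC z)).1
      have hC0 : 0 ≤ C := (abs_nonneg _).trans (hC z)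
      have h6 : s ^ 2 * (2 * C + ‖P‖) ≤ s ^ 2 * (1 / (2 * α)) := by gcongr
      have h7 : 2 * C + ‖P‖ * s ≤ s ^ 2 * (2 * C + ‖P‖) := by
        have : ‖P‖ * s ≤ ‖P‖ * s ^ 2 := by
          gcongr
          nlinarith
        have h8 : C ≤ C * s ^ 2 := le_mul_of_one_le_right hC0 (one_le_pow₀ hZ.le)
        linarith
      have h8 : (0 : ℝ) ^ 2 / (2 * α) = 0 := by simp
      rw [h3]
      linarith
  choose Zm h1 h2 using key
  exact ⟨Zm, h1, h2⟩

theorem tilted_envelope_semiconvex {U : V → ℝ} {P : V} {α : ℝ} {Zm : V → V}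
    (hJ : ∀ z Z, U Z - ⟪P, Z - z⟫ - ‖Z - z‖ ^ 2 / (2 * α) ≤
        U (Zm z) - ⟪P, Zm z - z⟫ - ‖Zm z - z‖ ^ 2 / (2 * α)) (z z' : V) :
    (U (Zm z) - ⟪P, Zm z - z⟫ - ‖Zm z - z‖ ^ 2 / (2 * α)) +
        ⟪P + (1 / α) • (Zm z - z), z' - z⟫ - ‖z' - z‖ ^ 2 / (2 * α) ≤
      U (Zm z') - ⟪P, Zm z' - z'⟫ - ‖Zm z' - z'‖ ^ 2 / (2 * α) := by
  have h1 := hJ z' (Zm z)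
  have h2 : Zm z - z' = (Zm z - z) - (z' - z) := by abel
  have h3 := norm_sq_div_sub α (Zm z - z) (Zm z - z')
  have h4 : Zm z - z' - (Zm z - z) = -(z' - z) := by abel
  rw [h4, inner_neg_right, norm_neg] at h3
  have h5 : ⟪P, Zm z - z'⟫ = ⟪P, Zm z - z⟫ - ⟪P, z' - z⟫ := by rw [h2, inner_sub_right]
  rw [inner_add_left]
  linarith

variable [FiniteDimensional ℝ V]

theorem continuous_of_semiconvex {w : V → ℝ} {π : V → V} {α : ℝ}
    (hπ : ∀ z z', w z + ⟪π z, z' - z⟫ - ‖z' - z‖ ^ 2 / (2 * α) ≤ w z') : Continuous w := by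
  have h := continuous_of_subgradients (f := fun z => w z + ‖z‖ ^ 2 / (2 * α))
    (η := fun z => π z + (1 / α) • z) fun z z' => by
      have h1 := hπ z z'
      have h2 := norm_sq_div_sub α z z'
      rw [inner_add_left]
      linarith
  have h2 : Continuous fun z : V => ‖z‖ ^ 2 / (2 * α) := by fun_prop
  exact (h.sub h2).congr fun z => add_sub_cancel_right _ _

theorem semiconvex_contact_points {w ψ : V → ℝ} {π : V → V} {α c : ℝ}
    (hπ : ∀ z z', w z + ⟪π z, z' - z⟫ - ‖z' - z‖ ^ 2 / (2 * α) ≤ w z') {z₀ : V} {R : ℝ}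
    (hψc : ContinuousOn ψ (closedBall z₀ R)) (hψ : ∀ z ∈ ball z₀ R, ContDiffAt ℝ 2 ψ z)
    (hle : ∀ z ∈ closedBall z₀ R, w z ≤ ψ z + c) (h0 : w z₀ = ψ z₀ + c) {ε : ℝ} (hε : 0 < ε)
    (hεR : ε < R) :
    ∃ z : V, ∃ B : V →L[ℝ] V, ‖z - z₀‖ ≤ ε ∧ ‖π z - gradient ψ z‖ ≤ 2 * ε * ε + ε ∧
      (∀ z' ∈ closedBall z₀ R, w z' - w z - ⟪π z, z' - z⟫ ≤
        ψ z' - ψ z - ⟪gradient ψ z, z' - z⟫ + ε * ‖z' - z‖ ^ 2) ∧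
      (∀ ε' > 0, ∃ ρ > 0, ∀ h, ‖h‖ ≤ ρ →
        |w (z + h) - w z - ⟪π z, h⟫ - 1 / 2 * ⟪B h, h⟫| ≤ ε' * ‖h‖ ^ 2) ∧
      ∀ h, -(1 / α) * ‖h‖ ^ 2 ≤ ⟪B h, h⟫ ∧
        ⟪B h, h⟫ ≤ fderiv ℝ (fderiv ℝ ψ) z h h + 2 * ε * ‖h‖ ^ 2 := by
  have hR : 0 < R := hε.trans hεR
  have hsq : ContDiff ℝ 2 fun z : V => ‖z‖ ^ 2 / (2 * α) := (contDiff_norm_sq ℝ).div_const _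
  obtain ⟨z, r, B, hz, hr, hη, hcon, hexp⟩ := jensen_contact_points
    (f := fun z => w z + ‖z‖ ^ 2 / (2 * α)) (Ψ := fun z => ψ z + (c + ‖z‖ ^ 2 / (2 * α)))
    (η := fun z => π z + (1 / α) • z) (fun z z' => by
      have h1 := hπ z z'
      have h2 := norm_sq_div_sub α z z'
      rw [inner_add_left]
      linarith) hR (hψc.add (continuous_const.add hsq.continuous).continuousOn)
    ((hψ z₀ (mem_ball_self hR)).add (contDiffAt_const.add hsq.contDiffAt))
    (fun z hz => by
      have := hle z hz
      linarith) (by rw [h0]; ring) hε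
  have hzb : z ∈ ball z₀ R := mem_ball_iff_norm.2 (hz.trans_lt hεR)
  have hgrad : gradient (fun z => ψ z + (c + ‖z‖ ^ 2 / (2 * α))) z =
      gradient ψ z + (1 / α) • z := by
    have h1 : DifferentiableAt ℝ ψ z := (hψ z hzb).differentiableAt (by norm_num)
    refine HasGradientAt.gradient (hasGradientAt_iff_hasFDerivAt.2 ?_)
    have h3 : HasFDerivAt (fun z : V => ‖z‖ ^ 2 / (2 * α))
        ((InnerProductSpace.toDual ℝ V) ((1 / α) • z)) z := by
      refine hasFDerivAt_of_abs_sub_le (C := |1 / (2 * α)|) one_pos fun z' _ => le_of_eq ?_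
      have h4 : ‖z'‖ ^ 2 / (2 * α) - ‖z‖ ^ 2 / (2 * α) - ⟪(1 / α) • z, z' - z⟫ =
          1 / (2 * α) * ‖z' - z‖ ^ 2 := by
        rw [norm_sq_div_sub α z z']
        ring
      rw [h4, abs_mul, abs_sq]
    have h6 := h1.hasGradientAt.hasFDerivAt.add (h3.const_add c)
    rwa [← map_add] at h6
  rw [hgrad] at hη hcon
  refine ⟨z, B - (1 / α) • ContinuousLinearMap.id ℝ V, hz, ?_, fun z' hz' => ?_, ?_⟩
  · have h1 : π z - gradient ψ z = (2 * ε) • (z - z₀) + r := by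
      have : π z = π z + (1 / α) • z - (1 / α) • z := by abel
      rw [this, hη]
      abel
    rw [h1]
    refine (norm_add_le _ _).trans ?_
    rw [norm_smul, Real.norm_of_nonneg (by positivity)]
    gcongr
  · have h1 := hcon z' hz'
    have h2 := norm_sq_div_sub α z z'
    rw [inner_add_left, inner_add_left] at h1
    linarith
  have hBq : ∀ h : V, ⟪(B - (1 / α) • ContinuousLinearMap.id ℝ V) h, h⟫ =
      ⟪B h, h⟫ - 1 / α * ‖h‖ ^ 2 := by
    intro h
    simp [inner_sub_left, real_inner_smul_left]
  have hexp' : ∀ ε' > 0, ∃ ρ > 0, ∀ h, ‖h‖ ≤ ρ → |w (z + h) - w z - ⟪π z, h⟫ -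
      1 / 2 * ⟪(B - (1 / α) • ContinuousLinearMap.id ℝ V) h, h⟫| ≤ ε' * ‖h‖ ^ 2 := by
    intro ε' hε'
    obtain ⟨ρ, hρ, h1⟩ := hexp ε' hε'
    refine ⟨ρ, hρ, fun h hh => ?_⟩
    have h2 := h1 h hh
    have h3 := norm_sq_div_sub α z (z + h)
    rw [add_sub_cancel_left] at h3
    rw [hBq]
    convert h2 using 2
    rw [inner_add_left, h3]
    ring
  refine ⟨hexp', fun h => ?_⟩
  have hhom : ∀ (T : V →L[ℝ] V) (t : ℝ) h, ⟪T (t • h), t • h⟫ = t ^ 2 * ⟪T h, h⟫ := by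
    intro T t h
    rw [map_smul, real_inner_smul_left, real_inner_smul_right]
    ring
  constructor
  · refine le_of_second_order_bounds (q₁ := fun h : V => -(1 / α) * ‖h‖ ^ 2)
      (q₂ := fun h => ⟪(B - (1 / α) • ContinuousLinearMap.id ℝ V) h, h⟫)
      (fun t h => by rw [norm_smul, mul_pow, Real.norm_eq_abs, sq_abs]; ring)
      (hhom _) (fun ε' hε' => ?_) h
    obtain ⟨ρ, hρ, h1⟩ := hexp' (ε' / 2) (by positivity)
    refine ⟨ρ, hρ, fun h hh => ?_⟩
    have h2 := (abs_le.1 (h1 h hh)).2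
    have h3 := hπ z (z + h)
    rw [add_sub_cancel_left] at h3
    have h4 : ‖h‖ ^ 2 / (2 * α) = 1 / 2 * (1 / α * ‖h‖ ^ 2) := by
      rw [div_eq_mul_inv, mul_inv, one_div, one_div]
      ring
    rw [h4] at h3
    linarith
  · refine le_of_second_order_bounds
      (q₁ := fun h => ⟪(B - (1 / α) • ContinuousLinearMap.id ℝ V) h, h⟫)
      (q₂ := fun h => fderiv ℝ (fderiv ℝ ψ) z h h + 2 * ε * ‖h‖ ^ 2)
      (hhom _) (fun t h => by
        simp only [map_smul, FunLike.coe_smul, Pi.smul_apply, smul_eq_mul]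
        rw [norm_smul, mul_pow, Real.norm_eq_abs, sq_abs]
        ring) (fun ε' hε' => ?_) h
    obtain ⟨ρ, hρ, h1⟩ := hexp' (ε' / 4) (by positivity)
    obtain ⟨ρ', hρ', h2⟩ := second_order_taylor (hψ z hzb) (ε' / 4) (by positivity)
    have hRz : 0 < R - ‖z - z₀‖ := by linarith
    refine ⟨min (min ρ ρ') (R - ‖z - z₀‖), by positivity, fun h hh => ?_⟩
    have h3 := (abs_le.1 (h1 h (hh.trans ((min_le_left _ _).trans (min_le_left _ _))))).1
    have h4 := (abs_le.1 (h2 h (hh.trans ((min_le_left _ _).trans (min_le_right _ _))))).2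
    have h5 := hcon (z + h) (by
      rw [mem_closedBall_iff_norm]
      have h6 := hh.trans (min_le_right _ _)
      have h7 : z + h - z₀ = (z - z₀) + h := by abel
      rw [h7]
      exact (norm_add_le _ _).trans (by linarith))
    have h6 := norm_sq_div_sub α z (z + h)
    rw [add_sub_cancel_left] at h5 h6
    rw [inner_add_left, inner_add_left, inner_gradient_left] at h5
    linarith

end ContactPoints

section ContactPoints

variable {V : Type*} [NormedAddCommGroup V] [InnerProductSpace ℝ V]

theorem abs_sub_sub_fderiv_le {ψ : V → ℝ} {K : Set V} (hK : Convex ℝ K)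
    (hψ : ∀ z ∈ K, ContDiffAt ℝ 2 ψ z) {L : ℝ} (hL0 : 0 ≤ L)
    (hL : ∀ z ∈ K, ‖fderiv ℝ (fderiv ℝ ψ) z‖ ≤ L) {z z' : V} (hz : z ∈ K) (hz' : z' ∈ K) :
    |ψ z' - ψ z - fderiv ℝ ψ z (z' - z)| ≤ L * ‖z' - z‖ ^ 2 := by
  set S := K ∩ closedBall z ‖z' - z‖
  have hS : Convex ℝ S := hK.inter (convex_closedBall _ _)
  have h1 : ∀ y ∈ S, ‖fderiv ℝ ψ y - fderiv ℝ ψ z‖ ≤ L * ‖z' - z‖ := fun y hy => by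
    refine (hK.norm_image_sub_le_of_norm_fderiv_le (𝕜 := ℝ) (f := fderiv ℝ ψ) (fun y hy =>
      ((hψ y hy).fderiv_right (m := 1) (by norm_num)).differentiableAt (by norm_num))
      hL hz hy.1).trans ?_
    gcongr
    exact mem_closedBall_iff_norm.1 hy.2
  have h2 := hS.norm_image_sub_le_of_norm_fderiv_le' (𝕜 := ℝ) (f := ψ)
    (fun y hy => (hψ y hy.1).differentiableAt (by norm_num)) h1
    ⟨hz, mem_closedBall_self (norm_nonneg _)⟩ ⟨hz', mem_closedBall_iff_norm.2 le_rfl⟩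
  rw [Real.norm_eq_abs] at h2
  refine h2.trans (le_of_eq ?_)
  ring

variable [FiniteDimensional ℝ V]

theorem exists_bound_fderiv_fderiv {ψ : V → ℝ} {z₀ : V} {R R' : ℝ} (hRR : R < R')
    (hψ : ∀ z ∈ ball z₀ R', ContDiffAt ℝ 2 ψ z) :
    ∃ L, 0 ≤ L ∧ ∀ z ∈ closedBall z₀ R, ‖fderiv ℝ (fderiv ℝ ψ) z‖ ≤ L := by
  have hc : ContinuousOn (fun z => fderiv ℝ (fderiv ℝ ψ) z) (closedBall z₀ R) := fun z hz =>
    ((((hψ z (closedBall_subset_ball hRR hz)).fderiv_right (m := 1) (by norm_num)).fderiv_right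
      (m := 0) (by norm_num)).continuousAt).continuousWithinAt
  obtain ⟨L, hL⟩ := (isCompact_closedBall z₀ R).exists_bound_of_continuousOn
    (f := fun z => fderiv ℝ (fderiv ℝ ψ) z) hc
  exact ⟨max L 0, le_max_right _ _, fun z hz => (hL z hz).trans (le_max_left _ _)⟩

end ContactPoints

section Nonlocal

variable {d : ℕ}

theorem exists_isSymm_quadF_eq
    (T : EuclideanSpace ℝ (Fin d) →L[ℝ] EuclideanSpace ℝ (Fin d)) :
    ∃ A : Matrix (Fin d) (Fin d) ℝ, A.IsSymm ∧ ∀ h, quadF A h = ⟪T h, h⟫ := by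
  set S : EuclideanSpace ℝ (Fin d) →L[ℝ] EuclideanSpace ℝ (Fin d) :=
    (1 / 2 : ℝ) • (T + ContinuousLinearMap.adjoint T) with hS
  have hSs : (S : EuclideanSpace ℝ (Fin d) →ₗ[ℝ] EuclideanSpace ℝ (Fin d)).IsSymmetric := by
    intro x y
    simp only [hS, ContinuousLinearMap.coe_coe, FunLike.coe_smul, Pi.smul_apply,
      FunLike.coe_add, Pi.add_apply, real_inner_smul_left, real_inner_smul_right,
      inner_add_left, inner_add_right, ContinuousLinearMap.adjoint_inner_left,
      ContinuousLinearMap.adjoint_inner_right]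
    ring
  refine ⟨Matrix.toEuclideanLin.symm S, ?_, fun h => ?_⟩
  · have h1 : (Matrix.toEuclideanLin.symm
        (S : EuclideanSpace ℝ (Fin d) →ₗ[ℝ] EuclideanSpace ℝ (Fin d))).IsHermitian := by
      rw [← Matrix.isSymmetric_toEuclideanLin_iff, LinearEquiv.apply_symm_apply]
      exact hSs
    rw [Matrix.IsHermitian, Matrix.conjTranspose_eq_transpose_of_trivial] at h1
    exact h1
  · rw [quadF, LinearEquiv.apply_symm_apply]
    simp only [hS, ContinuousLinearMap.coe_coe, FunLike.coe_smul, Pi.smul_apply,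
      FunLike.coe_add, Pi.add_apply, real_inner_smul_left,
      inner_add_left, ContinuousLinearMap.adjoint_inner_left]
    rw [real_inner_comm h (T h)]
    ring

theorem abs_apply_le_of_abs_quadF_le {A : Matrix (Fin d) (Fin d) ℝ} (hA : A.IsSymm) {K : ℝ}
    (hK : ∀ h, |quadF A h| ≤ K * ‖h‖ ^ 2) (i k : Fin d) : |A i k| ≤ 2 * K := by
  set e := fun i : Fin d => EuclideanSpace.single i (1 : ℝ)
  have he : ∀ i, ‖e i‖ = 1 := fun i => by simp [e]
  have hs : (Matrix.toEuclideanLin A).IsSymmetric := by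
    rw [Matrix.isSymmetric_toEuclideanLin_iff, Matrix.IsHermitian,
      Matrix.conjTranspose_eq_transpose_of_trivial]
    exact hA
  have h1 : A i k = ⟪Matrix.toEuclideanLin A (e k), e i⟫ := by
    simp [e, EuclideanSpace.inner_single_right, Matrix.toLpLin_apply]
  have h2 : ⟪Matrix.toEuclideanLin A (e k), e i⟫ =
      (quadF A (e k + e i) - quadF A (e k - e i)) / 4 := by
    have := hs (e i) (e k)
    rw [real_inner_comm] at this
    simp only [quadF, map_add, map_sub, inner_add_left, inner_add_right, inner_sub_left,
      inner_sub_right]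
    linarith [real_inner_comm (e i) (Matrix.toEuclideanLin A (e k)),
      real_inner_comm (e k) (Matrix.toEuclideanLin A (e i))]
  have h3 := hK (e k + e i)
  have h4 := hK (e k - e i)
  have h5 : ‖e k + e i‖ ^ 2 + ‖e k - e i‖ ^ 2 = 4 := by
    have := parallelogram_law_with_norm ℝ (e k) (e i)
    rw [he, he] at this
    nlinarith
  have h6 : 0 ≤ K := by
    have := (abs_nonneg _).trans (hK (e k))
    rwa [he, one_pow, mul_one] at this
  rw [h1, h2]
  have h7 : K * ‖e k + e i‖ ^ 2 + K * ‖e k - e i‖ ^ 2 = K * 4 := by rw [← mul_add, h5]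
  rw [abs_le] at h3 h4 ⊢
  constructor <;> linarith

theorem exists_subseq_tendsto_of_abs_quadF_le {A A' : ℕ → Matrix (Fin d) (Fin d) ℝ}
    (hA : ∀ n, (A n).IsSymm) (hA' : ∀ n, (A' n).IsSymm) {K : ℝ}
    (hK : ∀ n h, |quadF (A n) h| ≤ K * ‖h‖ ^ 2) (hK' : ∀ n h, |quadF (A' n) h| ≤ K * ‖h‖ ^ 2) :
    ∃ A₀ A'₀ : Matrix (Fin d) (Fin d) ℝ, ∃ θ : ℕ → ℕ, StrictMono θ ∧
      Tendsto (fun n => A (θ n)) atTop (𝓝 A₀) ∧ Tendsto (fun n => A' (θ n)) atTop (𝓝 A'₀) := by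
  have hc : IsCompact (Set.univ.pi fun _ : Fin d => Set.univ.pi fun _ : Fin d =>
      Set.Icc (-(2 * K)) (2 * K)) :=
    isCompact_univ_pi fun _ => isCompact_univ_pi fun _ => isCompact_Icc
  have hmem : ∀ {A : Matrix (Fin d) (Fin d) ℝ}, A.IsSymm → (∀ h, |quadF A h| ≤ K * ‖h‖ ^ 2) →
      (A : Fin d → Fin d → ℝ) ∈ (Set.univ.pi fun _ : Fin d => Set.univ.pi fun _ : Fin d =>
      Set.Icc (-(2 * K)) (2 * K)) := fun hA hK i _ k _ =>
    abs_le.1 (abs_apply_le_of_abs_quadF_le hA hK i k)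
  obtain ⟨a, -, θ, hθ, hlim⟩ := (hc.prod hc).tendsto_subseq
    (X := (Fin d → Fin d → ℝ) × (Fin d → Fin d → ℝ)) (x := fun n => (A n, A' n))
    fun n => ⟨hmem (hA n) (hK n), hmem (hA' n) (hK' n)⟩
  exact ⟨a.1, a.2, θ, hθ, (continuous_fst.tendsto a).comp hlim,
    (continuous_snd.tendsto a).comp hlim⟩

variable {μ : Measure (EuclideanSpace ℝ (Fin d))}
  {j : EuclideanSpace ℝ (Fin d) → EuclideanSpace ℝ (Fin d) → EuclideanSpace ℝ (Fin d)}
  {F : EuclideanSpace ℝ (Fin d) → ℝ → EuclideanSpace ℝ (Fin d) →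
      Matrix (Fin d) (Fin d) ℝ → ℝ → ℝ} {u : EuclideanSpace ℝ (Fin d) → ℝ} {cb C δ : ℝ}
  {V : Type*} [NormedAddCommGroup V] [InnerProductSpace ℝ V] [FiniteDimensional ℝ V]

theorem IsSubsolution.le_zero_of_contact_sequence
    (hLevy : ∫⁻ z, ENNReal.ofReal (min (‖z‖ ^ 2) 1) ∂μ < ⊤) (hcb : 0 < cb)
    (hjm : Measurable (Function.uncurry j)) (hjb : ∀ x z, ‖j x z‖ ≤ cb * ‖z‖)
    (hjc : ∀ z, Continuous fun x => j x z)
    (hFc : Continuous fun ξ : EuclideanSpace ℝ (Fin d) × ℝ × EuclideanSpace ℝ (Fin d) ×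
      Matrix (Fin d) (Fin d) ℝ × ℝ => F ξ.1 ξ.2.1 ξ.2.2.1 ξ.2.2.2.1 ξ.2.2.2.2)
    (hFe : DegEll F) (hu : UpperSemicontinuous u) (hC : ∀ x, |u x| ≤ C)
    (hsub : IsSubsolution F μ j u) (hδ : 0 < δ) (hδ1 : δ < 1)
    (ι : EuclideanSpace ℝ (Fin d) →ₗᵢ[ℝ] V) {w ψ : V → ℝ} {z₀ P : V}
    (hψc : Continuous ψ) (hψ : ∀ z ∈ ball z₀ (cb + 2), ContDiffAt ℝ 2 ψ z)
    (hP : gradient ψ z₀ = P) {z π : ℕ → V} {B : ℕ → V →L[ℝ] V} {ε : ℕ → ℝ}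
    (hε1 : ∀ k, ε k ≤ 1) (hzε : ∀ k, ‖z k - z₀‖ ≤ ε k) (hεt : Tendsto ε atTop (𝓝 0))
    (hπ : Tendsto π atTop (𝓝 P))
    (hcon : ∀ k, ∀ z' ∈ closedBall z₀ (cb + 1), w z' - w (z k) - ⟪π k, z' - z k⟫ ≤
        ψ z' - ψ (z k) - ⟪gradient ψ (z k), z' - z k⟫ + ε k * ‖z' - z k‖ ^ 2)
    (hexp : ∀ k, ∀ ε' > 0, ∃ ρ > 0, ∀ h, ‖h‖ ≤ ρ →
        |w (z k + h) - w (z k) - ⟪π k, h⟫ - 1 / 2 * ⟪B k h, h⟫| ≤ ε' * ‖h‖ ^ 2)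
    {x : ℕ → EuclideanSpace ℝ (Fin d)} {A : ℕ → Matrix (Fin d) (Fin d) ℝ}
    {x₀ : EuclideanSpace ℝ (Fin d)} {A₀ : Matrix (Fin d) (Fin d) ℝ}
    (huw : ∀ k h, u (x k + h) - u (x k) ≤ w (z k + ι h) - w (z k))
    (hA : ∀ k, (A k).IsSymm) (hAq : ∀ k h, quadF (A k) h = ⟪B k (ι h), ι h⟫)
    (hx : Tendsto x atTop (𝓝 x₀)) (hux : Tendsto (fun k => u (x k)) atTop (𝓝 (u x₀)))
    (hAt : Tendsto A atTop (𝓝 A₀)) {p : EuclideanSpace ℝ (Fin d)}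
    (hp : ∀ h, ⟪p, h⟫ = ⟪P, ι h⟫) :
    F x₀ (u x₀) p A₀
      ((∫ z in {z : EuclideanSpace ℝ (Fin d) | ‖z‖ ≤ δ},
        (ψ (z₀ + ι (j x₀ z)) - ψ z₀ - ⟪p, j x₀ z⟫) ∂μ) + I2 μ j δ x₀ p u) ≤ 0 := by
  have hz : Tendsto z atTop (𝓝 z₀) := by
    rw [tendsto_iff_norm_sub_tendsto_zero]
    exact squeeze_zero (fun _ => norm_nonneg _) hzε hεt
  have hε0 : ∀ k, 0 ≤ ε k := fun k => (norm_nonneg _).trans (hzε k)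
  have hz₀b : z₀ ∈ ball z₀ (cb + 2) := mem_ball_self (by linarith)
  have hmem : ∀ k (h : EuclideanSpace ℝ (Fin d)), ‖h‖ ≤ cb →
      z k + ι h ∈ closedBall z₀ (cb + 1) := fun k h hh => by
    rw [mem_closedBall_iff_norm, add_sub_right_comm]
    refine (norm_add_le _ _).trans ?_
    rw [ι.norm_map]
    linarith [hzε k, hε1 k]
  have hmem' : ∀ k, z k ∈ closedBall z₀ (cb + 1) := fun k => by
    simpa using hmem k 0 (by simpa using hcb.le)
  have hsubset : closedBall z₀ (cb + 1) ⊆ ball z₀ (cb + 2) := closedBall_subset_ball (by linarith)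
  obtain ⟨L, hL0, hL⟩ := exists_bound_fderiv_fderiv (R := cb + 1) (by linarith) hψ
  set ι' := ContinuousLinearMap.adjoint ι.toContinuousLinearMap with hι'
  have hι : ∀ (P : V) h, ⟪ι' P, h⟫ = ⟪P, ι h⟫ := fun P h => by
    rw [hι', ContinuousLinearMap.adjoint_inner_left]
    rfl
  have hpP : p = ι' P := ext_inner_right ℝ fun h => by rw [hp, hι]
  refine hsub.le_zero_of_tendsto_touching hLevy hcb hjm hjb hjc hFc hFe hu hC (x := x)
    (p := fun k => ι' (π k)) (A := A) (Cg := L + 1)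
    (g := fun k h => ψ (z k + ι h) - ψ (z k) - ⟪gradient ψ (z k), ι h⟫ + ε k * ‖h‖ ^ 2)
    (g₀ := fun h => ψ (z₀ + ι h) - ψ z₀ - ⟪p, h⟫) hA (fun k ε' hε' => ?_) (fun k => ?_)
    (by positivity) (fun k h hh => ?_) (fun k h hh => ?_) hδ hδ1 hx hux ?_ hAt ?_
    fun h h₀ hh ht => ?_
  · obtain ⟨ρ, hρ, h1⟩ := hexp k ε' hε'
    refine ⟨ρ, hρ, fun h hh => ?_⟩
    have h2 := (abs_le.1 (h1 (ι h) (by rwa [ι.norm_map]))).2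
    rw [ι.norm_map] at h2
    rw [hι, hAq]
    linarith [huw k h]
  · have := ι.continuous
    exact Continuous.measurable (by fun_prop)
  · have h1 := abs_sub_sub_fderiv_le (convex_closedBall z₀ (cb + 1))
      (fun y hy => hψ y (hsubset hy)) hL0 hL (hmem' k) (hmem k h hh)
    rw [add_sub_cancel_left, ι.norm_map] at h1
    rw [inner_gradient_left]
    refine (abs_add_le _ _).trans ?_
    rw [abs_of_nonneg (mul_nonneg (hε0 k) (sq_nonneg _)), add_mul]
    have h2 := hε1 k
    gcongr
  · have h1 := hcon k _ (hmem k h hh)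
    rw [add_sub_cancel_left, ι.norm_map] at h1
    rw [hι]
    linarith [huw k h]
  · rw [hpP]
    exact (ι'.continuous.tendsto P).comp hπ
  · have := ι.continuous
    exact Continuous.measurable (by fun_prop)
  · have hg : Tendsto (fun k => gradient ψ (z k)) atTop (𝓝 P) := by
      rw [← hP]
      exact (hψ z₀ hz₀b).gradient_contDiffAt.continuousAt.tendsto.comp hz
    have h1 : Tendsto (fun k => ι (h k)) atTop (𝓝 (ι h₀)) := (ι.continuous.tendsto h₀).comp ht
    have h2 : Tendsto (fun k => ψ (z k + ι (h k))) atTop (𝓝 (ψ (z₀ + ι h₀))) :=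
      (hψc.tendsto _).comp (hz.add h1)
    have h3 := ((h2.sub ((hψc.tendsto z₀).comp hz)).sub (hg.inner h1)).add
      (hεt.mul (ht.norm.pow 2))
    simpa [hp] using h3

end Nonlocal

section ProductSpace

variable {E : Type*} [NormedAddCommGroup E] [InnerProductSpace ℝ E]

/-- The isometric embedding `h ↦ (h, 0)` into the Hilbert product. -/
noncomputable def prodInl (E : Type*) [NormedAddCommGroup E] [InnerProductSpace ℝ E] :
    E →ₗᵢ[ℝ] WithLp 2 (E × E) where
  toFun h := WithLp.toLp 2 (h, 0)
  map_add' h k := by rw [← WithLp.toLp_add, Prod.mk_add_mk, add_zero]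
  map_smul' c h := by
    rw [RingHom.id_apply, ← WithLp.toLp_smul, Prod.smul_mk, smul_zero]
  norm_map' h := by simp

/-- The isometric embedding `h ↦ (0, h)` into the Hilbert product. -/
noncomputable def prodInr (E : Type*) [NormedAddCommGroup E] [InnerProductSpace ℝ E] :
    E →ₗᵢ[ℝ] WithLp 2 (E × E) where
  toFun h := WithLp.toLp 2 (0, h)
  map_add' h k := by rw [← WithLp.toLp_add, Prod.mk_add_mk, add_zero]
  map_smul' c h := by
    rw [RingHom.id_apply, ← WithLp.toLp_smul, Prod.smul_mk, smul_zero]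
  norm_map' h := by simp

theorem prodInl_apply (h : E) : prodInl E h = WithLp.toLp 2 (h, 0) := rfl

theorem prodInr_apply (h : E) : prodInr E h = WithLp.toLp 2 (0, h) := rfl

theorem isCompact_unit_bicylinder [FiniteDimensional ℝ E] :
    IsCompact {w : WithLp 2 (E × E) | ‖w.fst‖ ≤ 1 ∧ ‖w.snd‖ ≤ 1} ∧
      closedBall 0 1 ⊆ {w : WithLp 2 (E × E) | ‖w.fst‖ ≤ 1 ∧ ‖w.snd‖ ≤ 1} ∧
      {w : WithLp 2 (E × E) | ‖w.fst‖ ≤ 1 ∧ ‖w.snd‖ ≤ 1} ⊆ closedBall 0 2 := by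
  have h2 : {w : WithLp 2 (E × E) | ‖w.fst‖ ≤ 1 ∧ ‖w.snd‖ ≤ 1} ⊆ closedBall 0 2 := by
    intro w hw
    rw [mem_closedBall_zero_iff]
    have h := WithLp.prod_norm_sq_eq_of_L2 w
    have h3 : ‖w.fst‖ ≤ 1 := hw.1
    have h4 : ‖w.snd‖ ≤ 1 := hw.2
    nlinarith [norm_nonneg w, norm_nonneg w.fst, norm_nonneg w.snd]
  refine ⟨(isCompact_closedBall 0 2).of_isClosed_subset ?_ h2, fun w hw => ?_, h2⟩
  · exact (isClosed_le (f := fun w : WithLp 2 (E × E) => ‖w.fst‖) (by fun_prop)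
      continuous_const).inter
      (isClosed_le (f := fun w : WithLp 2 (E × E) => ‖w.snd‖) (by fun_prop) continuous_const)
  · rw [mem_closedBall_zero_iff] at hw
    have h := WithLp.prod_norm_sq_eq_of_L2 w
    constructor <;> nlinarith [norm_nonneg w, norm_nonneg w.fst, norm_nonneg w.snd]

theorem toLp_eq_add_prodInl (x y : E) :
    WithLp.toLp 2 (x, y) = WithLp.toLp 2 (0, y) + prodInl E x := by
  rw [prodInl_apply, ← WithLp.toLp_add, Prod.mk_add_mk, add_zero, zero_add]

theorem toLp_eq_add_prodInr (x y : E) :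
    WithLp.toLp 2 (x, y) = WithLp.toLp 2 (x, 0) + prodInr E y := by
  rw [prodInr_apply, ← WithLp.toLp_add, Prod.mk_add_mk, add_zero, zero_add]

theorem iteratedFDeriv_two_comp_toLp (ψ : WithLp 2 (E × E) → ℝ) (x : E × E) (m : Fin 2 → E × E) :
    iteratedFDeriv ℝ 2 (fun xy : E × E => ψ (WithLp.toLp 2 xy)) x m =
      fderiv ℝ (fderiv ℝ ψ) (WithLp.toLp 2 x) (WithLp.toLp 2 (m 0)) (WithLp.toLp 2 (m 1)) := by
  have h := (WithLp.prodContinuousLinearEquiv 2 ℝ E E).symm.iteratedFDerivWithin_comp_right ψ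
    uniqueDiffOn_univ (x := x) (Set.mem_univ _) 2
  rw [Set.preimage_univ, iteratedFDerivWithin_univ, iteratedFDerivWithin_univ] at h
  have h1 : (ψ ∘ (WithLp.prodContinuousLinearEquiv 2 ℝ E E).symm) =
      fun xy : E × E => ψ (WithLp.toLp 2 xy) := rfl
  rw [h1] at h
  rw [h, ContinuousMultilinearMap.compContinuousLinearMap_apply, iteratedFDeriv_two_apply]
  rfl

variable [FiniteDimensional ℝ E]

theorem gradient_comp_of_isometry {V : Type*} [NormedAddCommGroup V] [InnerProductSpace ℝ V]
    [FiniteDimensional ℝ V] (ι : E →ₗᵢ[ℝ] V) (z : V) {ψ : V → ℝ} {x : E}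
    (hψ : DifferentiableAt ℝ ψ (z + ι x)) (h : E) :
    ⟪gradient (fun x' => ψ (z + ι x')) x, h⟫ = ⟪gradient ψ (z + ι x), ι h⟫ := by
  rw [inner_gradient_left, inner_gradient_left]
  have h1 : HasFDerivAt (fun x' => z + ι x') (ι.toContinuousLinearMap) x :=
    (ι.toContinuousLinearMap.hasFDerivAt).const_add z
  have h2 : HasFDerivAt (fun x' => ψ (z + ι x'))
    ((fderiv ℝ ψ (z + ι x)).comp ι.toContinuousLinearMap) x := hψ.hasFDerivAt.comp x h1
  rw [h2.fderiv]
  rfl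

theorem inner_gradient_partial_fst {ψ : WithLp 2 (E × E) → ℝ} {x y : E}
    (hψ : DifferentiableAt ℝ ψ (WithLp.toLp 2 (x, y))) (h : E) :
    ⟪gradient (fun x' => ψ (WithLp.toLp 2 (x', y))) x, h⟫ =
      ⟪gradient ψ (WithLp.toLp 2 (x, y)), prodInl E h⟫ := by
  have h1 : (fun x' => ψ (WithLp.toLp 2 (x', y))) =
      fun x' => ψ (WithLp.toLp 2 (0, y) + prodInl E x') :=
    funext fun x' => congrArg ψ (toLp_eq_add_prodInl x' y)
  rw [toLp_eq_add_prodInl] at hψ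
  rw [h1, toLp_eq_add_prodInl x y]
  exact gradient_comp_of_isometry _ _ hψ h

theorem inner_gradient_partial_snd {ψ : WithLp 2 (E × E) → ℝ} {x y : E}
    (hψ : DifferentiableAt ℝ ψ (WithLp.toLp 2 (x, y))) (h : E) :
    ⟪gradient (fun y' => ψ (WithLp.toLp 2 (x, y'))) y, h⟫ =
      ⟪gradient ψ (WithLp.toLp 2 (x, y)), prodInr E h⟫ := by
  have h1 : (fun y' => ψ (WithLp.toLp 2 (x, y'))) =
      fun y' => ψ (WithLp.toLp 2 (x, 0) + prodInr E y') :=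
    funext fun y' => congrArg ψ (toLp_eq_add_prodInr x y')
  rw [toLp_eq_add_prodInr] at hψ
  rw [h1, toLp_eq_add_prodInr x y]
  exact gradient_comp_of_isometry _ _ hψ h

end ProductSpace

theorem continuous_quadF_matrix {d : ℕ} (h : EuclideanSpace ℝ (Fin d)) :
    Continuous fun A : Matrix (Fin d) (Fin d) ℝ => quadF A h := by
  simp only [quadF, Matrix.toLpLin_apply]
  fun_prop

theorem quadF_neg {d : ℕ} (A : Matrix (Fin d) (Fin d) ℝ) (h : EuclideanSpace ℝ (Fin d)) :
    quadF (-A) h = -quadF A h := by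
  simp [quadF]

theorem continuous_supConv {V : Type*} [NormedAddCommGroup V] [InnerProductSpace ℝ V]
    {C₀ : Set V} (hC : IsCompact C₀) {φ : V → ℝ} (hφ : Continuous φ) (P : V) (α : ℝ) :
    Continuous (supConv C₀ φ P α) := by
  refine hC.continuous_sSup (f := fun z w => φ (z + w) - ⟪P, w⟫ - ‖w‖ ^ 2 / (2 * α)) ?_
  simp only [Function.HasUncurry.uncurry, id]
  fun_prop

theorem RsupP_eq_supConv {d : ℕ}
    (φ : EuclideanSpace ℝ (Fin d) → EuclideanSpace ℝ (Fin d) → ℝ) (α : ℝ)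
    (x y a b : EuclideanSpace ℝ (Fin d)) :
    RsupP φ α x y a b =
      supConv {w : WithLp 2 (EuclideanSpace ℝ (Fin d) × EuclideanSpace ℝ (Fin d)) |
        ‖w.fst‖ ≤ 1 ∧ ‖w.snd‖ ≤ 1} (fun z => φ z.fst z.snd) (WithLp.toLp 2 (a, b)) α
        (WithLp.toLp 2 (x, y)) := by
  rw [RsupP, supConv]
  congr 1
  ext t
  constructor
  · rintro ⟨⟨X, Y⟩, ⟨hX, hY⟩, rfl⟩
    refine ⟨WithLp.toLp 2 (X - x, Y - y),
      ⟨mem_closedBall_iff_norm.1 hX, mem_closedBall_iff_norm.1 hY⟩, ?_⟩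
    simp only [WithLp.prod_norm_sq_eq_of_L2, WithLp.prod_inner_apply, WithLp.add_fst,
      WithLp.add_snd, WithLp.toLp_fst, WithLp.toLp_snd, add_sub_cancel]
    ring
  · rintro ⟨w, ⟨hw1, hw2⟩, rfl⟩
    refine ⟨(x + w.fst, y + w.snd), ⟨by simpa using hw1, by simpa using hw2⟩, ?_⟩
    simp only [WithLp.prod_norm_sq_eq_of_L2, WithLp.prod_inner_apply, WithLp.add_fst,
      WithLp.add_snd, WithLp.toLp_fst, WithLp.toLp_snd, add_sub_cancel_left, WithLp.ofLp_fst,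
      WithLp.ofLp_snd]
    ring

section TiltedEnvelope

variable {E : Type*} [NormedAddCommGroup E] [InnerProductSpace ℝ E]

theorem tilted_envelope_translate {U : E → ℝ} {P : E} {α : ℝ} {Zm : E → E}
    (hJ : ∀ z Z, U Z - ⟪P, Z - z⟫ - ‖Z - z‖ ^ 2 / (2 * α) ≤
        U (Zm z) - ⟪P, Zm z - z⟫ - ‖Zm z - z‖ ^ 2 / (2 * α)) (z h : E) :
    U (Zm z + h) - U (Zm z) ≤
      (U (Zm (z + h)) - ⟪P, Zm (z + h) - (z + h)⟫ - ‖Zm (z + h) - (z + h)‖ ^ 2 / (2 * α)) -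
        (U (Zm z) - ⟪P, Zm z - z⟫ - ‖Zm z - z‖ ^ 2 / (2 * α)) := by
  have h1 := hJ (z + h) (Zm z + h)
  rw [add_sub_add_right_eq_sub] at h1
  linarith

theorem tendsto_tilted_maximizer [FiniteDimensional ℝ E] {U : E → ℝ} {P : E} {α : ℝ} {Zm : E → E}
    (hα : 0 < α)
    (hJ : ∀ z Z, U Z - ⟪P, Z - z⟫ - ‖Z - z‖ ^ 2 / (2 * α) ≤
        U (Zm z) - ⟪P, Zm z - z⟫ - ‖Zm z - z‖ ^ 2 / (2 * α)) {x : ℕ → E} {x₀ : E}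
    (hx : Tendsto x atTop (𝓝 x₀))
    (hg : Tendsto (fun k => P + (1 / α) • (Zm (x k) - x k)) atTop (𝓝 P))
    (h0 : U (Zm x₀) - ⟪P, Zm x₀ - x₀⟫ - ‖Zm x₀ - x₀‖ ^ 2 / (2 * α) = U x₀) :
    Tendsto (fun k => Zm (x k)) atTop (𝓝 x₀) ∧
      Tendsto (fun k => U (Zm (x k))) atTop (𝓝 (U x₀)) := by
  have hd : Tendsto (fun k => Zm (x k) - x k) atTop (𝓝 0) := by
    have h1 := (hg.sub_const P).const_smul α
    simpa [smul_smul, hα.ne'] using h1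
  have hc := (continuous_of_semiconvex (tilted_envelope_semiconvex hJ)).tendsto x₀
  have he := hc.comp hx
  rw [h0] at he
  refine ⟨by simpa using hd.add hx, ?_⟩
  have hc₂ : Continuous fun y : E => ⟪P, y⟫ + ‖y‖ ^ 2 / (2 * α) := by fun_prop
  have h2 := (hc₂.tendsto 0).comp hd
  have h3 := he.add h2
  simp only [inner_zero_right, norm_zero, ne_eq, OfNat.ofNat_ne_zero, not_false_eq_true, zero_pow,
    zero_div, add_zero] at h3
  refine h3.congr fun k => ?_
  simp only [Function.comp_apply]
  ring

end TiltedEnvelope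

section SeparatedContact

theorem toLp_fst_snd_eq_add {E : Type*} [NormedAddCommGroup E] [InnerProductSpace ℝ E]
    (w : WithLp 2 (E × E)) : w = prodInl E w.fst + prodInr E w.snd := by
  rw [prodInl_apply, prodInr_apply, ← WithLp.toLp_add, Prod.mk_add_mk, add_zero, zero_add]
  rfl

theorem inner_block_add_le {E : Type*} [NormedAddCommGroup E] [InnerProductSpace ℝ E]
    {a b : E → ℝ} {z π : WithLp 2 (E × E)} {B : WithLp 2 (E × E) →L[ℝ] WithLp 2 (E × E)}
    (hexp : ∀ ε > 0, ∃ ρ > 0, ∀ h : WithLp 2 (E × E), ‖h‖ ≤ ρ →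
      |(a (z + h).fst + b (z + h).snd) - (a z.fst + b z.snd) - ⟪π, h⟫ - 1 / 2 * ⟪B h, h⟫| ≤
        ε * ‖h‖ ^ 2) (ξ η : E) :
    ⟪B (prodInl E ξ), prodInl E ξ⟫ + ⟪B (prodInr E η), prodInr E η⟫ ≤
      ⟪B (WithLp.toLp 2 (ξ, η)), WithLp.toLp 2 (ξ, η)⟫ := by
  refine le_of_second_order_bounds
    (q₁ := fun h : WithLp 2 (E × E) => ⟪B (prodInl E h.fst), prodInl E h.fst⟫ +
      ⟪B (prodInr E h.snd), prodInr E h.snd⟫) (q₂ := fun h => ⟪B h, h⟫) (fun t h => ?_)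
    (fun t h => ?_) (fun ε hε => ?_) (WithLp.toLp 2 (ξ, η))
  · simp only [WithLp.smul_fst, WithLp.smul_snd, map_smul, inner_smul_left, inner_smul_right,
      RCLike.conj_to_real]
    ring
  · simp only [map_smul, inner_smul_left, inner_smul_right, RCLike.conj_to_real]
    ring
  · obtain ⟨ρ, hρ, h⟩ := hexp (ε / 6) (by positivity)
    refine ⟨ρ, hρ, fun w hw => ?_⟩
    have h1 := (abs_le.1 (h w hw)).2
    have hf : ‖prodInl E w.fst‖ ≤ ‖w‖ := by
      rw [LinearIsometry.norm_map]; exact WithLp.norm_fst_le _ w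
    have hs : ‖prodInr E w.snd‖ ≤ ‖w‖ := by
      rw [LinearIsometry.norm_map]; exact WithLp.norm_snd_le _ w
    have h2 := (abs_le.1 (h _ (hf.trans hw))).1
    have h3 := (abs_le.1 (h _ (hs.trans hw))).1
    have h4 := (abs_le.1 (h w hw)).1
    have h2' := (abs_le.1 (h _ (hf.trans hw))).2
    have h3' := (abs_le.1 (h _ (hs.trans hw))).2
    have hi : ⟪π, w⟫ = ⟪π, prodInl E w.fst⟫ + ⟪π, prodInr E w.snd⟫ := by
      rw [← inner_add_right, ← toLp_fst_snd_eq_add]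
    have hf2 : ‖prodInl E w.fst‖ ^ 2 ≤ ‖w‖ ^ 2 := by gcongr
    have hs2 : ‖prodInr E w.snd‖ ^ 2 ≤ ‖w‖ ^ 2 := by gcongr
    simp only [WithLp.add_fst, WithLp.add_snd, prodInl_apply, prodInr_apply, WithLp.toLp_fst,
      WithLp.toLp_snd, add_zero] at h1 h2 h3 h4 h2' h3' hi hf2 hs2 ⊢
    nlinarith

variable {d : ℕ}

theorem exists_separated_contact_sequence {a b : EuclideanSpace ℝ (Fin d) → ℝ}
    {πa πb : EuclideanSpace ℝ (Fin d) → EuclideanSpace ℝ (Fin d)} {α c R R' : ℝ} (hα : 0 < α)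
    (ha : ∀ x x', a x + ⟪πa x, x' - x⟫ - ‖x' - x‖ ^ 2 / (2 * α) ≤ a x')
    (hb : ∀ x x', b x + ⟪πb x, x' - x⟫ - ‖x' - x‖ ^ 2 / (2 * α) ≤ b x')
    {ψ : WithLp 2 (EuclideanSpace ℝ (Fin d) × EuclideanSpace ℝ (Fin d)) → ℝ}
    {z₀ : WithLp 2 (EuclideanSpace ℝ (Fin d) × EuclideanSpace ℝ (Fin d))}
    (hR : 1 < R) (hRR : R < R') (hψc : Continuous ψ) (hψ : ∀ z ∈ ball z₀ R', ContDiffAt ℝ 2 ψ z)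
    (hle : ∀ z, a z.fst + b z.snd ≤ ψ z + c) (h0 : a z₀.fst + b z₀.snd = ψ z₀ + c) :
    ∃ (z : ℕ → WithLp 2 (EuclideanSpace ℝ (Fin d) × EuclideanSpace ℝ (Fin d)))
      (B : ℕ → WithLp 2 (EuclideanSpace ℝ (Fin d) × EuclideanSpace ℝ (Fin d)) →L[ℝ]
        WithLp 2 (EuclideanSpace ℝ (Fin d) × EuclideanSpace ℝ (Fin d)))
      (ε : ℕ → ℝ) (A A' : ℕ → Matrix (Fin d) (Fin d) ℝ) (A₀ A₀' : Matrix (Fin d) (Fin d) ℝ),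
      (∀ k, ε k ≤ 1) ∧ (∀ k, ‖z k - z₀‖ ≤ ε k) ∧ Tendsto ε atTop (𝓝 0) ∧
      Tendsto (fun k => WithLp.toLp 2 (πa (z k).fst, πb (z k).snd)) atTop (𝓝 (gradient ψ z₀)) ∧
      (∀ k, ∀ z' ∈ closedBall z₀ R, (a z'.fst + b z'.snd) - (a (z k).fst + b (z k).snd) -
        ⟪WithLp.toLp 2 (πa (z k).fst, πb (z k).snd), z' - z k⟫ ≤
          ψ z' - ψ (z k) - ⟪gradient ψ (z k), z' - z k⟫ + ε k * ‖z' - z k‖ ^ 2) ∧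
      (∀ k, ∀ ε' > 0, ∃ ρ > 0, ∀ h, ‖h‖ ≤ ρ →
        |(a (z k + h).fst + b (z k + h).snd) - (a (z k).fst + b (z k).snd) -
          ⟪WithLp.toLp 2 (πa (z k).fst, πb (z k).snd), h⟫ - 1 / 2 * ⟪B k h, h⟫| ≤ ε' * ‖h‖ ^ 2) ∧
      (∀ k, (A k).IsSymm) ∧ (∀ k, (A' k).IsSymm) ∧
      (∀ k h, quadF (A k) h = ⟪B k (prodInl _ h), prodInl _ h⟫) ∧
      (∀ k h, quadF (A' k) h = ⟪B k (prodInr _ h), prodInr _ h⟫) ∧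
      Tendsto A atTop (𝓝 A₀) ∧ Tendsto A' atTop (𝓝 A₀') ∧
      ∀ ξ η, -(1 / α) * (‖ξ‖ ^ 2 + ‖η‖ ^ 2) ≤ quadF A₀ ξ + quadF A₀' η ∧
        quadF A₀ ξ + quadF A₀' η ≤
          fderiv ℝ (fderiv ℝ ψ) z₀ (WithLp.toLp 2 (ξ, η)) (WithLp.toLp 2 (ξ, η)) := by
  have hsub : closedBall z₀ R ⊆ ball z₀ R' := closedBall_subset_ball hRR
  have hz₀ : z₀ ∈ ball z₀ R' := mem_ball_self (by linarith)
  have hπ : ∀ z z' : WithLp 2 (EuclideanSpace ℝ (Fin d) × EuclideanSpace ℝ (Fin d)),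
      (a z.fst + b z.snd) + ⟪WithLp.toLp 2 (πa z.fst, πb z.snd), z' - z⟫ -
        ‖z' - z‖ ^ 2 / (2 * α) ≤ a z'.fst + b z'.snd := by
    intro z z'
    have h1 := ha z.fst z'.fst
    have h2 := hb z.snd z'.snd
    rw [WithLp.prod_norm_sq_eq_of_L2, WithLp.prod_inner_apply, WithLp.sub_fst, WithLp.sub_snd,
      add_div]
    simp only [WithLp.ofLp_fst, WithLp.ofLp_snd, WithLp.sub_fst, WithLp.sub_snd]
    linarith
  have hstep : ∀ k : ℕ, 0 < 1 / ((k : ℝ) + 1) ∧ 1 / ((k : ℝ) + 1) ≤ 1 := fun k => by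
    have : (0 : ℝ) ≤ k := k.cast_nonneg
    refine ⟨by positivity, ?_⟩
    rw [div_le_one (by positivity)]
    linarith
  choose z B hz hgrad hcon hexp hB using fun k : ℕ =>
    semiconvex_contact_points (w := fun z => a z.fst + b z.snd) hπ hψc.continuousOn
      (fun z hz => hψ z (hsub (ball_subset_closedBall hz))) (fun z _ => hle z) h0 (hstep k).1
      ((hstep k).2.trans_lt hR)
  have hε : Tendsto (fun k : ℕ => 1 / ((k : ℝ) + 1)) atTop (𝓝 0) :=
    tendsto_one_div_add_atTop_nhds_zero_nat
  have hzt : Tendsto z atTop (𝓝 z₀) := by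
    rw [tendsto_iff_norm_sub_tendsto_zero]
    exact squeeze_zero (fun _ => norm_nonneg _) hz hε
  have hgt : Tendsto (fun k => WithLp.toLp 2 (πa (z k).fst, πb (z k).snd)) atTop
      (𝓝 (gradient ψ z₀)) := by
    have h1 : Tendsto (fun k => gradient ψ (z k)) atTop (𝓝 (gradient ψ z₀)) :=
      ((hψ z₀ hz₀).gradient_contDiffAt.continuousAt.tendsto).comp hzt
    have h2 : Tendsto (fun k => WithLp.toLp 2 (πa (z k).fst, πb (z k).snd) - gradient ψ (z k))
        atTop (𝓝 0) := by
      refine squeeze_zero_norm hgrad ?_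
      simpa using ((hε.const_mul 2).mul hε).add hε
    simpa using h2.add h1
  choose A hAs hAq using fun k => exists_isSymm_quadF_eq
    ((ContinuousLinearMap.adjoint (prodInl (EuclideanSpace ℝ (Fin d))).toContinuousLinearMap).comp
      ((B k).comp (prodInl (EuclideanSpace ℝ (Fin d))).toContinuousLinearMap))
  choose A' hAs' hAq' using fun k => exists_isSymm_quadF_eq
    ((ContinuousLinearMap.adjoint (prodInr (EuclideanSpace ℝ (Fin d))).toContinuousLinearMap).comp
      ((B k).comp (prodInr (EuclideanSpace ℝ (Fin d))).toContinuousLinearMap))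
  replace hAq : ∀ k h, quadF (A k) h = ⟪B k (prodInl _ h), prodInl _ h⟫ := fun k h => by
    rw [hAq, ContinuousLinearMap.comp_apply, ContinuousLinearMap.adjoint_inner_left]
    rfl
  replace hAq' : ∀ k h, quadF (A' k) h = ⟪B k (prodInr _ h), prodInr _ h⟫ := fun k h => by
    rw [hAq', ContinuousLinearMap.comp_apply, ContinuousLinearMap.adjoint_inner_left]
    rfl
  obtain ⟨L, hL0, hL⟩ := exists_bound_fderiv_fderiv hRR hψ
  have hBb : ∀ k h, |⟪B k h, h⟫| ≤ (1 / α + L + 2) * ‖h‖ ^ 2 := by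
    intro k h
    obtain ⟨h1, h2⟩ := hB k h
    have h3 : fderiv ℝ (fderiv ℝ ψ) (z k) h h ≤ L * ‖h‖ * ‖h‖ := by
      refine (Real.le_norm_self _).trans ((ContinuousLinearMap.le_opNorm₂ _ _ _).trans ?_)
      gcongr
      refine hL _ (mem_closedBall_iff_norm.2 ((hz k).trans ((hstep k).2.trans hR.le)))
    have h4 : 0 < 1 / α := by positivity
    have h5 := (hstep k).2
    have h6 := sq_nonneg ‖h‖
    have h7 := (hstep k).1
    rw [abs_le]
    constructor
    · nlinarith
    · nlinarith [mul_nonneg h4.le h6, mul_le_mul_of_nonneg_right h5 h6]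
  obtain ⟨A₀, A₀', θ, hθ, hlim, hlim'⟩ := exists_subseq_tendsto_of_abs_quadF_le hAs hAs'
    (K := 1 / α + L + 2)
    (fun k h => by rw [hAq, ← (prodInl (EuclideanSpace ℝ (Fin d))).norm_map h]; exact hBb k _)
    (fun k h => by rw [hAq', ← (prodInr (EuclideanSpace ℝ (Fin d))).norm_map h]; exact hBb k _)
  have hθt := hθ.tendsto_atTop
  refine ⟨z ∘ θ, B ∘ θ, fun k => 1 / ((θ k : ℝ) + 1), A ∘ θ, A' ∘ θ, A₀, A₀',
    fun k => (hstep _).2, fun k => hz _, hε.comp hθt, hgt.comp hθt, fun k => hcon _,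
    fun k => hexp _, fun k => hAs _, fun k => hAs' _, fun k => hAq _, fun k => hAq' _, hlim,
    hlim', fun ξ η => ?_⟩
  have hq : Tendsto (fun k => quadF (A (θ k)) ξ + quadF (A' (θ k)) η) atTop
      (𝓝 (quadF A₀ ξ + quadF A₀' η)) :=
    (((continuous_quadF_matrix ξ).tendsto A₀).comp hlim).add
      (((continuous_quadF_matrix η).tendsto A₀').comp hlim')
  constructor
  · refine ge_of_tendsto' hq fun k => ?_
    have h1 := (hB (θ k) (prodInl _ ξ)).1
    have h2 := (hB (θ k) (prodInr _ η)).1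
    rw [LinearIsometry.norm_map] at h1 h2
    rw [hAq, hAq']
    linarith
  · have h1 : Tendsto (fun k => fderiv ℝ (fderiv ℝ ψ) (z (θ k)) (WithLp.toLp 2 (ξ, η))
        (WithLp.toLp 2 (ξ, η)) + 2 * (1 / ((θ k : ℝ) + 1)) * ‖WithLp.toLp 2 (ξ, η)‖ ^ 2) atTop
        (𝓝 (fderiv ℝ (fderiv ℝ ψ) z₀ (WithLp.toLp 2 (ξ, η)) (WithLp.toLp 2 (ξ, η)) +
          2 * 0 * ‖WithLp.toLp 2 (ξ, η)‖ ^ 2)) := by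
      refine Tendsto.add ?_ (((hε.comp hθt).const_mul 2).mul_const _)
      have h2 : Tendsto (fun k => fderiv ℝ (fderiv ℝ ψ) (z (θ k))) atTop
          (𝓝 (fderiv ℝ (fderiv ℝ ψ) z₀)) :=
        ((((hψ z₀ hz₀).fderiv_right (m := 1) (by norm_num)).fderiv_right
          (m := 0) (by norm_num)).continuousAt.tendsto).comp (hzt.comp hθt)
      have h3 : Continuous fun T : WithLp 2 (EuclideanSpace ℝ (Fin d) × EuclideanSpace ℝ (Fin d))
          →L[ℝ] WithLp 2 (EuclideanSpace ℝ (Fin d) × EuclideanSpace ℝ (Fin d)) →L[ℝ] ℝ =>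
          T (WithLp.toLp 2 (ξ, η)) (WithLp.toLp 2 (ξ, η)) := by fun_prop
      exact (h3.tendsto _).comp h2
    rw [mul_zero, zero_mul, add_zero] at h1
    refine le_of_tendsto_of_tendsto' hq h1 fun k => ?_
    rw [hAq, hAq']
    exact (inner_block_add_le (hexp (θ k)) ξ η).trans (hB (θ k) _).2

end SeparatedContact

theorem exists_matrices_of_regular_majorant {d : ℕ} {μ : Measure (EuclideanSpace ℝ (Fin d))}
    (hLevy : ∫⁻ z, ENNReal.ofReal (min (‖z‖ ^ 2) 1) ∂μ < ⊤)
    {cb : ℝ} (hcb : 0 < cb)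
    {j : EuclideanSpace ℝ (Fin d) → EuclideanSpace ℝ (Fin d) → EuclideanSpace ℝ (Fin d)}
    (hjm : Measurable (Function.uncurry j))
    (hjb : ∀ x z, ‖j x z‖ ≤ cb * ‖z‖)
    (hjc : ∀ z, Continuous fun x => j x z)
    {F : EuclideanSpace ℝ (Fin d) → ℝ → EuclideanSpace ℝ (Fin d) →
      Matrix (Fin d) (Fin d) ℝ → ℝ → ℝ}
    (hFc : Continuous fun ξ : EuclideanSpace ℝ (Fin d) × ℝ × EuclideanSpace ℝ (Fin d) ×
      Matrix (Fin d) (Fin d) ℝ × ℝ => F ξ.1 ξ.2.1 ξ.2.2.1 ξ.2.2.2.1 ξ.2.2.2.2)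
    (hFe : DegEll F)
    {u v : EuclideanSpace ℝ (Fin d) → ℝ} {Cu Cv : ℝ}
    (hu : UpperSemicontinuous u) (hub : ∀ x, |u x| ≤ Cu)
    (hv : LowerSemicontinuous v) (hvb : ∀ x, |v x| ≤ Cv)
    (husub : IsSubsolution F μ j u) (hvsuper : IsSupersolution F μ j v)
    {φ : EuclideanSpace ℝ (Fin d) → EuclideanSpace ℝ (Fin d) → ℝ}
    {xm ym : EuclideanSpace ℝ (Fin d)}
    (hmax : ∀ x y, u x - v y - φ x y ≤ u xm - v ym - φ xm ym)
    {p q : EuclideanSpace ℝ (Fin d)} {δ : ℝ} (hδ : 0 < δ) (hδ1 : δ < 1) {α : ℝ} (hα : 0 < α)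
    (hαu : 2 * Cu + ‖p‖ < 1 / (2 * α)) (hαv : 2 * Cv + ‖q‖ < 1 / (2 * α))
    {ψ : WithLp 2 (EuclideanSpace ℝ (Fin d) × EuclideanSpace ℝ (Fin d)) → ℝ}
    (hψc : Continuous ψ)
    (hψ : ∀ z ∈ ball (WithLp.toLp 2 (xm, ym)) (cb + 2), ContDiffAt ℝ 2 ψ z)
    (hψ0 : ψ (WithLp.toLp 2 (xm, ym)) = φ xm ym)
    (hgrad : gradient ψ (WithLp.toLp 2 (xm, ym)) = WithLp.toLp 2 (p, -q))
    (hψle : ∀ x y X Y, ‖X - x‖ ≤ 1 → ‖Y - y‖ ≤ 1 →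
      φ X Y - ⟪p, X - x⟫ - ⟪-q, Y - y⟫ - (‖X - x‖ ^ 2 + ‖Y - y‖ ^ 2) / (2 * α) ≤
        ψ (WithLp.toLp 2 (x, y))) :
    ∃ X Y : Matrix (Fin d) (Fin d) ℝ, X.IsSymm ∧ Y.IsSymm ∧
      F xm (u xm) p X
        (I1 μ j δ xm (fun x => ψ (WithLp.toLp 2 (x, ym))) + I2 μ j δ xm p u) ≤ 0 ∧
      F ym (v ym) q Y
        (I1 μ j δ ym (fun y => -ψ (WithLp.toLp 2 (xm, y))) + I2 μ j δ ym q v) ≥ 0 ∧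
      ∀ ξ η : EuclideanSpace ℝ (Fin d),
        -(1 / α) * (‖ξ‖ ^ 2 + ‖η‖ ^ 2) ≤ quadF X ξ - quadF Y η ∧
        quadF X ξ - quadF Y η ≤ fderiv ℝ (fderiv ℝ ψ) (WithLp.toLp 2 (xm, ym))
          (WithLp.toLp 2 (ξ, η)) (WithLp.toLp 2 (ξ, η)) := by
  obtain ⟨Xm, hXm, hJu⟩ := exists_tilted_maximizer hu hub p hαu
  have hv' : UpperSemicontinuous fun y => -v y := hv.neg
  have hvb' : ∀ y, |-v y| ≤ Cv := fun y => by rw [abs_neg]; exact hvb y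
  obtain ⟨Ym, hYm, hJv⟩ := exists_tilted_maximizer hv' hvb' (-q) (by rwa [norm_neg])
  set a := fun x => u (Xm x) - ⟪p, Xm x - x⟫ - ‖Xm x - x‖ ^ 2 / (2 * α) with ha
  set b := fun y => -v (Ym y) - ⟪-q, Ym y - y⟫ - ‖Ym y - y‖ ^ 2 / (2 * α) with hb
  set c := u xm - v ym - φ xm ym with hc
  have hle : ∀ z : WithLp 2 (EuclideanSpace ℝ (Fin d) × EuclideanSpace ℝ (Fin d)),
      a z.fst + b z.snd ≤ ψ z + c := fun z => by
    have h1 := hψle z.fst z.snd (Xm z.fst) (Ym z.snd) (hXm _) (hYm _)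
    have h2 := hmax (Xm z.fst) (Ym z.snd)
    rw [add_div] at h1
    have h3 : ψ (WithLp.toLp 2 (z.fst, z.snd)) = ψ z := rfl
    simp only [ha, hb]
    linarith
  have hau : u xm ≤ a xm := by simpa using hJu xm xm
  have hbv : -v ym ≤ b ym := by
    have h1 := hJv ym ym
    simp only [sub_self, inner_zero_right, norm_zero, ne_eq, OfNat.ofNat_ne_zero,
      not_false_eq_true, zero_pow, zero_div, sub_zero] at h1
    exact h1
  have hle0 := hle (WithLp.toLp 2 (xm, ym))
  rw [hψ0, WithLp.toLp_fst, WithLp.toLp_snd] at hle0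
  have hau' : a xm = u xm := by linarith
  have hbv' : b ym = -v ym := by linarith
  obtain ⟨z, B, ε, A, A', A₀, A₀', hε1, hzε, hεt, hπ, hcon, hexp, hAs, hAs', hAq, hAq', hAt, hAt',
    hbd⟩ := exists_separated_contact_sequence (a := a) (b := b) (R := cb + 1) (R' := cb + 2)
      hα (tilted_envelope_semiconvex hJu)
      (tilted_envelope_semiconvex hJv) (by linarith) (by linarith) hψc hψ hle
      (by rw [hψ0, WithLp.toLp_fst, WithLp.toLp_snd]; linarith)
  have hz : Tendsto z atTop (𝓝 (WithLp.toLp 2 (xm, ym))) := by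
    rw [tendsto_iff_norm_sub_tendsto_zero]
    exact squeeze_zero (fun _ => norm_nonneg _) hzε hεt
  have hfc : Continuous
      fun w : WithLp 2 (EuclideanSpace ℝ (Fin d) × EuclideanSpace ℝ (Fin d)) => w.fst := by
    fun_prop
  have hsc : Continuous
      fun w : WithLp 2 (EuclideanSpace ℝ (Fin d) × EuclideanSpace ℝ (Fin d)) => w.snd := by
    fun_prop
  have hπ' := hπ
  rw [hgrad] at hπ'
  obtain ⟨hx, hux⟩ := tendsto_tilted_maximizer (x₀ := xm) hα hJu ((hfc.tendsto _).comp hz)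
    ((hfc.tendsto _).comp hπ') hau'
  obtain ⟨hy, hvy⟩ := tendsto_tilted_maximizer (x₀ := ym) hα hJv ((hsc.tendsto _).comp hz)
    ((hsc.tendsto _).comp hπ') hbv'
  have hψd : DifferentiableAt ℝ ψ (WithLp.toLp 2 (xm, ym)) :=
    (hψ _ (mem_ball_self (by linarith))).differentiableAt (by norm_num)
  have hinl : ∀ h, ⟪p, h⟫ = ⟪gradient ψ (WithLp.toLp 2 (xm, ym)), prodInl _ h⟫ := fun h => by
    rw [hgrad, WithLp.prod_inner_apply]
    simp [prodInl_apply]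
  have hinr : ∀ h, ⟪-q, h⟫ = ⟪gradient ψ (WithLp.toLp 2 (xm, ym)), prodInr _ h⟫ := fun h => by
    rw [hgrad, WithLp.prod_inner_apply]
    simp [prodInr_apply]
  have hgf : gradient (fun x => ψ (WithLp.toLp 2 (x, ym))) xm = p :=
    ext_inner_right ℝ fun h => by rw [inner_gradient_partial_fst hψd, hinl]
  have hgs : gradient (fun y => ψ (WithLp.toLp 2 (xm, y))) ym = -q :=
    ext_inner_right ℝ fun h => by rw [inner_gradient_partial_snd hψd, hinr]
  have hFu := husub.le_zero_of_contact_sequence hLevy hcb hjm hjb hjc hFc hFe hu hub hδ hδ1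
    (prodInl _) hψc hψ rfl hε1 hzε hεt hπ hcon hexp
    (fun k h => by
      have := tilted_envelope_translate hJu (z k).fst h
      simpa [prodInl_apply, ha] using this) hAs hAq hx hux hAt hinl
  have hFv := hvsuper.neg.le_zero_of_contact_sequence hLevy hcb hjm hjb hjc
    (continuous_neg_reflect hFc) hFe.neg hv' hvb' hδ hδ1
    (prodInr _) hψc hψ rfl hε1 hzε hεt hπ hcon hexp
    (fun k h => by
      have := tilted_envelope_translate hJv (z k).snd h
      simpa [prodInr_apply, hb] using this) hAs' hAq' hy hvy hAt' hinr
  have hsymm : ∀ {M : ℕ → Matrix (Fin d) (Fin d) ℝ} {M₀ : Matrix (Fin d) (Fin d) ℝ},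
      (∀ k, (M k).IsSymm) → Tendsto M atTop (𝓝 M₀) → M₀.IsSymm := fun {M M₀} h1 h2 =>
    tendsto_nhds_unique
      (((Continuous.matrix_transpose continuous_id).tendsto M₀).comp h2)
      (h2.congr fun k => (h1 k).symm)
  refine ⟨A₀, -A₀', hsymm hAs hAt, (hsymm hAs' hAt').neg, ?_, ?_, fun ξ η => ?_⟩
  · rw [I1, hgf]
    simpa only [prodInl_apply, ← WithLp.toLp_add, Prod.mk_add_mk, add_zero] using hFu
  · rw [I1_neg, I1, hgs]
    simp only [prodInr_apply, ← WithLp.toLp_add, Prod.mk_add_mk, add_zero, I2_neg, neg_add,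
      neg_neg] at hFv
    linarith
  · rw [quadF_neg, sub_neg_eq_add]
    exact hbd ξ η

theorem tendsto_iteratedFDeriv_two_of_le {E : Type*} [NormedAddCommGroup E]
    [InnerProductSpace ℝ E] {Ψ : ℝ → WithLp 2 (E × E) → ℝ} {φ : WithLp 2 (E × E) → ℝ}
    {x : E × E} {α₀ C : ℝ} (hα₀ : 0 < α₀)
    (h : ∀ α, 0 < α → α < α₀ → ∀ h k,
      |fderiv ℝ (fderiv ℝ (Ψ α)) (WithLp.toLp 2 x) h k -
        fderiv ℝ (fderiv ℝ φ) (WithLp.toLp 2 x) h k| ≤ C * α * (‖h‖ * ‖k‖)) :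
    Tendsto (fun α => iteratedFDeriv ℝ 2 (fun xy : E × E => Ψ α (WithLp.toLp 2 xy)) x)
      (𝓝[>] 0) (𝓝 (iteratedFDeriv ℝ 2 (fun xy : E × E => φ (WithLp.toLp 2 xy)) x)) := by
  have hn : ∀ m : E × E, ‖WithLp.toLp 2 m‖ ≤ 2 * ‖m‖ := fun m => by
    have h1 := WithLp.prod_norm_sq_eq_of_L2 (WithLp.toLp 2 m)
    have h2 : ‖(WithLp.toLp 2 m).fst‖ ≤ ‖m‖ := norm_fst_le m
    have h3 : ‖(WithLp.toLp 2 m).snd‖ ≤ ‖m‖ := norm_snd_le m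
    refine abs_le_of_sq_le_sq' ?_ (by positivity) |>.2
    nlinarith [norm_nonneg (WithLp.toLp 2 m).fst, norm_nonneg (WithLp.toLp 2 m).snd]
  rw [tendsto_iff_norm_sub_tendsto_zero]
  have hlim : Tendsto (fun α : ℝ => |C| * α * 4) (𝓝[>] 0) (𝓝 0) := by
    have : Continuous fun α : ℝ => |C| * α * 4 := by fun_prop
    simpa using (this.tendsto 0).mono_left nhdsWithin_le_nhds
  refine squeeze_zero' (Eventually.of_forall fun _ => norm_nonneg _) ?_ hlim
  filter_upwards [Ioo_mem_nhdsGT hα₀] with α hα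
  have hα0 : 0 < α := hα.1
  refine ContinuousMultilinearMap.opNorm_le_bound (by positivity) fun m => ?_
  rw [sub_apply, iteratedFDeriv_two_comp_toLp, iteratedFDeriv_two_comp_toLp,
    Real.norm_eq_abs, Fin.prod_univ_two]
  refine (h α hα.1 hα.2 _ _).trans ?_
  calc C * α * (‖WithLp.toLp 2 (m 0)‖ * ‖WithLp.toLp 2 (m 1)‖)
      ≤ |C| * α * ((2 * ‖m 0‖) * (2 * ‖m 1‖)) := by
        gcongr
        · exact le_abs_self C
        · exact hn _
        · exact hn _
    _ = |C| * α * 4 * (‖m 0‖ * ‖m 1‖) := by ring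

/-- Corollary of the nonlocal Jensen-Ishii Lemma giving the two viscosity
inequalities at a global maximum point of `u(x) − v(y) − φ(x,y)`. -/
theorem statement7 {d : ℕ} (μ : Measure (EuclideanSpace ℝ (Fin d)))
    (hLevy : ∫⁻ z, ENNReal.ofReal (min (‖z‖ ^ 2) 1) ∂μ < ⊤)
    (cb : ℝ) (hcb : 0 < cb)
    (j : EuclideanSpace ℝ (Fin d) → EuclideanSpace ℝ (Fin d) → EuclideanSpace ℝ (Fin d))
    (hjm : Measurable (Function.uncurry j))
    (hjb : ∀ x z, ‖j x z‖ ≤ cb * ‖z‖)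
    (hjc : ∀ z, Continuous fun x => j x z)
    (F : EuclideanSpace ℝ (Fin d) → ℝ → EuclideanSpace ℝ (Fin d) →
      Matrix (Fin d) (Fin d) ℝ → ℝ → ℝ)
    (hFc : Continuous fun ξ : EuclideanSpace ℝ (Fin d) × ℝ × EuclideanSpace ℝ (Fin d) ×
      Matrix (Fin d) (Fin d) ℝ × ℝ => F ξ.1 ξ.2.1 ξ.2.2.1 ξ.2.2.2.1 ξ.2.2.2.2)
    (hFe : DegEll F)
    (u v : EuclideanSpace ℝ (Fin d) → ℝ)
    (hu : UpperSemicontinuous u) (hub : ∃ C, ∀ x, |u x| ≤ C)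
    (hv : LowerSemicontinuous v) (hvb : ∃ C, ∀ x, |v x| ≤ C)
    (husub : IsSubsolution F μ j u) (hvsuper : IsSupersolution F μ j v)
    (φ : EuclideanSpace ℝ (Fin d) → EuclideanSpace ℝ (Fin d) → ℝ)
    (hφ : ContDiff ℝ 2 (Function.uncurry φ))
    (xm ym : EuclideanSpace ℝ (Fin d))
    (hmax : ∀ x y, u x - v y - φ x y ≤ u xm - v ym - φ xm ym)
    (p q : EuclideanSpace ℝ (Fin d))
    (hp : p = gradient (fun x => φ x ym) xm)
    (hq : q = - gradient (fun y => φ xm y) ym) :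
    (∀ δ : ℝ, 0 < δ → δ < 1 →
      ∃ ab > (0:ℝ), ∀ α : ℝ, 0 < α → α < ab →
        ∃ X Y : Matrix (Fin d) (Fin d) ℝ, X.IsSymm ∧ Y.IsSymm ∧
          F xm (u xm) p X
            (I1 μ j δ xm (fun x => RsupP φ α x ym p (-q)) + I2 μ j δ xm p u) ≤ 0 ∧
          F ym (v ym) q Y
            (I1 μ j δ ym (fun y => -(RsupP φ α xm y p (-q))) + I2 μ j δ ym q v) ≥ 0 ∧
          (∀ ξ η : EuclideanSpace ℝ (Fin d),
            -(1 / α) * (‖ξ‖ ^ 2 + ‖η‖ ^ 2) ≤ quadF X ξ - quadF Y η ∧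
            quadF X ξ - quadF Y η ≤
              iteratedFDeriv ℝ 2
                (fun xy : EuclideanSpace ℝ (Fin d) × EuclideanSpace ℝ (Fin d) =>
                  RsupP φ α xy.1 xy.2 p (-q)) (xm, ym) ![(ξ, η), (ξ, η)])) ∧
    Tendsto (fun α : ℝ =>
        iteratedFDeriv ℝ 2
          (fun xy : EuclideanSpace ℝ (Fin d) × EuclideanSpace ℝ (Fin d) =>
            RsupP φ α xy.1 xy.2 p (-q)) (xm, ym))
      (𝓝[>] (0:ℝ)) (𝓝 (iteratedFDeriv ℝ 2 (Function.uncurry φ) (xm, ym))) := by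
  set φ' : WithLp 2 (EuclideanSpace ℝ (Fin d) × EuclideanSpace ℝ (Fin d)) → ℝ :=
    fun z => φ z.fst z.snd with hφ'
  set S := {w : WithLp 2 (EuclideanSpace ℝ (Fin d) × EuclideanSpace ℝ (Fin d)) |
    ‖w.fst‖ ≤ 1 ∧ ‖w.snd‖ ≤ 1} with hS
  obtain ⟨hSc, hS1, hS2⟩ : IsCompact S ∧ closedBall 0 1 ⊆ S ∧ S ⊆ closedBall 0 2 :=
    isCompact_unit_bicylinder
  have hφ'2 : ContDiff ℝ 2 φ' :=
    hφ.comp (WithLp.prodContinuousLinearEquiv 2 ℝ (EuclideanSpace ℝ (Fin d))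
      (EuclideanSpace ℝ (Fin d))).contDiff
  have hgrad : gradient φ' (WithLp.toLp 2 (xm, ym)) = WithLp.toLp 2 (p, -q) := by
    have hd : DifferentiableAt ℝ φ' (WithLp.toLp 2 (xm, ym)) :=
      hφ'2.contDiffAt.differentiableAt (by norm_num)
    refine ext_inner_right ℝ fun w => ?_
    rw [toLp_fst_snd_eq_add w, inner_add_right, ← inner_gradient_partial_fst hd,
      ← inner_gradient_partial_snd hd, ← toLp_fst_snd_eq_add w, WithLp.prod_inner_apply, hp, hq,
      neg_neg]
    rfl
  obtain ⟨α₀, hα₀, C, hreg⟩ := supConv_regular hφ'2 hSc hS1 hS2 (WithLp.toLp 2 (xm, ym)) hgrad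
    (R := cb + 2) (by linarith)
  simp only [RsupP_eq_supConv]
  refine ⟨fun δ hδ hδ1 => ?_, tendsto_iteratedFDeriv_two_of_le
    (Ψ := supConv S φ' (WithLp.toLp 2 (p, -q))) (φ := φ') hα₀ fun α h1 h2 => (hreg α h1 h2).2.2.2⟩
  obtain ⟨Cu, hCu⟩ := hub
  obtain ⟨Cv, hCv⟩ := hvb
  have hCu0 : 0 ≤ Cu := (abs_nonneg _).trans (hCu 0)
  have hCv0 : 0 ≤ Cv := (abs_nonneg _).trans (hCv 0)
  set D := 2 * Cu + 2 * Cv + ‖p‖ + ‖q‖ + 1 with hD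
  have hDp : 0 < D := by positivity
  refine ⟨min α₀ (1 / (2 * D)), by positivity, fun α hα hαlt => ?_⟩
  obtain ⟨hψ, hψ0, hψg, -⟩ := hreg α hα (hαlt.trans_le (min_le_left _ _))
  have hαD : D < 1 / (2 * α) := by
    have h1 := hαlt.trans_le (min_le_right _ _)
    rw [lt_div_iff₀ (by positivity)] at h1 ⊢
    linarith
  have hp0 := norm_nonneg p
  have hq0 := norm_nonneg q
  obtain ⟨X, Y, hX, hY, hFu, hFv, hXY⟩ := exists_matrices_of_regular_majorant hLevy hcb hjm hjb hjc
    hFc hFe hu hCu hv hCv husub hvsuper hmax hδ hδ1 hα (by linarith) (by linarith)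
    (ψ := supConv S φ' (WithLp.toLp 2 (p, -q)) α) (continuous_supConv hSc hφ'2.continuous _ _) hψ
    hψ0 hψg fun x y X Y hX hY => by
      obtain ⟨-, -, -, h1⟩ := exists_isMaxOn_supConv hSc ⟨0, hS1 (by simp)⟩ hφ'2.continuous
        (WithLp.toLp 2 (p, -q)) α (WithLp.toLp 2 (x, y))
      have h2 := h1 (WithLp.toLp 2 (X - x, Y - y)) ⟨hX, hY⟩
      simp only [hφ', WithLp.prod_norm_sq_eq_of_L2, WithLp.prod_inner_apply, WithLp.add_fst,
        WithLp.add_snd, WithLp.toLp_fst, WithLp.toLp_snd, add_sub_cancel] at h2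
      linarith
  refine ⟨X, Y, hX, hY, hFu, hFv, fun ξ η => ⟨(hXY ξ η).1, (hXY ξ η).2.trans_eq ?_⟩⟩
  rw [iteratedFDeriv_two_comp_toLp]
  rfl
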